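/- Let (X, F, μ, T) be a measure-preserving system, a ≠ b nonzero integers, and f, g ∈ L^∞(μ). Let I denote the σ-algebra of T^{b-a}-invariant sets. Then ∫ lim_N (1/N) ∑_{n=0}^{N-1} f(T^{an}x) g(T^{bn}x) dμ(x) = ∫ E[f | I] · E[g | I] dμ. -/

import Mathlib

/-- The σ-algebra of measurable sets invariant under a map `S : X → X` (a sub-σ-algebra
of the ambient σ-algebra). -/
def invariantSets {X : Type*} [MeasurableSpace X] (S : X → X) : MeasurableSpace X where
  MeasurableSet' A := MeasurableSet A ∧ S ⁻¹' A = A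
  measurableSet_empty := ⟨MeasurableSet.empty, by simp⟩
  measurableSet_compl A hA := ⟨hA.1.compl, by rw [Set.preimage_compl, hA.2]⟩
  measurableSet_iUnion f hf := ⟨MeasurableSet.iUnion fun i => (hf i).1, by
    rw [Set.preimage_iUnion]; exact Set.iUnion_congr fun i => (hf i).2⟩

section
namespace DR
open Finset

abbrev TT := UnitAddCircle

/-- character -/
noncomputable def ch (n : ℤ) (z : TT) : ℂ := fourier n z

lemma ch_zero_left (z : TT) : ch 0 z = 1 := by simp [ch]
lemma ch_zero_right (n : ℤ) : ch n 0 = 1 := by simp [ch]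
lemma norm_ch (n : ℤ) (z : TT) : ‖ch n z‖ = 1 := by
  rw [ch, fourier_apply]; exact Circle.norm_coe _
lemma ch_add_left (m n : ℤ) (z : TT) : ch (m + n) z = ch m z * ch n z := by
  simp [ch]
lemma ch_add_right (n : ℤ) (z w : TT) : ch n (z + w) = ch n z * ch n w := by
  simp [ch, fourier_apply, smul_add, AddCircle.toCircle_add]
lemma ch_zsmul (n m : ℤ) (z : TT) : ch n (m • z) = ch (n * m) z := by
  simp [ch, fourier_apply, mul_smul]
lemma ch_neg_left (n : ℤ) (z : TT) : ch (-n) z = (starRingEnd ℂ) (ch n z) := by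
  simp [ch]
lemma ch_neg_right (n : ℤ) (z : TT) : ch n (-z) = (starRingEnd ℂ) (ch n z) := by
  rw [← ch_neg_left]; simp [ch, fourier_apply]
lemma ch_ne_zero (n : ℤ) (z : TT) : ch n z ≠ 0 := by
  intro h; have := norm_ch n z; rw [h] at this; simp at this
lemma ch_sub_left (m n : ℤ) (z : TT) : ch (m - n) z = ch m z * (starRingEnd ℂ) (ch n z) := by
  rw [sub_eq_add_neg, ch_add_left, ch_neg_left]
lemma continuous_ch (n : ℤ) : Continuous (ch n) := by
  unfold ch; exact (fourier n).continuous

lemma ch_nat (n : ℕ) (z : TT) : ch n z = (ch 1 z) ^ n := by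
  induction n with
  | zero => simp [ch_zero_left]
  | succ k ih => push_cast; rw [ch_add_left, ih, pow_succ]

lemma ch_mul_conj (n : ℤ) (z : TT) : ch n z * (starRingEnd ℂ) (ch n z) = 1 := by
  rw [Complex.mul_conj, Complex.normSq_eq_norm_sq, norm_ch]; simp

/-- choose representative -/
lemma exists_rep (z : TT) : ∃ t : ℝ, (t : TT) = z ∧ |t| = ‖z‖ ∧ |t| ≤ 1 / 2 := by
  induction z using QuotientAddGroup.induction_on with
  | H x =>
    refine ⟨x - round x, ?_, ?_, ?_⟩
    · show ((x - round x : ℝ) : TT) = (x : TT)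
      rw [AddCircle.coe_sub]
      have : ((round x : ℝ) : TT) = 0 := by
        have := AddCircle.coe_eq_zero_iff (p := (1:ℝ)) (x := (round x : ℝ))
        rw [this]; exact ⟨round x, by simp⟩
      rw [this]; simp
    · exact (UnitAddCircle.norm_eq (x := x)).symm
    · exact abs_sub_round x

lemma ch_coe (n : ℤ) (t : ℝ) : ch n (t : TT) = Complex.exp (2 * Real.pi * Complex.I * n * t) := by
  simp [ch]

lemma norm_ch_one_sub_one (t : ℝ) : ‖ch 1 (t : TT) - 1‖ = 2 * |Real.sin (Real.pi * t)| := by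
  rw [ch_coe]
  have := Complex.norm_exp_I_mul_ofReal_sub_one (2 * Real.pi * t)
  have e : (2 * Real.pi * Complex.I * (1:ℤ) * t : ℂ) = Complex.I * ((2 * Real.pi * t : ℝ) : ℂ) := by
    push_cast; ring
  rw [e, this, norm_mul, Real.norm_eq_abs, Real.norm_eq_abs]
  have : 2 * Real.pi * t / 2 = Real.pi * t := by ring
  rw [this]; simp

lemma norm_ch_one_sub_one_ge (z : TT) : 4 * ‖z‖ ≤ ‖ch 1 z - 1‖ := by
  obtain ⟨t, rfl, h1, h2⟩ := exists_rep z
  rw [norm_ch_one_sub_one, ← h1]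
  have : |Real.sin (Real.pi * t)| = Real.sin (Real.pi * |t|) := by
    rcases le_total 0 t with h | h
    · rw [abs_of_nonneg h, abs_of_nonneg]
      rw [abs_of_nonneg h] at h2
      apply Real.sin_nonneg_of_nonneg_of_le_pi (by positivity)
      nlinarith [Real.pi_pos]
    · rw [abs_of_nonpos h]
      rw [abs_of_nonpos h] at h2
      rw [abs_of_nonpos, mul_neg, Real.sin_neg]
      have : 0 ≤ Real.sin (Real.pi * (-t)) := by
        apply Real.sin_nonneg_of_nonneg_of_le_pi
        · apply mul_nonneg Real.pi_pos.le; linarith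
        · nlinarith [Real.pi_pos]
      rw [mul_neg, Real.sin_neg] at this; linarith
  rw [this]
  have := Real.mul_le_sin (x := Real.pi * |t|) (by positivity) (by nlinarith [Real.pi_pos])
  have e : 2 / Real.pi * (Real.pi * |t|) = 2 * |t| := by field_simp
  rw [e] at this; linarith

lemma norm_ch_sub_one_le (n : ℤ) (z : TT) : ‖ch n z - 1‖ ≤ 2 * Real.pi * |(n:ℝ)| * ‖z‖ := by
  obtain ⟨t, rfl, h1, h2⟩ := exists_rep z
  rw [ch_coe, ← h1]
  have e : (2 * Real.pi * Complex.I * n * t : ℂ) = Complex.I * ((2 * Real.pi * n * t : ℝ) : ℂ) := by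
    push_cast; ring
  rw [e]
  refine (Real.norm_exp_I_mul_ofReal_sub_one_le).trans ?_
  rw [Real.norm_eq_abs, abs_mul, abs_mul, abs_of_pos (by positivity : (0:ℝ) < 2 * Real.pi)]

/-- Dirichlet kernel -/
noncomputable def Dir (N : ℕ) (z : TT) : ℂ := (N : ℂ)⁻¹ * ∑ h ∈ range N, ch h z

lemma norm_Dir_le_one (N : ℕ) (z : TT) : ‖Dir N z‖ ≤ 1 := by
  unfold Dir
  rw [norm_mul, norm_inv, Complex.norm_natCast]
  have : ‖∑ h ∈ range N, ch h z‖ ≤ N := by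
    refine (norm_sum_le _ _).trans ?_
    simp [norm_ch]
  rcases Nat.eq_zero_or_pos N with h | h
  · subst h; simp
  · have : (0:ℝ) < N := by exact_mod_cast h
    rw [inv_mul_le_iff₀ this]; simpa

lemma norm_Dir_le (N : ℕ) (z : TT) (hN : 0 < N) (c : ℝ) (hc : 0 < c) (hz : c ≤ ‖z‖) :
    ‖Dir N z‖ ≤ 1 / (2 * N * c) := by
  have hz0 : 0 < ‖z‖ := hc.trans_le hz
  have h4 := norm_ch_one_sub_one_ge z
  have hne : ch 1 z ≠ 1 := by
    intro h; rw [h, sub_self, norm_zero] at h4; linarith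
  have hN' : (0:ℝ) < N := by exact_mod_cast hN
  unfold Dir
  rw [norm_mul, norm_inv, Complex.norm_natCast]
  have e : ∑ h ∈ range N, ch h z = (ch 1 z ^ N - 1) / (ch 1 z - 1) := by
    rw [← geom_sum_eq hne]; exact sum_congr rfl fun i _ => ch_nat i z
  rw [e, norm_div]
  have h2 : ‖ch 1 z ^ N - 1‖ ≤ 2 := by
    refine (norm_sub_le _ _).trans ?_
    rw [norm_pow, norm_ch]; norm_num
  have h3 : ‖ch 1 z ^ N - 1‖ / ‖ch 1 z - 1‖ ≤ 2 / (4 * c) := by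
    gcongr; linarith
  calc (N:ℝ)⁻¹ * (‖ch 1 z ^ N - 1‖ / ‖ch 1 z - 1‖) ≤ (N:ℝ)⁻¹ * (2 / (4 * c)) := by gcongr
    _ = 1 / (2 * N * c) := by field_simp; norm_num

end DR
end

section
namespace DR
open Finset

abbrev Om (N H D : ℕ) := Fin N × (Fin D → Fin H × Fin H)

def ph {N H D : ℕ} (ω : Om N H D) : ℤ :=
  (ω.1 : ℕ) + ∑ i, (((ω.2 i).1 : ℕ) - ((ω.2 i).2 : ℕ) : ℤ)

/-- smoothed average at the origin -/
noncomputable def av (N H D : ℕ) (v : ℤ → ℂ) : ℂ :=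
  ((N : ℂ) * ((H : ℂ) ^ 2) ^ D)⁻¹ * ∑ ω : Om N H D, v (ph ω)

noncomputable def mu (N H D : ℕ) (z : TT) : ℂ := av N H D (fun n => ch n z)

def rad (N H D : ℕ) : ℕ := N + D * H

lemma card_Om (N H D : ℕ) : (Fintype.card (Om N H D) : ℂ) = (N : ℂ) * ((H : ℂ) ^ 2) ^ D := by
  simp [Om, sq]

lemma abs_ph_sum_le {H D : ℕ} (p : Fin D → Fin H × Fin H) :
    |∑ i, (((p i).1 : ℕ) - ((p i).2 : ℕ) : ℤ)| ≤ D * H := by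
  refine (abs_sum_le_sum_abs _ _).trans ?_
  refine (sum_le_card_nsmul _ _ (H : ℤ) ?_).trans (by simp)
  intro i _
  have h1 := (p i).1.2
  have h2 := (p i).2.2
  rw [abs_le]; constructor <;> omega

lemma abs_ph_le {N H D : ℕ} (ω : Om N H D) : |ph ω| ≤ rad N H D := by
  unfold ph rad
  have h := abs_ph_sum_le ω.2
  have h1 := ω.1.2
  rw [abs_le] at h ⊢
  push_cast
  constructor <;> linarith [h.1, h.2, (by exact_mod_cast h1.le : ((ω.1 : ℕ) : ℤ) ≤ N), (by positivity : (0:ℤ) ≤ ((ω.1 : ℕ) : ℤ))]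

lemma av_congr {N H D : ℕ} {v w : ℤ → ℂ} (h : ∀ n : ℤ, |n| ≤ rad N H D → v n = w n) :
    av N H D v = av N H D w := by
  unfold av
  congr 1
  exact sum_congr rfl fun ω _ => h _ (abs_ph_le ω)

lemma av_add {N H D : ℕ} (v w : ℤ → ℂ) :
    av N H D (fun n => v n + w n) = av N H D v + av N H D w := by
  simp only [av, sum_add_distrib, mul_add]

lemma av_sub {N H D : ℕ} (v w : ℤ → ℂ) :
    av N H D (fun n => v n - w n) = av N H D v - av N H D w := by
  simp only [av, sum_sub_distrib, mul_sub]

lemma av_mul_left {N H D : ℕ} (c : ℂ) (v : ℤ → ℂ) :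
    av N H D (fun n => c * v n) = c * av N H D v := by
  simp only [av, ← mul_sum]; ring

lemma av_sum {N H D : ℕ} {ι : Type*} (s : Finset ι) (v : ι → ℤ → ℂ) :
    av N H D (fun n => ∑ i ∈ s, v i n) = ∑ i ∈ s, av N H D (v i) := by
  simp only [av]
  rw [sum_comm, mul_sum]

lemma norm_av_le_sum {N H D : ℕ} (v : ℤ → ℂ) :
    ‖av N H D v‖ ≤ ((N : ℝ) * ((H : ℝ) ^ 2) ^ D)⁻¹ * ∑ ω : Om N H D, ‖v (ph ω)‖ := by
  unfold av
  rw [norm_mul, norm_inv, norm_mul, norm_pow, norm_pow, Complex.norm_natCast, Complex.norm_natCast]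
  gcongr
  exact norm_sum_le _ _

lemma norm_av_le {N H D : ℕ} (v : ℤ → ℂ) (C : ℝ) (hC : 0 ≤ C)
    (h : ∀ n : ℤ, |n| ≤ rad N H D → ‖v n‖ ≤ C) : ‖av N H D v‖ ≤ C := by
  refine (norm_av_le_sum v).trans ?_
  have h1 : ∑ ω : Om N H D, ‖v (ph ω)‖ ≤ ∑ ω : Om N H D, C :=
    sum_le_sum fun ω _ => h _ (abs_ph_le ω)
  have h2 : ∑ ω : Om N H D, C = ((N : ℝ) * ((H : ℝ) ^ 2) ^ D) * C := by
    simp [Om, sq]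
  rw [h2] at h1
  calc _ ≤ ((N : ℝ) * ((H : ℝ) ^ 2) ^ D)⁻¹ * (((N : ℝ) * ((H : ℝ) ^ 2) ^ D) * C) := by gcongr
    _ ≤ C := by
      rw [← mul_assoc]
      by_cases h0 : ((N : ℝ) * ((H : ℝ) ^ 2) ^ D) = 0
      · rw [h0]; simpa
      · rw [inv_mul_cancel₀ h0, one_mul]

lemma norm_av_le_l1 {N H D : ℕ} (v : ℤ → ℂ) :
    ‖av N H D v‖ ≤ (N : ℝ)⁻¹ * ∑ n ∈ Icc (-(rad N H D : ℤ)) (rad N H D), ‖v n‖ := by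
  refine (norm_av_le_sum v).trans ?_
  rw [Fintype.sum_prod_type_right]
  have key : ∀ p : Fin D → Fin H × Fin H, ∑ h : Fin N, ‖v (ph (N := N) (h, p))‖ ≤
      ∑ n ∈ Icc (-(rad N H D : ℤ)) (rad N H D), ‖v n‖ := by
    intro p
    have inj : Function.Injective (fun h : Fin N => ph (N := N) (h, p)) := by
      intro h h' e
      simp only [ph] at e
      exact Fin.ext (by omega)
    rw [← sum_image (f := fun n => ‖v n‖) (s := univ) (g := fun h : Fin N => ph (N := N) (h, p))
      (fun x _ y _ e => inj e)]
    apply sum_le_sum_of_subset_of_nonneg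
    · intro n hn
      simp only [mem_image, mem_univ, true_and] at hn
      obtain ⟨h, rfl⟩ := hn
      have := abs_ph_le (N := N) (h, p)
      rw [abs_le] at this
      simp [this.1, this.2]
    · intros; positivity
  have h2 := sum_le_sum fun p (_ : p ∈ (univ : Finset (Fin D → Fin H × Fin H))) => key p
  rw [sum_const, nsmul_eq_mul] at h2
  have h3 : ((univ : Finset (Fin D → Fin H × Fin H)).card : ℝ) = ((H : ℝ) ^ 2) ^ D := by
    simp [sq]
  rw [h3] at h2
  set S := ∑ n ∈ Icc (-(rad N H D : ℤ)) (rad N H D), ‖v n‖ with hS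
  have hS0 : 0 ≤ S := sum_nonneg fun _ _ => norm_nonneg _
  calc _ ≤ ((N : ℝ) * ((H : ℝ) ^ 2) ^ D)⁻¹ * (((H : ℝ) ^ 2) ^ D * S) := by gcongr
    _ = (N : ℝ)⁻¹ * (((((H : ℝ) ^ 2) ^ D)⁻¹ * ((H : ℝ) ^ 2) ^ D) * S) := by
      rw [mul_inv]; ring
    _ ≤ (N : ℝ)⁻¹ * S := by
      gcongr
      by_cases h0 : ((H : ℝ) ^ 2) ^ D = 0
      · rw [h0]; simpa
      · rw [inv_mul_cancel₀ h0, one_mul]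

lemma ch_sum {ι : Type*} (s : Finset ι) (f : ι → ℤ) (z : TT) :
    ch (∑ i ∈ s, f i) z = ∏ i ∈ s, ch (f i) z := by
  classical
  induction s using Finset.induction_on with
  | empty => simp [ch_zero_left]
  | insert a s ha ih => rw [sum_insert ha, prod_insert ha, ch_add_left, ih]

lemma mu_eq (N H D : ℕ) (z : TT) : mu N H D z = Dir N z * ((‖Dir H z‖ ^ 2 : ℝ) : ℂ) ^ D := by
  unfold mu av
  have e : ∀ ω : Om N H D, ch (ph ω) z =
      ch ((ω.1 : ℕ) : ℤ) z * ∏ i, ch (((ω.2 i).1 : ℕ) - ((ω.2 i).2 : ℕ) : ℤ) z := by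
    intro ω; rw [ph, ch_add_left, ch_sum]
  simp only [e]
  rw [Fintype.sum_prod_type]
  simp only [← mul_sum]
  rw [← sum_mul, ← Fintype.sum_pow (fun p : Fin H × Fin H => ch ((p.1 : ℕ) - (p.2 : ℕ) : ℤ) z) D]
  have e2 : ∑ p : Fin H × Fin H, ch ((p.1 : ℕ) - (p.2 : ℕ) : ℤ) z =
      (H : ℂ) ^ 2 * ((‖Dir H z‖ ^ 2 : ℝ) : ℂ) := by
    rw [Fintype.sum_prod_type]
    simp only [ch_sub_left, ← mul_sum]
    rw [← sum_mul, ← map_sum, Complex.mul_conj, Complex.normSq_eq_norm_sq]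
    rw [Fin.sum_univ_eq_sum_range (fun h => ch (h : ℤ) z) H]
    unfold Dir
    rw [norm_mul, norm_inv, Complex.norm_natCast, mul_pow]
    push_cast
    rcases Nat.eq_zero_or_pos H with h | h
    · subst h; simp
    · have : (H : ℂ) ≠ 0 := by exact_mod_cast h.ne'
      field_simp
  rw [e2, Fin.sum_univ_eq_sum_range (fun h => ch (h : ℤ) z) N]
  unfold Dir
  rcases Nat.eq_zero_or_pos H with h | h
  · subst h
    rcases Nat.eq_zero_or_pos D with h | h
    · subst h; simp
    · simp [h.ne']
  · have : (H : ℂ) ≠ 0 := by exact_mod_cast h.ne'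
    rw [mul_inv, mul_pow]
    field_simp

lemma norm_mu (N H D : ℕ) (z : TT) : ‖mu N H D z‖ = ‖Dir N z‖ * (‖Dir H z‖ ^ 2) ^ D := by
  rw [mu_eq, norm_mul, norm_pow, Complex.norm_real]; simp

lemma norm_mu_le_one (N H D : ℕ) (z : TT) : ‖mu N H D z‖ ≤ 1 := by
  rw [norm_mu]
  have := norm_Dir_le_one N z
  have h2 := norm_Dir_le_one H z
  have h3 : (‖Dir H z‖ ^ 2) ^ D ≤ 1 := pow_le_one₀ (by positivity) (pow_le_one₀ (by positivity) h2)
  exact mul_le_one₀ this (by positivity) h3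

lemma norm_mu_le_mul (N H D : ℕ) (hD : 1 ≤ D) (z : TT) : ‖mu N H D z‖ ≤ ‖Dir N z‖ * ‖Dir H z‖ := by
  rw [norm_mu, ← pow_mul]
  have h2 := norm_Dir_le_one H z
  gcongr
  calc _ ≤ ‖Dir H z‖ ^ 1 := pow_le_pow_of_le_one (by positivity) h2 (by omega)
    _ = _ := pow_one _

lemma norm_mu_far (N H D : ℕ) (hH : 0 < H) (z : TT) (c : ℝ) (hc : 0 < c) (hz : c ≤ ‖z‖) :
    ‖mu N H D z‖ ≤ (1 / (2 * H * c)) ^ (2 * D) := by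
  rw [norm_mu, ← pow_mul]
  have h1 := norm_Dir_le_one N z
  have h2 := norm_Dir_le H z hH c hc hz
  calc _ ≤ 1 * (1 / (2 * H * c)) ^ (2 * D) := by gcongr
    _ = _ := one_mul _

lemma av_one {N H D : ℕ} (hN : 0 < N) (hH : 0 < H) : av N H D (fun _ => 1) = 1 := by
  unfold av
  have := card_Om N H D
  rw [sum_const, nsmul_eq_mul, mul_one, card_univ, this]
  apply inv_mul_cancel₀
  have : (H : ℂ) ≠ 0 := by exact_mod_cast hH.ne'
  have : (N : ℂ) ≠ 0 := by exact_mod_cast hN.ne'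
  positivity

lemma norm_mu_sub_one (N H D : ℕ) (hN : 0 < N) (hH : 0 < H) (z : TT) :
    ‖mu N H D z - 1‖ ≤ 2 * Real.pi * rad N H D * ‖z‖ := by
  rw [← av_one (D := D) hN hH, mu, ← av_sub]
  apply norm_av_le _ _ (by positivity)
  intro n hn
  refine (norm_ch_sub_one_le n z).trans ?_
  have : |(n : ℝ)| ≤ rad N H D := by exact_mod_cast hn
  gcongr

end DR
end

section
namespace DR
open Finset

section F
variable {P : ℕ} [Fact P.Prime]

noncomputable def ps (x : ZMod P) : ℂ := ch 1 (ZMod.toAddCircle x)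

lemma ps_add (x y : ZMod P) : ps (x + y) = ps x * ps y := by
  rw [ps, map_add, ch_add_right]; rfl
lemma ps_zero : ps (0 : ZMod P) = 1 := by rw [ps, map_zero, ch_zero_right]
lemma norm_ps (x : ZMod P) : ‖ps x‖ = 1 := norm_ch _ _
lemma ps_neg (x : ZMod P) : ps (-x) = (starRingEnd ℂ) (ps x) := by
  rw [ps, map_neg, ch_neg_right]; rfl
lemma ps_mul_conj (x : ZMod P) : ps x * (starRingEnd ℂ) (ps x) = 1 := ch_mul_conj _ _

lemma ch_toAddCircle (n : ℤ) (γ : ZMod P) : ch n (ZMod.toAddCircle γ) = ps ((n : ZMod P) * γ) := by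
  rw [ps, ← zsmul_eq_mul, map_zsmul, ch_zsmul, one_mul]

lemma ps_eq_one_iff (x : ZMod P) : ps x = 1 ↔ x = 0 := by
  constructor
  · intro h
    have := norm_ch_one_sub_one_ge (ZMod.toAddCircle x)
    rw [ps] at h
    rw [h, sub_self, norm_zero] at this
    have h0 : ZMod.toAddCircle x = 0 := by
      rw [← norm_le_zero_iff]; linarith
    apply ZMod.toAddCircle_injective P
    rw [h0, map_zero]
  · rintro rfl; exact ps_zero

lemma sum_ps (x : ZMod P) : ∑ γ : ZMod P, ps (x * γ) = if x = 0 then (P : ℂ) else 0 := by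
  split_ifs with h
  · subst h; simp [ps_zero, ZMod.card]
  · have h1 : ∑ γ : ZMod P, ps (x * γ) = ps x * ∑ γ : ZMod P, ps (x * γ) := by
      conv_lhs => rw [← Equiv.sum_comp (Equiv.addRight (1 : ZMod P))]
      rw [mul_sum]
      refine sum_congr rfl fun γ _ => ?_
      simp only [Equiv.coe_addRight]
      rw [mul_add, mul_one, ps_add, mul_comm]
    have h2 : ps x ≠ 1 := fun e => h ((ps_eq_one_iff x).1 e)
    have h3 : (ps x - 1) * ∑ γ : ZMod P, ps (x * γ) = 0 := by
      rw [sub_mul, one_mul, ← h1, sub_self]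
    rcases mul_eq_zero.1 h3 with h4 | h4
    · exact absurd (sub_eq_zero.1 h4) h2
    · exact h4

noncomputable def ft (f : ZMod P → ℂ) (γ : ZMod P) : ℂ := ∑ x, f x * ps (-(x * γ))

lemma P_ne : (P : ℂ) ≠ 0 := by
  have := (Fact.out : P.Prime).ne_zero; exact_mod_cast this

lemma ft_inv (f : ZMod P → ℂ) (x : ZMod P) : ∑ γ, ft f γ * ps (x * γ) = P * f x := by
  unfold ft
  simp only [sum_mul]
  rw [sum_comm]
  have : ∀ y : ZMod P, ∑ γ, f y * ps (-(y * γ)) * ps (x * γ) = if x = y then P * f y else 0 := by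
    intro y
    have e : ∀ γ, f y * ps (-(y * γ)) * ps (x * γ) = f y * ps ((x - y) * γ) := by
      intro γ; rw [mul_assoc, ← ps_add]; congr 2; ring
    simp only [e]
    rw [← mul_sum, sum_ps]
    simp only [sub_eq_zero]
    split_ifs <;> ring
  simp only [this]
  rw [sum_ite_eq]; simp

lemma parseval (f : ZMod P → ℂ) : ∑ γ, ‖ft f γ‖ ^ 2 = P * ∑ x, ‖f x‖ ^ 2 := by
  have h : ∑ γ, ft f γ * (starRingEnd ℂ) (ft f γ) = P * ∑ x, f x * (starRingEnd ℂ) (f x) := by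
    have e : ∀ γ, (starRingEnd ℂ) (ft f γ) = ∑ x, (starRingEnd ℂ) (f x) * ps (x * γ) := by
      intro γ
      rw [ft, map_sum]
      refine sum_congr rfl fun x _ => ?_
      rw [map_mul, ps_neg, Complex.conj_conj]
    simp only [e, mul_sum]
    rw [sum_comm]
    refine sum_congr rfl fun x _ => ?_
    have : ∀ γ, ft f γ * ((starRingEnd ℂ) (f x) * ps (x * γ)) =
      (starRingEnd ℂ) (f x) * (ft f γ * ps (x * γ)) := fun γ => by ring
    simp only [this]
    rw [← mul_sum, ft_inv]; ring
  simp only [Complex.mul_conj, Complex.normSq_eq_norm_sq] at h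
  exact_mod_cast h

/-- lift of a function on a finite set of integers -/
noncomputable def lf (P : ℕ) (Q : Finset ℤ) (c : ℤ → ℂ) (z : ZMod P) : ℂ :=
  ∑ y ∈ Q, if (y : ZMod P) = z then c y else 0

lemma sum_lf (Q : Finset ℤ) (c : ℤ → ℂ) (φ : ZMod P → ℂ) :
    ∑ z, lf P Q c z * φ z = ∑ y ∈ Q, c y * φ (y : ZMod P) := by
  unfold lf
  simp only [sum_mul]
  rw [sum_comm]
  refine sum_congr rfl fun y _ => ?_
  rw [sum_eq_single (y : ZMod P)]
  · simp
  · intro z _ hz; rw [if_neg (Ne.symm hz)]; simp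
  · simp

lemma lf_apply {Q : Finset ℤ} (hQ : Set.InjOn (fun y : ℤ => (y : ZMod P)) Q) (c : ℤ → ℂ) {y : ℤ}
    (hy : y ∈ Q) : lf P Q c (y : ZMod P) = c y := by
  unfold lf
  rw [sum_eq_single y]
  · simp
  · intro z hz hne
    rw [if_neg]; intro e; exact hne (hQ hz hy e)
  · intro h; exact absurd hy h

lemma sum_lf_sq {Q : Finset ℤ} (hQ : Set.InjOn (fun y : ℤ => (y : ZMod P)) Q) (c : ℤ → ℂ) :
    ∑ z, ‖lf P Q c z‖ ^ 2 = ∑ y ∈ Q, ‖c y‖ ^ 2 := by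
  have h : ∑ z, lf P Q c z * (starRingEnd ℂ) (lf P Q c z) = ∑ y ∈ Q, c y * (starRingEnd ℂ) (c y) := by
    rw [sum_lf Q c (fun z => (starRingEnd ℂ) (lf P Q c z))]
    refine sum_congr rfl fun y hy => ?_
    rw [lf_apply hQ c hy]
  simp only [Complex.mul_conj, Complex.normSq_eq_norm_sq] at h
  exact_mod_cast h

lemma ft_lf (Q : Finset ℤ) (c : ℤ → ℂ) (γ : ZMod P) :
    ft (lf P Q c) γ = ∑ y ∈ Q, c y * ch y (ZMod.toAddCircle (-γ)) := by
  unfold ft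
  rw [sum_lf Q c (fun z => ps (-(z * γ)))]
  refine sum_congr rfl fun y _ => ?_
  rw [ch_toAddCircle, mul_neg]

lemma sum_Dir_sq (N : ℕ) (hN : 0 < N) (hNP : N ≤ P) (s : TT) :
    ∑ γ : ZMod P, ‖Dir N (ZMod.toAddCircle γ + s)‖ ^ 2 = P / N := by
  set Q : Finset ℤ := (range N).image (fun h : ℕ => (h : ℤ)) with hQd
  have hQ : Set.InjOn (fun y : ℤ => (y : ZMod P)) Q := by
    intro y hy z hz e
    simp only [hQd, coe_image, Set.mem_image, mem_coe, mem_range] at hy hz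
    obtain ⟨h, hh, rfl⟩ := hy
    obtain ⟨h', hh', rfl⟩ := hz
    simp only [Int.cast_natCast] at e
    rw [ZMod.natCast_eq_natCast_iff'] at e
    rw [Nat.mod_eq_of_lt (by omega), Nat.mod_eq_of_lt (by omega)] at e
    rw [e]
  have h := parseval (lf P Q (fun y => (N : ℂ)⁻¹ * ch y s))
  rw [sum_lf_sq hQ] at h
  simp only [ft_lf, norm_mul, norm_ch, norm_inv, Complex.norm_natCast, mul_one, sum_const] at h
  have hc : Q.card = N := by rw [hQd, card_image_of_injective _ Nat.cast_injective]; simp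
  rw [hc, nsmul_eq_mul] at h
  rw [← Equiv.sum_comp (Equiv.neg (ZMod P))]
  have hN' : (N : ℝ) ≠ 0 := by exact_mod_cast hN.ne'
  have e : (P : ℝ) * (N * (N : ℝ)⁻¹ ^ 2) = P / N := by field_simp
  rw [← e, ← h]
  refine sum_congr rfl fun γ _ => ?_
  congr 2
  rw [hQd, sum_image (fun x _ y _ e => Nat.cast_injective e), Dir, mul_sum]
  refine sum_congr rfl fun h _ => ?_
  rw [ch_add_right]; simp only [Equiv.neg_apply]; ring

/-- mean of `|mu|` is at most `M` along all shifts -/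
def MeanLe (P : ℕ) [Fact P.Prime] (N H D : ℕ) (M : ℝ) : Prop :=
  ∀ s : TT, ∑ γ : ZMod P, ‖mu N H D (ZMod.toAddCircle γ + s)‖ ≤ P * M

lemma meanLe_gen (N H D : ℕ) (hD : 1 ≤ D) (hN : 0 < N) (hH : 0 < H) (hNP : N ≤ P) (hHP : H ≤ P) :
    MeanLe P N H D (1 / Real.sqrt (N * H)) := by
  intro s
  have h1 : ∑ γ : ZMod P, ‖mu N H D (ZMod.toAddCircle γ + s)‖ ≤
      ∑ γ : ZMod P, ‖Dir N (ZMod.toAddCircle γ + s)‖ * ‖Dir H (ZMod.toAddCircle γ + s)‖ :=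
    sum_le_sum fun γ _ => norm_mu_le_mul N H D hD _
  refine h1.trans ((Real.sum_mul_le_sqrt_mul_sqrt _ _ _).trans ?_)
  rw [sum_Dir_sq N hN hNP, sum_Dir_sq H hH hHP, ← Real.sqrt_mul (by positivity)]
  have : (P : ℝ) / N * (P / H) = P ^ 2 / (N * H) := by
    field_simp
  rw [this, Real.sqrt_div (by positivity), Real.sqrt_sq (by positivity)]
  apply le_of_eq; ring

lemma Dir_one (z : TT) : Dir 1 z = 1 := by simp [Dir, ch_zero_left]

lemma norm_mu_one_le (H D : ℕ) (hD : 1 ≤ D) (z : TT) : ‖mu 1 H D z‖ ≤ ‖Dir H z‖ ^ 2 := by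
  rw [norm_mu, Dir_one, norm_one, one_mul]
  have h2 := norm_Dir_le_one H z
  calc _ ≤ (‖Dir H z‖ ^ 2) ^ 1 :=
        pow_le_pow_of_le_one (by positivity) (pow_le_one₀ (by positivity) h2) hD
    _ = _ := pow_one _

lemma meanLe_one (H D : ℕ) (hD : 1 ≤ D) (hH : 0 < H) (hHP : H ≤ P) :
    MeanLe P 1 H D (1 / H) := by
  intro s
  refine (sum_le_sum fun γ _ => norm_mu_one_le H D hD _).trans ?_
  rw [sum_Dir_sq H hH hHP]
  apply le_of_eq; ring

/-- pointwise linear estimate -/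
lemma linear_est {N H D : ℕ} {M : ℝ} (hM : MeanLe P N H D M) {Q : Finset ℤ}
    (hQ : Set.InjOn (fun y : ℤ => (y : ZMod P)) Q) (a : ℤ) (ha : (a : ZMod P) ≠ 0)
    (U : ℤ → ℂ) (A : ℝ) (hA : ∀ θ : TT, ‖∑ y ∈ Q, U y * ch y θ‖ ≤ A) (x : ℤ)
    (hx : ∀ n : ℤ, |n| ≤ rad N H D → x + a * n ∈ Q) (s : TT) :
    ‖av N H D (fun n => U (x + a * n) * ch n s)‖ ≤ A * M := by
  have hA0 : 0 ≤ A := (norm_nonneg _).trans (hA 0)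
  have hP : (0:ℝ) < P := by exact_mod_cast (Fact.out : P.Prime).pos
  have e1 : av N H D (fun n => U (x + a * n) * ch n s) =
      (P : ℂ)⁻¹ * ∑ γ : ZMod P, (ft (lf P Q U) γ * ps ((x : ZMod P) * γ)) *
        mu N H D (ZMod.toAddCircle ((a : ZMod P) * γ) + s) := by
    have : av N H D (fun n => U (x + a * n) * ch n s) = av N H D (fun n => (P : ℂ)⁻¹ *
        ∑ γ : ZMod P, (ft (lf P Q U) γ * ps ((x : ZMod P) * γ)) *
          ch n (ZMod.toAddCircle ((a : ZMod P) * γ) + s)) := by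
      apply av_congr
      intro n hn
      have h := ft_inv (lf P Q U) ((x + a * n : ℤ) : ZMod P)
      rw [lf_apply hQ U (hx n hn)] at h
      have : U (x + a * n) = (P : ℂ)⁻¹ * (P * U (x + a * n)) := by
        rw [← mul_assoc, inv_mul_cancel₀ P_ne, one_mul]
      rw [this, ← h, mul_assoc, sum_mul]
      congr 1
      refine sum_congr rfl fun γ _ => ?_
      rw [ch_add_right, ch_toAddCircle]
      push_cast
      rw [add_mul, ps_add]
      have : (a : ZMod P) * n * γ = n * (a * γ) := by ring
      rw [this]; ring
    rw [this, av_mul_left, av_sum]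
    congr 1
    refine sum_congr rfl fun γ _ => ?_
    rw [av_mul_left]; rfl
  rw [e1, norm_mul, norm_inv, Complex.norm_natCast]
  have h2 : ‖∑ γ : ZMod P, (ft (lf P Q U) γ * ps ((x : ZMod P) * γ)) *
        mu N H D (ZMod.toAddCircle ((a : ZMod P) * γ) + s)‖ ≤ A * (P * M) := by
    refine (norm_sum_le _ _).trans ?_
    calc _ ≤ ∑ γ : ZMod P, A * ‖mu N H D (ZMod.toAddCircle ((a : ZMod P) * γ) + s)‖ := by
          refine sum_le_sum fun γ _ => ?_
          rw [norm_mul, norm_mul, norm_ps, mul_one, ft_lf]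
          gcongr
          exact hA _
      _ = A * ∑ γ : ZMod P, ‖mu N H D (ZMod.toAddCircle γ + s)‖ := by
          rw [← mul_sum, ← Equiv.sum_comp (Equiv.mulLeft₀ (a : ZMod P) ha)
            (fun γ => ‖mu N H D (ZMod.toAddCircle γ + s)‖)]
          rfl
      _ ≤ _ := by gcongr; exact hM s
  calc _ ≤ (P : ℝ)⁻¹ * (A * (P * M)) := by gcongr
    _ = A * M := by field_simp

lemma sum_V_sq (a b : ZMod P) (ha : a ≠ 0) (hab : a ≠ b) (U W : ZMod P → ℂ) (A : ℝ)
    (hA : ∀ γ, ‖ft U γ‖ ≤ A) (γ : ZMod P) :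
    ∑ x, ‖∑ n, U (x + a * n) * W (x + b * n) * ps (-(n * γ))‖ ^ 2 ≤ A ^ 2 * ∑ x, ‖W x‖ ^ 2 := by
  have hba : b - a ≠ 0 := sub_ne_zero.2 hab.symm
  have hA0 : 0 ≤ A := (norm_nonneg _).trans (hA 0)
  have hP : (0:ℝ) < P := by exact_mod_cast (Fact.out : P.Prime).pos
  set V : ZMod P → ℂ := fun x => ∑ n, U (x + a * n) * W (x + b * n) * ps (-(n * γ)) with hV
  set β : ZMod P → ZMod P := fun τ => (γ - a * τ) / (b - a) with hβ
  have key : ∀ τ, ft V τ = ft U (τ - β τ) * ft W (β τ) := by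
    intro τ
    unfold ft
    rw [sum_mul_sum]
    simp only [hV, sum_mul]
    rw [← sum_product', ← sum_product']
    refine sum_bij' (fun p _ => (p.1 + a * p.2, p.1 + b * p.2))
      (fun q _ => ((b * q.1 - a * q.2) / (b - a), (q.2 - q.1) / (b - a))) ?_ ?_ ?_ ?_ ?_
    · simp
    · simp
    · rintro ⟨x, n⟩ _; ext <;> simp <;> field_simp <;> ring
    · rintro ⟨x, n⟩ _; ext <;> simp <;> field_simp <;> ring
    · rintro ⟨x, n⟩ _
      simp only
      have : -(n * γ) + -(x * τ) = -((x + a * n) * (τ - β τ)) + -((x + b * n) * β τ) := by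
        simp only [hβ]; field_simp; ring
      have h2 : ps (-(n * γ)) * ps (-(x * τ)) =
          ps (-((x + a * n) * (τ - β τ))) * ps (-((x + b * n) * β τ)) := by
        rw [← ps_add, ← ps_add, this]
      calc _ = U (x + a * n) * W (x + b * n) * (ps (-(n * γ)) * ps (-(x * τ))) := by ring
        _ = _ := by rw [h2]; ring
  have hbij : Function.Bijective β := by
    apply Function.Injective.bijective_of_finite
    intro t t' e
    simp only [hβ] at e
    have := (div_left_inj' hba).1 e
    have h3 : a * t = a * t' := by linear_combination -this
    exact mul_left_cancel₀ ha h3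
  have h1 := parseval V
  have h2 := parseval W
  have h3 : ∑ τ, ‖ft V τ‖ ^ 2 ≤ A ^ 2 * ∑ τ, ‖ft W τ‖ ^ 2 := by
    rw [mul_sum, ← hbij.sum_comp (fun τ => A ^ 2 * ‖ft W τ‖ ^ 2)]
    refine sum_le_sum fun τ _ => ?_
    rw [key, norm_mul, mul_pow]
    gcongr
    exact hA _
  rw [h1, h2] at h3
  have h4 : (P : ℝ) * ∑ x, ‖V x‖ ^ 2 ≤ P * (A ^ 2 * ∑ x, ‖W x‖ ^ 2) := by linarith
  exact le_of_mul_le_mul_left h4 hP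

/-- bilinear `L²` estimate -/
lemma bilinear_est {N H D : ℕ} {M : ℝ} (hM : MeanLe P N H D M) {Q : Finset ℤ}
    (hQ : Set.InjOn (fun y : ℤ => (y : ZMod P)) Q) (a b : ℤ) (ha : (a : ZMod P) ≠ 0)
    (hab : (a : ZMod P) ≠ b)
    (U W : ℤ → ℂ) (A : ℝ) (hA : ∀ θ : TT, ‖∑ y ∈ Q, U y * ch y θ‖ ≤ A) (S : Finset ℤ) (hSQ : S ⊆ Q)
    (hx : ∀ x ∈ S, ∀ n : ℤ, |n| ≤ rad N H D → x + a * n ∈ Q ∧ x + b * n ∈ Q) :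
    ∑ x ∈ S, ‖av N H D (fun n => U (x + a * n) * W (x + b * n))‖ ^ 2 ≤
      (A * M) ^ 2 * ∑ y ∈ Q, ‖W y‖ ^ 2 := by
  have hP : (0:ℝ) < P := by exact_mod_cast (Fact.out : P.Prime).pos
  have hM0 : 0 ≤ P * M := (sum_nonneg fun _ _ => norm_nonneg _).trans (hM 0)
  set U' := lf P Q U
  set W' := lf P Q W
  set V : ZMod P → ZMod P → ℂ := fun x γ =>
    ∑ n, U' (x + a * n) * W' (x + b * n) * ps (-(n * γ)) with hV
  have hm : ∑ γ : ZMod P, ‖mu N H D (ZMod.toAddCircle γ)‖ ≤ P * M := by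
    simpa using hM 0
  have e1 : ∀ x ∈ S, av N H D (fun n => U (x + a * n) * W (x + b * n)) =
      (P : ℂ)⁻¹ * ∑ γ : ZMod P, V x γ * mu N H D (ZMod.toAddCircle γ) := by
    intro x hxS
    have : av N H D (fun n => U (x + a * n) * W (x + b * n)) = av N H D (fun n => (P : ℂ)⁻¹ *
        ∑ γ : ZMod P, V x γ * ch n (ZMod.toAddCircle γ)) := by
      apply av_congr
      intro n hn
      have h := ft_inv (fun n : ZMod P => U' (x + a * n) * W' (x + b * n)) (n : ZMod P)
      obtain ⟨h1, h2⟩ := hx x hxS n hn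
      have l1 : U' (x + a * n) = U (x + a * n) := by
        rw [← lf_apply hQ U h1]; push_cast; rfl
      have l2 : W' (x + b * n) = W (x + b * n) := by
        rw [← lf_apply hQ W h2]; push_cast; rfl
      rw [l1, l2] at h
      have : U (x + a * n) * W (x + b * n) = (P : ℂ)⁻¹ * (P * (U (x + a * n) * W (x + b * n))) := by
        rw [← mul_assoc, inv_mul_cancel₀ P_ne, one_mul]
      rw [this, ← h]
      congr 1
      refine sum_congr rfl fun γ _ => ?_
      rw [ch_toAddCircle]; rfl
    rw [this, av_mul_left, av_sum]
    congr 1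
    refine sum_congr rfl fun γ _ => ?_
    rw [av_mul_left]; rfl
  have e2 : ∀ x ∈ S, ‖av N H D (fun n => U (x + a * n) * W (x + b * n))‖ ^ 2 ≤
      ((P : ℝ)⁻¹) ^ 2 * ((P * M) * ∑ γ : ZMod P, ‖mu N H D (ZMod.toAddCircle γ)‖ * ‖V x γ‖ ^ 2) := by
    intro x hxS
    rw [e1 x hxS, norm_mul, norm_inv, Complex.norm_natCast, mul_pow]
    gcongr
    have h1 : ‖∑ γ : ZMod P, V x γ * mu N H D (ZMod.toAddCircle γ)‖ ≤
        ∑ γ : ZMod P, ‖mu N H D (ZMod.toAddCircle γ)‖ * ‖V x γ‖ := by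
      refine (norm_sum_le _ _).trans (le_of_eq ?_)
      refine sum_congr rfl fun γ _ => ?_
      rw [norm_mul, mul_comm]
    have h2 : (∑ γ : ZMod P, ‖mu N H D (ZMod.toAddCircle γ)‖ * ‖V x γ‖) ^ 2 ≤
        (∑ γ : ZMod P, ‖mu N H D (ZMod.toAddCircle γ)‖) *
          ∑ γ : ZMod P, ‖mu N H D (ZMod.toAddCircle γ)‖ * ‖V x γ‖ ^ 2 := by
      apply sum_sq_le_sum_mul_sum_of_sq_le_mul
      · intros; positivity
      · intros; positivity
      · intros; apply le_of_eq; ring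
    calc _ ≤ (∑ γ : ZMod P, ‖mu N H D (ZMod.toAddCircle γ)‖ * ‖V x γ‖) ^ 2 := by gcongr
      _ ≤ _ := h2
      _ ≤ _ := by gcongr
  have e3 : ∀ γ, ∑ x ∈ S, ‖V x γ‖ ^ 2 ≤ A ^ 2 * ∑ y ∈ Q, ‖W y‖ ^ 2 := by
    intro γ
    rw [← sum_lf_sq hQ W]
    refine le_trans ?_ (sum_V_sq (a : ZMod P) b ha hab U' W' A ?_ γ)
    · rw [← sum_image (f := fun z : ZMod P => ‖V z γ‖ ^ 2) (s := S) (g := fun x : ℤ => (x : ZMod P))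
        (fun x hx y hy e => hQ (hSQ hx) (hSQ hy) e)]
      exact sum_le_sum_of_subset_of_nonneg (subset_univ _) (fun _ _ _ => by positivity)
    · intro γ'
      rw [ft_lf]; exact hA _
  set E := A ^ 2 * ∑ y ∈ Q, ‖W y‖ ^ 2 with hE
  have hE0 : 0 ≤ E := by positivity
  calc _ ≤ ∑ x ∈ S, ((P : ℝ)⁻¹) ^ 2 *
        ((P * M) * ∑ γ : ZMod P, ‖mu N H D (ZMod.toAddCircle γ)‖ * ‖V x γ‖ ^ 2) := sum_le_sum e2
    _ = ((P : ℝ)⁻¹) ^ 2 *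
        ((P * M) * ∑ γ : ZMod P, ‖mu N H D (ZMod.toAddCircle γ)‖ * ∑ x ∈ S, ‖V x γ‖ ^ 2) := by
        rw [← mul_sum, ← mul_sum, sum_comm]
        simp only [mul_sum]
    _ ≤ ((P : ℝ)⁻¹) ^ 2 *
        ((P * M) * ∑ γ : ZMod P, ‖mu N H D (ZMod.toAddCircle γ)‖ * E) := by
        gcongr with γ _
        exact e3 γ
    _ = ((P : ℝ)⁻¹) ^ 2 *
        ((P * M) * ((∑ γ : ZMod P, ‖mu N H D (ZMod.toAddCircle γ)‖) * E)) := by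
        rw [sum_mul]
    _ ≤ ((P : ℝ)⁻¹) ^ 2 * ((P * M) * ((P * M) * E)) := by gcongr
    _ = _ := by rw [hE]; field_simp

end F
end DR
end

section
namespace DR
open Finset

lemma exists_P (Q : Finset ℤ) (B : ℕ) : ∃ P : ℕ, ∃ _ : Fact P.Prime,
    Set.InjOn (fun y : ℤ => (y : ZMod P)) Q ∧ B < P := by
  obtain ⟨C, hC⟩ : ∃ C : ℕ, ∀ y ∈ Q, |y| ≤ C := by
    refine ⟨∑ y ∈ Q, y.natAbs, fun y hy => ?_⟩
    have := single_le_sum (f := fun y : ℤ => y.natAbs) (fun _ _ => Nat.zero_le _) hy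
    rw [Int.abs_eq_natAbs]; exact_mod_cast this
  obtain ⟨P, hP, hp⟩ := Nat.exists_infinite_primes (2 * C + B + 1)
  refine ⟨P, ⟨hp⟩, ?_, by omega⟩
  intro y hy z hz e
  simp only at e
  rw [ZMod.intCast_eq_intCast_iff_dvd_sub] at e
  have h1 := hC y hy
  have h2 := hC z hz
  rw [abs_le] at h1 h2
  have h3 : z - y = 0 := by
    apply Int.eq_zero_of_abs_lt_dvd e
    rw [abs_lt]; constructor <;> omega
  omega

lemma intCast_ne_zero_of_lt {P : ℕ} {a : ℤ} (ha : a ≠ 0) (h : a.natAbs < P) : (a : ZMod P) ≠ 0 := by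
  intro e
  rw [ZMod.intCast_zmod_eq_zero_iff_dvd] at e
  exact ha (Int.eq_zero_of_abs_lt_dvd e (by rw [Int.abs_eq_natAbs]; exact_mod_cast h))

lemma linear_bound {N H D : ℕ} (hD : 1 ≤ D) (hN : 0 < N) (hH : 0 < H) {Q : Finset ℤ}
    (a : ℤ) (ha : a ≠ 0)
    (U : ℤ → ℂ) (A : ℝ) (hA : ∀ θ : TT, ‖∑ y ∈ Q, U y * ch y θ‖ ≤ A) (x : ℤ)
    (hx : ∀ n : ℤ, |n| ≤ rad N H D → x + a * n ∈ Q) (s : TT) :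
    ‖av N H D (fun n => U (x + a * n) * ch n s)‖ ≤ A * (1 / Real.sqrt (N * H)) := by
  obtain ⟨P, hP, hinj, hB⟩ := exists_P Q (N + H + a.natAbs)
  exact linear_est (P := P) (meanLe_gen N H D hD hN hH (by omega) (by omega)) hinj a
    (intCast_ne_zero_of_lt ha (by omega)) U A hA x hx s

lemma linear_bound_one {H D : ℕ} (hD : 1 ≤ D) (hH : 0 < H) {Q : Finset ℤ}
    (a : ℤ) (ha : a ≠ 0)
    (U : ℤ → ℂ) (A : ℝ) (hA : ∀ θ : TT, ‖∑ y ∈ Q, U y * ch y θ‖ ≤ A) (x : ℤ)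
    (hx : ∀ n : ℤ, |n| ≤ rad 1 H D → x + a * n ∈ Q) (s : TT) :
    ‖av 1 H D (fun n => U (x + a * n) * ch n s)‖ ≤ A * (1 / H) := by
  obtain ⟨P, hP, hinj, hB⟩ := exists_P Q (H + a.natAbs)
  exact linear_est (P := P) (meanLe_one H D hD hH (by omega)) hinj a
    (intCast_ne_zero_of_lt ha (by omega)) U A hA x hx s

lemma bilinear_bound {N H D : ℕ} (hD : 1 ≤ D) (hN : 0 < N) (hH : 0 < H) {Q : Finset ℤ}
    (a b : ℤ) (ha : a ≠ 0) (hab : a ≠ b)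
    (U W : ℤ → ℂ) (A : ℝ) (hA : ∀ θ : TT, ‖∑ y ∈ Q, U y * ch y θ‖ ≤ A) (S : Finset ℤ) (hSQ : S ⊆ Q)
    (hx : ∀ x ∈ S, ∀ n : ℤ, |n| ≤ rad N H D → x + a * n ∈ Q ∧ x + b * n ∈ Q) :
    ∑ x ∈ S, ‖av N H D (fun n => U (x + a * n) * W (x + b * n))‖ ^ 2 ≤
      (A ^ 2 / (N * H)) * ∑ y ∈ Q, ‖W y‖ ^ 2 := by
  obtain ⟨P, hP, hinj, hB⟩ := exists_P Q (N + H + a.natAbs + (a - b).natAbs)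
  have h := bilinear_est (P := P) (meanLe_gen N H D hD hN hH (by omega) (by omega)) hinj a b
    (intCast_ne_zero_of_lt ha (by omega)) (by
      have := intCast_ne_zero_of_lt (P := P) (sub_ne_zero.2 hab) (by omega)
      push_cast at this
      exact sub_ne_zero.1 this) U W A hA S hSQ hx
  have e : (A * (1 / Real.sqrt (N * H))) ^ 2 = A ^ 2 / (N * H) := by
    rw [mul_pow, div_pow, Real.sq_sqrt (by positivity)]; ring
  rwa [e] at h

end DR
end

section
namespace DR
open Finset

section clusters
variable {ι : Type*}

/-- proximity graph -/
def pg (pt : ι → TT) (r : ℝ) (Z : Finset ι) : SimpleGraph ι where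
  Adj i j := i ≠ j ∧ i ∈ Z ∧ j ∈ Z ∧ ‖pt i - pt j‖ < r
  symm := ⟨fun i j h => ⟨h.1.symm, h.2.2.1, h.2.1, by rw [norm_sub_rev]; exact h.2.2.2⟩⟩
  loopless := ⟨fun i h => h.1 rfl⟩

def conn (pt : ι → TT) (r : ℝ) (Z : Finset ι) (i j : ι) : Prop := (pg pt r Z).Reachable i j

open Classical in
noncomputable def cls (pt : ι → TT) (r : ℝ) (Z : Finset ι) (i : ι) : Finset ι :=
  Z.filter (fun j => conn pt r Z i j)

open Classical in
/-- number of clusters -/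
noncomputable def cl (pt : ι → TT) (r : ℝ) (Z : Finset ι) : ℕ := (Z.image (cls pt r Z)).card

variable {pt : ι → TT} {r r' : ℝ} {Z Z' : Finset ι}

lemma conn_refl (i : ι) : conn pt r Z i i := SimpleGraph.Reachable.refl _
lemma conn_symm {i j : ι} (h : conn pt r Z i j) : conn pt r Z j i := SimpleGraph.Reachable.symm h
lemma conn_trans {i j k : ι} (h : conn pt r Z i j) (h' : conn pt r Z j k) : conn pt r Z i k :=
  SimpleGraph.Reachable.trans h h'

lemma conn_mono (hr : r ≤ r') (hZ : Z ⊆ Z') {i j : ι} (h : conn pt r Z i j) : conn pt r' Z' i j := by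
  refine SimpleGraph.Reachable.mono ?_ h
  intro i j h
  exact ⟨h.1, hZ h.2.1, hZ h.2.2.1, h.2.2.2.trans_le hr⟩

lemma conn_of_lt {i j : ι} (hi : i ∈ Z) (hj : j ∈ Z) (h : ‖pt i - pt j‖ < r) : conn pt r Z i j := by
  by_cases e : i = j
  · subst e; exact conn_refl _
  · exact SimpleGraph.Adj.reachable (G := pg pt r Z) ⟨e, hi, hj, h⟩

lemma cls_eq_iff {i j : ι} (hj : j ∈ Z) : cls pt r Z i = cls pt r Z j ↔ conn pt r Z i j := by
  constructor
  · intro h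
    have : j ∈ cls pt r Z j := by simp [cls, hj, conn_refl]
    rw [← h] at this
    simp only [cls, mem_filter] at this
    exact this.2
  · intro h
    ext k
    simp only [cls, mem_filter]
    exact ⟨fun hk => ⟨hk.1, conn_trans (conn_symm h) hk.2⟩, fun hk => ⟨hk.1, conn_trans h hk.2⟩⟩

lemma card_image_le_card_image {α β γ : Type*} [DecidableEq β] [DecidableEq γ] (s : Finset α)
    (f : α → β) (g : α → γ)
    (h : ∀ i ∈ s, ∀ j ∈ s, f i = f j → g i = g j) : (s.image g).card ≤ (s.image f).card := by
  classical
  rcases s.eq_empty_or_nonempty with rfl | ⟨i0, _⟩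
  · simp
  haveI : Nonempty α := ⟨i0⟩
  choose! k hk using fun (b : β) (hb : b ∈ s.image f) => mem_image.1 hb
  have : s.image g ⊆ (s.image f).image (fun b => g (k b)) := by
    intro c hc
    obtain ⟨i, hi, rfl⟩ := mem_image.1 hc
    have hb := mem_image_of_mem f hi
    refine mem_image.2 ⟨f i, hb, ?_⟩
    exact h _ (hk _ hb).1 _ hi (hk _ hb).2
  exact (card_le_card this).trans card_image_le

lemma cl_anti (hr : r ≤ r') : cl pt r' Z ≤ cl pt r Z := by
  classical
  unfold cl
  apply card_image_le_card_image
  intro i hi j hj h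
  rw [cls_eq_iff hj] at h ⊢
  exact conn_mono hr (subset_refl _) h

lemma cl_le_card : cl pt r Z ≤ Z.card := by
  classical
  unfold cl; exact card_image_le

lemma cl_subset (hZ : Z ⊆ Z') : cl pt r Z' + Z.card ≤ cl pt r Z + Z'.card := by
  classical
  have h1 : Z'.image (cls pt r Z') = Z.image (cls pt r Z') ∪ (Z' \ Z).image (cls pt r Z') := by
    rw [← image_union, union_sdiff_of_subset hZ]
  have h2 : (Z.image (cls pt r Z')).card ≤ cl pt r Z := by
    unfold cl
    apply card_image_le_card_image
    intro i hi j hj h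
    rw [cls_eq_iff hj] at h
    rw [cls_eq_iff (hZ hj)]
    exact conn_mono le_rfl hZ h
  have h3 : ((Z' \ Z).image (cls pt r Z')).card ≤ (Z' \ Z).card := card_image_le
  have h4 : (Z' \ Z).card + Z.card = Z'.card := card_sdiff_add_card_eq_card hZ
  have h5 : cl pt r Z' ≤ (Z.image (cls pt r Z')).card + ((Z' \ Z).image (cls pt r Z')).card := by
    have h0 : cl pt r Z' = (Z'.image (cls pt r Z')).card := by unfold cl; congr!
    rw [h0, h1]; exact card_union_le _ _
  omega

lemma walk_norm_le {i j : ι} (w : (pg pt r Z).Walk i j) :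
    ‖pt i - pt j‖ ≤ w.length * r := by
  induction w with
  | nil => simp
  | cons h p ih =>
    rename_i u v t
    have h1 : ‖pt u - pt v‖ < r := h.2.2.2
    have h2 : ‖pt u - pt t‖ ≤ ‖pt u - pt v‖ + ‖pt v - pt t‖ := by
      have := norm_add_le (pt u - pt v) (pt v - pt t)
      rwa [sub_add_sub_cancel] at this
    rw [SimpleGraph.Walk.length_cons]
    push_cast
    linarith

lemma walk_support {i j : ι} (hi : i ∈ Z) (w : (pg pt r Z).Walk i j) : ∀ k ∈ w.support, k ∈ Z := by
  induction w with
  | nil => simpa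
  | cons h p ih =>
    intro k hk
    rw [SimpleGraph.Walk.support_cons, List.mem_cons] at hk
    rcases hk with rfl | hk
    · exact hi
    · exact ih h.2.2.1 k hk

lemma conn_norm_le {i j : ι} (hr : 0 ≤ r) (hi : i ∈ Z) (h : conn pt r Z i j) :
    ‖pt i - pt j‖ ≤ Z.card * r := by
  classical
  obtain ⟨w, hw⟩ := SimpleGraph.Reachable.exists_isPath h
  refine (walk_norm_le w).trans ?_
  have h1 : w.support.toFinset ⊆ Z := fun k hk => walk_support hi w k (List.mem_toFinset.1 hk)
  have h2 := card_le_card h1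
  rw [List.toFinset_card_of_nodup hw.support_nodup, SimpleGraph.Walk.length_support] at h2
  have : (w.length : ℝ) ≤ Z.card := by exact_mod_cast (Nat.le_of_succ_le h2)
  gcongr

lemma exists_U (pt : ι → TT) (A B : ℝ) (hA : 0 ≤ A) (hAB : A ≤ B) (Z Y : Finset ι) (hY : Y ⊆ Z) :
    ∃ U ⊆ Z, Y ⊆ U ∧ (∀ i ∈ U, ∀ j ∈ Z, j ∉ U → B ≤ ‖pt i - pt j‖) ∧
      (∀ i ∈ Z, i ∉ U → ∀ j ∈ Z, j ∉ U → B ≤ ‖pt i - pt j‖ ∨ ‖pt i - pt j‖ ≤ Z.card * A) ∧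
      ∃ C ⊆ U, C.card ≤ 2 * (cl pt A Z - cl pt B Z) + Y.card ∧
        ∀ i ∈ U, ∃ c ∈ C, ‖pt i - pt c‖ ≤ Z.card * A := by
  classical
  set U1 := Z.filter (fun i => ∃ j ∈ Z, conn pt B Z i j ∧ ¬ conn pt A Z i j) with hU1
  set U2 := (Z \ U1).filter (fun i => ∃ y ∈ Y, conn pt B Z i y) with hU2
  have m1 : ∀ i, i ∈ U1 ↔ i ∈ Z ∧ ∃ j ∈ Z, conn pt B Z i j ∧ ¬ conn pt A Z i j := by
    intro i; rw [hU1, mem_filter]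
  have m2 : ∀ i, i ∈ U2 ↔ (i ∈ Z ∧ i ∉ U1) ∧ ∃ y ∈ Y, conn pt B Z i y := by
    intro i; rw [hU2, mem_filter, mem_sdiff]
  have inv1 : ∀ i ∈ U1, ∀ j ∈ Z, conn pt B Z i j → j ∈ U1 := by
    intro i hi j hj hij
    rw [m1] at hi ⊢
    obtain ⟨hiZ, k, hk, hik, hnk⟩ := hi
    refine ⟨hj, ?_⟩
    by_cases hc : conn pt A Z j i
    · exact ⟨k, hk, conn_trans (conn_symm hij) hik, fun h => hnk (conn_trans (conn_symm hc) h)⟩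
    · exact ⟨i, hiZ, conn_symm hij, hc⟩
  have same : ∀ i ∈ Z, i ∉ U1 → ∀ j ∈ Z, conn pt B Z i j → conn pt A Z i j := by
    intro i hi hn j hj hij
    by_contra h
    exact hn ((m1 i).2 ⟨hi, j, hj, hij, h⟩)
  have hU1Z : U1 ⊆ Z := filter_subset _ _
  have hUZ : U1 ∪ U2 ⊆ Z := union_subset hU1Z ((filter_subset _ _).trans sdiff_subset)
  have invU : ∀ i ∈ U1 ∪ U2, ∀ j ∈ Z, conn pt B Z i j → j ∈ U1 ∪ U2 := by
    intro i hi j hj hij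
    rw [mem_union] at hi ⊢
    rcases hi with hi | hi
    · exact Or.inl (inv1 i hi j hj hij)
    · by_cases hj1 : j ∈ U1
      · exact Or.inl hj1
      · right
        rw [m2] at hi ⊢
        obtain ⟨_, y, hy, hiy⟩ := hi
        exact ⟨⟨hj, hj1⟩, y, hy, conn_trans (conn_symm hij) hiy⟩
  refine ⟨U1 ∪ U2, hUZ, ?_, ?_, ?_, ?_⟩
  · intro y hy
    rw [mem_union]
    by_cases h : y ∈ U1
    · exact Or.inl h
    · right; rw [m2]; exact ⟨⟨hY hy, h⟩, y, hy, conn_refl _⟩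
  · intro i hi j hj hjU
    by_contra h
    exact hjU (invU i hi j hj (conn_of_lt (hUZ hi) hj (not_le.1 h)))
  · intro i hi hiU j hj hjU
    by_cases h : B ≤ ‖pt i - pt j‖
    · exact Or.inl h
    · right
      apply conn_norm_le hA hi
      exact same i hi (fun h => hiU (mem_union_left _ h)) j hj (conn_of_lt hi hj (not_le.1 h))
  · -- choose representatives
    rcases isEmpty_or_nonempty ι with hemp | hne
    · exact ⟨∅, empty_subset _, by simp, fun i => isEmptyElim i⟩
    set I := (U1 ∪ U2).image (cls pt A Z) with hI
    choose! k hk using fun (b : Finset ι) (hb : b ∈ I) => mem_image.1 hb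
    refine ⟨I.image k, ?_, ?_, ?_⟩
    · intro c hc
      obtain ⟨b, hb, rfl⟩ := mem_image.1 hc
      exact (hk b hb).1
    · refine card_image_le.trans ?_
      have c2 : (U2.image (cls pt A Z)).card ≤ Y.card := by
        have : U2.image (cls pt A Z) ⊆ Y.image (cls pt A Z) := by
          intro c hc
          obtain ⟨i, hi, rfl⟩ := mem_image.1 hc
          rw [m2] at hi
          obtain ⟨⟨hiZ, hi1⟩, y, hy, hiy⟩ := hi
          refine mem_image.2 ⟨y, hy, ?_⟩
          exact ((cls_eq_iff (hY hy)).2 (same i hiZ hi1 y (hY hy) hiy)).symm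
        exact (card_le_card this).trans card_image_le
      have split : ∀ r : ℝ, r ≤ B → cl pt r Z = (U1.image (cls pt r Z)).card +
          ((Z \ U1).image (cls pt r Z)).card := by
        intro r hr
        rw [← card_union_of_disjoint, ← image_union, union_sdiff_of_subset hU1Z]
        · unfold cl; congr!
        · rw [disjoint_left]
          intro c hc hc'
          obtain ⟨i, hi, rfl⟩ := mem_image.1 hc
          obtain ⟨j, hj, e⟩ := mem_image.1 hc'
          rw [mem_sdiff] at hj
          rw [cls_eq_iff (hU1Z hi)] at e
          exact hj.2 (inv1 i hi j hj.1 (conn_mono hr (subset_refl _) (conn_symm e)))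
      have cV : ((Z \ U1).image (cls pt B Z)).card ≤ ((Z \ U1).image (cls pt A Z)).card := by
        apply card_image_le_card_image
        intro i hi j hj h
        rw [mem_sdiff] at hi hj
        rw [cls_eq_iff hj.1] at h ⊢
        exact conn_mono hAB (subset_refl _) h
      have cV2 : ((Z \ U1).image (cls pt A Z)).card ≥ ((Z \ U1).image (cls pt B Z)).card := cV
      have c1 : 2 * (U1.image (cls pt B Z)).card ≤ (U1.image (cls pt A Z)).card := by
        set f : Finset ι → Finset ι := fun c => Z.filter (fun j => ∃ i ∈ c, conn pt B Z i j) with hf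
        have hfc : ∀ i ∈ Z, f (cls pt A Z i) = cls pt B Z i := by
          intro i hi
          ext j
          simp only [hf, cls, mem_filter]
          constructor
          · rintro ⟨hj, l, ⟨hl, hil⟩, hlj⟩
            exact ⟨hj, conn_trans (conn_mono hAB (subset_refl _) hil) hlj⟩
          · rintro ⟨hj, hij⟩
            exact ⟨hj, i, ⟨hi, conn_refl _⟩, hij⟩
        have hmaps : ∀ c ∈ U1.image (cls pt A Z), f c ∈ U1.image (cls pt B Z) := by
          intro c hc
          obtain ⟨i, hi, rfl⟩ := mem_image.1 hc
          rw [hfc i (hU1Z hi)]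
          exact mem_image_of_mem _ hi
        rw [card_eq_sum_card_fiberwise hmaps, mul_comm]
        rw [← smul_eq_mul]
        apply card_nsmul_le_sum
        intro d hd
        obtain ⟨i, hi, rfl⟩ := mem_image.1 hd
        have hi' := hi
        rw [m1] at hi'
        obtain ⟨hiZ, j, hj, hij, hnij⟩ := hi'
        have hj1 := inv1 i hi j hj hij
        have hne : cls pt A Z i ≠ cls pt A Z j := fun e => hnij ((cls_eq_iff hj).1 e)
        rw [← card_pair hne]
        apply card_le_card
        intro c hc
        rw [mem_insert, mem_singleton] at hc
        rw [mem_filter]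
        rcases hc with rfl | rfl
        · exact ⟨mem_image_of_mem _ hi, hfc i hiZ⟩
        · refine ⟨mem_image_of_mem _ hj1, ?_⟩
          rw [hfc j hj]; exact (cls_eq_iff hiZ).2 (conn_symm hij)
      have hIc : I.card ≤ (U1.image (cls pt A Z)).card + (U2.image (cls pt A Z)).card := by
        rw [hI, image_union]; exact card_union_le _ _
      have sA := split A hAB
      have sB := split B le_rfl
      omega
    · intro i hi
      have hb : cls pt A Z i ∈ I := mem_image_of_mem _ hi
      refine ⟨k (cls pt A Z i), mem_image_of_mem _ hb, ?_⟩
      apply conn_norm_le hA (hUZ hi)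
      rw [← cls_eq_iff (hUZ (hk _ hb).1)]
      exact (hk _ hb).2.symm

end clusters
end DR
end

section
namespace DR
open Finset MeasureTheory

lemma integrable_cont {E : Type*} [NormedAddCommGroup E] {f : TT → E} (hf : Continuous f) :
    Integrable f := hf.integrable_of_hasCompactSupport (HasCompactSupport.of_compactSpace f)

lemma integral_ch (n : ℤ) : ∫ z : TT, ch n z = if n = 0 then 1 else 0 := by
  split_ifs with h
  · subst h; simp [ch_zero_left, Measure.real]
  · exact integral_eq_zero_of_add_right_eq_neg (μ := (volume : Measure TT)) (f := fun z : TT => ch n z)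
      (fourier_add_half_inv_index h (by norm_num : (0:ℝ) < 1))

lemma continuous_Dir (H : ℕ) : Continuous (Dir H) := by
  unfold Dir
  exact continuous_const.mul (continuous_finsetSum _ fun h _ => continuous_ch _)

lemma integral_Dir_sq (H : ℕ) (hH : 0 < H) : ∫ z : TT, ‖Dir H z‖ ^ 2 = 1 / H := by
  have hH' : (H : ℂ) ≠ 0 := by exact_mod_cast hH.ne'
  have e : ∀ z : TT, ((‖Dir H z‖ ^ 2 : ℝ) : ℂ) =
      ((H : ℂ)⁻¹) ^ 2 * ∑ h ∈ range H, ∑ h' ∈ range H, ch ((h : ℤ) - h') z := by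
    intro z
    have : ((‖Dir H z‖ ^ 2 : ℝ) : ℂ) = Dir H z * (starRingEnd ℂ) (Dir H z) := by
      rw [Complex.mul_conj, Complex.normSq_eq_norm_sq]
    rw [this, Dir, map_mul, map_sum]
    simp only [ch_sub_left, ← mul_sum]
    rw [← sum_mul, map_inv₀, Complex.conj_natCast]; ring
  have h2 : ((∫ z : TT, ‖Dir H z‖ ^ 2 : ℝ) : ℂ) = 1 / H := by
    rw [← integral_complex_ofReal]
    simp only [e]
    rw [integral_const_mul, integral_finsetSum]
    · have : ∀ h ∈ range H, ∫ z : TT, ∑ h' ∈ range H, ch ((h : ℤ) - h') z = 1 := by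
        intro h hh
        rw [integral_finsetSum _ (fun h' _ => integrable_cont (continuous_ch _))]
        simp only [integral_ch]
        rw [sum_eq_single h]
        · simp
        · intro b _ hb; rw [if_neg]; omega
        · intro h'; exact absurd hh h'
      rw [sum_congr rfl this]
      simp
      field_simp
    · intro h _
      exact integrable_cont (continuous_finsetSum _ fun h' _ => continuous_ch _)
  have h3 : ((∫ z : TT, ‖Dir H z‖ ^ 2 : ℝ) : ℂ) = ((1 / H : ℝ) : ℂ) := by rw [h2]; push_cast; rfl
  exact Complex.ofReal_injective h3

/-- the smoothing kernel -/
noncomputable def KK (H D : ℕ) (z : TT) : ℝ := (‖Dir H z‖ ^ 2) ^ D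

lemma mu_one_eq (H D : ℕ) (z : TT) : mu 1 H D z = (KK H D z : ℂ) := by
  rw [mu_eq, Dir_one, one_mul, KK]; push_cast; rfl

lemma KK_nonneg (H D : ℕ) (z : TT) : 0 ≤ KK H D z := by unfold KK; positivity
lemma continuous_KK (H D : ℕ) : Continuous (KK H D) := by
  unfold KK; exact ((continuous_Dir H).norm.pow 2).pow D

lemma real_closedBall (c : TT) (ε : ℝ) (h0 : 0 ≤ ε) :
    (volume : Measure TT).real (Metric.closedBall c ε) = min 1 (2 * ε) := by
  rw [Measure.real, AddCircle.volume_closedBall, ENNReal.toReal_ofReal (by positivity)]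

lemma c0_lower (H D : ℕ) (hH : 0 < H) (hD : 1 ≤ D) :
    1 / (8 * Real.pi * D * H) ≤ ∫ z : TT, KK H D z := by
  set R : ℝ := D * H with hR
  have hR1 : 1 ≤ R := by
    rw [hR]; exact_mod_cast Nat.mul_pos hD hH
  set ε : ℝ := 1 / (8 * Real.pi * R) with hε
  have hpi := Real.pi_gt_three
  have hε0 : 0 < ε := by positivity
  have h1 : ∀ z ∈ Metric.closedBall (0 : TT) ε, 1 / 2 ≤ KK H D z := by
    intro z hz
    rw [mem_closedBall_zero_iff] at hz
    have h := norm_mu_sub_one 1 H D one_pos hH z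
    rw [mu_one_eq] at h
    have h' : |KK H D z - 1| ≤ 2 * Real.pi * rad 1 H D * ‖z‖ := by
      rw [← Complex.ofReal_one, ← Complex.ofReal_sub, Complex.norm_real] at h
      exact h
    have hr : (rad 1 H D : ℝ) ≤ 2 * R := by
      simp only [rad]; push_cast; rw [← hR]; linarith
    have h2 : 2 * Real.pi * rad 1 H D * ‖z‖ ≤ 2 * Real.pi * (2 * R) * ε := by gcongr
    have h3 : 2 * Real.pi * (2 * R) * ε = 1 / 2 := by rw [hε]; field_simp; norm_num
    have := (abs_le.1 (h'.trans (h2.trans h3.le))).1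
    linarith
  have h2 : ∫ z in Metric.closedBall (0 : TT) ε, (1 / 2 : ℝ) ≤ ∫ z in Metric.closedBall (0 : TT) ε, KK H D z :=
    setIntegral_mono_on (integrable_cont continuous_const).integrableOn
      (integrable_cont (continuous_KK H D)).integrableOn Metric.isClosed_closedBall.measurableSet h1
  have h3 : ∫ z in Metric.closedBall (0 : TT) ε, KK H D z ≤ ∫ z : TT, KK H D z :=
    setIntegral_le_integral (integrable_cont (continuous_KK H D)) (Filter.Eventually.of_forall (KK_nonneg H D))
  have h4 : 2 * ε ≤ 1 := by
    rw [hε, mul_one_div, div_le_one (by positivity)]; nlinarith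
  rw [setIntegral_const, real_closedBall _ _ hε0.le, min_eq_right h4] at h2
  have : (2 * ε) • (1 / 2 : ℝ) = 1 / (8 * Real.pi * D * H) := by
    rw [smul_eq_mul, hε, hR]; field_simp
  rw [this] at h2
  exact h2.trans h3

lemma tail_bound (H D : ℕ) (hH : 0 < H) (hD : 1 ≤ D) (c : ℝ) (hc : 0 < c) :
    ∫ z in {z : TT | c ≤ ‖z‖}, KK H D z ≤ (1 / (2 * H * c)) ^ (2 * D - 2) * (1 / H) := by
  have hm : MeasurableSet {z : TT | c ≤ ‖z‖} := (isClosed_le continuous_const continuous_norm).measurableSet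
  have hcont : Continuous fun z : TT => (1 / (2 * H * c)) ^ (2 * D - 2) * ‖Dir H z‖ ^ 2 :=
    continuous_const.mul ((continuous_Dir H).norm.pow 2)
  calc ∫ z in {z : TT | c ≤ ‖z‖}, KK H D z
      ≤ ∫ z in {z : TT | c ≤ ‖z‖}, (1 / (2 * H * c)) ^ (2 * D - 2) * ‖Dir H z‖ ^ 2 := by
        apply setIntegral_mono_on (integrable_cont (continuous_KK H D)).integrableOn
          (integrable_cont hcont).integrableOn hm
        intro z hz
        have h2 := norm_Dir_le H z hH c hc hz
        have e : KK H D z = ‖Dir H z‖ ^ (2 * D - 2) * ‖Dir H z‖ ^ 2 := by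
          rw [KK, ← pow_mul, ← pow_add]; congr 1; omega
        rw [e]; gcongr
    _ ≤ ∫ z : TT, (1 / (2 * H * c)) ^ (2 * D - 2) * ‖Dir H z‖ ^ 2 :=
        setIntegral_le_integral (integrable_cont hcont) (Filter.Eventually.of_forall (fun z => by positivity))
    _ = _ := by rw [integral_const_mul, integral_Dir_sq H hH]

lemma box_abstract {ι : Type*} (S U : Finset ι) (hU : U ⊆ S) (e : ι → ℂ) (p : ι → TT) (C : Finset ι)
    (K : TT → ℝ) (hK : Continuous K) (hK0 : ∀ z, 0 ≤ K z) (B V : ℝ) (hB : 0 < B)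
    (hV : ∀ s : TT, ‖∑ i ∈ S, e i * (K (p i - s) : ℂ)‖ ≤ V)
    (hC : ∀ i ∈ U, ∃ c ∈ C, ‖p i - p c‖ ≤ B / 4)
    (hfar : ∀ i ∈ S, i ∉ U → ∀ c ∈ C, B ≤ ‖p c - p i‖) :
    ‖∑ i ∈ U, e i‖ * ∫ z : TT, K z ≤ C.card * B * V +
      (∫ z in {z : TT | B / 4 ≤ ‖z‖}, K z) * ∑ i ∈ S, ‖e i‖ := by
  classical
  have hV0 : 0 ≤ V := (norm_nonneg _).trans (hV 0)
  set c0 := ∫ z : TT, K z with hc0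
  set τ := ∫ z in {z : TT | B / 4 ≤ ‖z‖}, K z with hτ
  have hmt : MeasurableSet {z : TT | B / 4 ≤ ‖z‖} := (isClosed_le continuous_const continuous_norm).measurableSet
  set SS : Set TT := ⋃ c ∈ C, Metric.closedBall (p c) (B / 2) with hSS
  have hmS : MeasurableSet SS := Finset.measurableSet_biUnion _ fun c _ => Metric.isClosed_closedBall.measurableSet
  have hvol : (volume : Measure TT).real SS ≤ C.card * B := by
    refine (measureReal_biUnion_finset_le _ _).trans ?_
    refine (sum_le_card_nsmul _ _ B ?_).trans (by simp)
    intro c _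
    rw [real_closedBall _ _ (by positivity)]
    refine (min_le_right _ _).trans (by linarith)
  have hcK : ∀ i, Continuous fun s : TT => K (p i - s) := fun i => hK.comp (continuous_const.sub continuous_id)
  -- tail integrals
  have tail_eq : ∀ i, ∫ s in {s : TT | B / 4 ≤ ‖p i - s‖}, K (p i - s) = τ := by
    intro i
    have hm2 : MeasurableSet {s : TT | B / 4 ≤ ‖p i - s‖} :=
      (isClosed_le continuous_const (continuous_const.sub continuous_id).norm).measurableSet
    rw [hτ, ← integral_indicator hmt, ← integral_indicator hm2,
      ← integral_sub_left_eq_self (Set.indicator {z : TT | B / 4 ≤ ‖z‖} K) volume (p i)]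
    rfl
  have tail_le : ∀ i, ∀ X : Set TT, MeasurableSet X → (∀ s ∈ X, B / 4 ≤ ‖p i - s‖) →
      ∫ s in X, K (p i - s) ≤ τ := by
    intro i X _ hXs
    rw [← tail_eq i]
    apply setIntegral_mono_set (integrable_cont (hcK i)).integrableOn
    · exact Filter.Eventually.of_forall fun s => hK0 _
    · exact (show X ⊆ {s : TT | B / 4 ≤ ‖p i - s‖} from fun s hs => hXs s hs).eventuallyLE
  set κ : ι → ℝ := fun i => ∫ s in SS, K (p i - s) with hκ
  have tot : ∀ i, κ i + ∫ s in SSᶜ, K (p i - s) = c0 := by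
    intro i
    rw [hκ, hc0, ← integral_sub_left_eq_self K volume (p i)]
    exact integral_add_compl hmS (integrable_cont (hcK i))
  have hτ0 : 0 ≤ τ := integral_nonneg fun z => hK0 z
  have hin : ∀ i ∈ U, |c0 - κ i| ≤ τ := by
    intro i hi
    rw [← tot i, add_sub_cancel_left, abs_of_nonneg (integral_nonneg fun z => hK0 _)]
    apply tail_le i _ hmS.compl
    intro s hs
    by_contra hlt
    push Not at hlt
    apply hs
    obtain ⟨c, hc, hcd⟩ := hC i hi
    rw [hSS, Set.mem_iUnion₂]
    refine ⟨c, hc, ?_⟩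
    rw [Metric.mem_closedBall, dist_eq_norm]
    have h1 : s - p c = (p i - p c) - (p i - s) := by abel
    rw [h1]
    refine (norm_sub_le _ _).trans (by linarith)
  have hout : ∀ i ∈ S, i ∉ U → |κ i| ≤ τ := by
    intro i hi hiU
    rw [abs_of_nonneg (integral_nonneg fun z => hK0 _)]
    apply tail_le i _ hmS
    intro s hs
    rw [hSS, Set.mem_iUnion₂] at hs
    obtain ⟨c, hc, hsc⟩ := hs
    rw [Metric.mem_closedBall, dist_eq_norm] at hsc
    have h1 := hfar i hi hiU c hc
    have h2 : p c - p i = -(p i - s) - (s - p c) := by abel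
    rw [h2] at h1
    have h3 := norm_sub_le (-(p i - s)) (s - p c)
    rw [norm_neg] at h3
    linarith
  have hmain : ∑ i ∈ S, e i * (κ i : ℂ) = ∫ s in SS, ∑ i ∈ S, e i * (K (p i - s) : ℂ) := by
    rw [integral_finsetSum]
    · refine sum_congr rfl fun i _ => ?_
      rw [integral_const_mul, hκ]
      congr 1
      exact (integral_ofReal (𝕜 := ℂ)).symm
    · intro i _
      exact (integrable_cont (continuous_const.mul (Complex.continuous_ofReal.comp (hcK i)))).integrableOn
  have hmain_le : ‖∑ i ∈ S, e i * (κ i : ℂ)‖ ≤ C.card * B * V := by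
    rw [hmain]
    refine (norm_setIntegral_le_of_norm_le_const (C := V) (measure_lt_top _ _) (fun s _ => hV s)).trans ?_
    rw [mul_comm]
    gcongr
  have hsplit : ((∑ i ∈ U, e i) * (c0 : ℂ)) = ∑ i ∈ S, e i * (κ i : ℂ) +
      ∑ i ∈ S, e i * ((if i ∈ U then c0 - κ i else - κ i : ℝ) : ℂ) := by
    rw [← sum_add_distrib, sum_mul, ← sum_filter_add_sum_filter_not S (fun i => i ∈ U)]
    have h1 : S.filter (fun i => i ∈ U) = U := by
      ext i; simp only [mem_filter]; exact ⟨fun h => h.2, fun h => ⟨hU h, h⟩⟩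
    have h2 : ∑ i ∈ S.filter (fun i => ¬ i ∈ U), (e i * (κ i : ℂ) +
        e i * ((if i ∈ U then c0 - κ i else - κ i : ℝ) : ℂ)) = 0 := by
      apply sum_eq_zero
      intro i hi
      rw [mem_filter] at hi
      rw [if_neg hi.2]; push_cast; ring
    rw [h2, h1, add_zero]
    refine sum_congr rfl fun i hi => ?_
    rw [if_pos hi]; push_cast; ring
  have herr : ‖∑ i ∈ S, e i * ((if i ∈ U then c0 - κ i else - κ i : ℝ) : ℂ)‖ ≤ τ * ∑ i ∈ S, ‖e i‖ := by
    refine (norm_sum_le _ _).trans ?_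
    rw [mul_sum]
    refine sum_le_sum fun i hi => ?_
    rw [norm_mul, Complex.norm_real, Real.norm_eq_abs, mul_comm]
    gcongr
    split_ifs with h
    · exact hin i h
    · rw [abs_neg]; exact hout i hi h
  have hc00 : 0 ≤ c0 := integral_nonneg fun z => hK0 z
  calc ‖∑ i ∈ U, e i‖ * c0 = ‖(∑ i ∈ U, e i) * (c0 : ℂ)‖ := by
        rw [norm_mul, Complex.norm_real, Real.norm_eq_abs, abs_of_nonneg hc00]
    _ ≤ _ := by
        rw [hsplit]
        exact (norm_add_le _ _).trans (add_le_add hmain_le herr)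

lemma box {ι : Type*} (S U : Finset ι) (hU : U ⊆ S) (e : ι → ℂ) (p : ι → TT) (C : Finset ι)
    (H D : ℕ) (hH : 0 < H) (hD : 1 ≤ D) (B V : ℝ) (hB : 0 < B)
    (hV : ∀ s : TT, ‖∑ i ∈ S, e i * mu 1 H D (p i - s)‖ ≤ V)
    (hC : ∀ i ∈ U, ∃ c ∈ C, ‖p i - p c‖ ≤ B / 4)
    (hfar : ∀ i ∈ S, i ∉ U → ∀ c ∈ C, B ≤ ‖p c - p i‖) :
    ‖∑ i ∈ U, e i‖ ≤ 8 * Real.pi * D * H * (C.card * B * V) +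
      8 * Real.pi * D * (2 / (H * B)) ^ (2 * D - 2) * ∑ i ∈ S, ‖e i‖ := by
  have h := box_abstract S U hU e p C (KK H D) (continuous_KK H D) (KK_nonneg H D) B V hB
    (by simpa only [mu_one_eq] using hV) hC hfar
  have h1 := c0_lower H D hH hD
  have h2 := tail_bound H D hH hD (B / 4) (by positivity)
  have hH' : (0:ℝ) < H := by exact_mod_cast hH
  have hD' : (0:ℝ) < D := by exact_mod_cast hD
  have e1 : 1 / (2 * H * (B / 4)) = 2 / (H * B) := by field_simp; norm_num
  rw [e1] at h2
  have h3 : ‖∑ i ∈ U, e i‖ * (1 / (8 * Real.pi * D * H)) ≤ C.card * B * V +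
      ((2 / (H * B)) ^ (2 * D - 2) * (1 / H)) * ∑ i ∈ S, ‖e i‖ := by
    refine le_trans (by gcongr) (h.trans ?_)
    gcongr
  rw [mul_one_div, div_le_iff₀ (by positivity)] at h3
  refine h3.trans (le_of_eq ?_)
  field_simp

end DR
end

section
namespace DR
open Finset

lemma compare_abs {ι κ : Type*} [DecidableEq ι] [DecidableEq κ] (S S' : Finset ι) (R R' : Finset κ) (hS : S ⊆ S') (hR : R ⊆ R')
    (e : ι → ℂ) (e' : κ → ℂ) (p : ι → TT) (q : κ → TT) (m m' : TT → ℂ) (B r ε X X' : ℝ) (hε : 0 ≤ ε)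
    (hf : ∀ z, B ≤ ‖z‖ → ‖m z‖ ≤ ε) (hf' : ∀ z, B ≤ ‖z‖ → ‖m' z‖ ≤ ε)
    (hn : ∀ z, ‖z‖ ≤ r → ‖m z - 1‖ ≤ ε) (hn' : ∀ z, ‖z‖ ≤ r → ‖m' z - 1‖ ≤ ε)
    (UI : Finset ι) (UR : Finset κ) (hSU : ∀ i ∈ S', i ∉ S → i ∈ UI) (hRU : ∀ l ∈ R', l ∉ R → l ∈ UR)
    (h1 : ∀ i ∈ S', i ∉ UI → ∀ l ∈ R', l ∈ UR → B ≤ ‖p i - q l‖)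
    (h2 : ∀ i ∈ S', i ∉ UI → ∀ l ∈ R', l ∉ UR → B ≤ ‖p i - q l‖ ∨ ‖p i - q l‖ ≤ r)
    (hX : ‖∑ i ∈ S ∩ UI, ∑ l ∈ R, e i * e' l * m (p i - q l)‖ ≤ X)
    (hX' : ‖∑ i ∈ S' ∩ UI, ∑ l ∈ R', e i * e' l * m' (p i - q l)‖ ≤ X') :
    ‖∑ i ∈ S, ∑ l ∈ R, e i * e' l * m (p i - q l) - ∑ i ∈ S', ∑ l ∈ R', e i * e' l * m' (p i - q l)‖
      ≤ X + X' + 4 * ε * ((∑ i ∈ S', ‖e i‖) * ∑ l ∈ R', ‖e' l‖) := by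
  have hSd : S \ UI = S' \ UI := by
    ext i; simp only [mem_sdiff]
    refine ⟨fun h => ⟨hS h.1, h.2⟩, fun h => ⟨?_, h.2⟩⟩
    by_contra h'; exact h.2 (hSU i h.1 h')
  have hRd : R \ UR = R' \ UR := by
    ext i; simp only [mem_sdiff]
    refine ⟨fun h => ⟨hR h.1, h.2⟩, fun h => ⟨?_, h.2⟩⟩
    by_contra h'; exact h.2 (hRU i h.1 h')
  set Q : ℝ := (∑ i ∈ S', ‖e i‖) * ∑ l ∈ R', ‖e' l‖ with hQ
  -- generic sum bound
  have key : ∀ (s : Finset ι) (t : Finset κ) (c : ι → κ → ℂ) (δ : ℝ), 0 ≤ δ → s ⊆ S' → t ⊆ R' →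
      (∀ i ∈ s, ∀ l ∈ t, ‖c i l‖ ≤ δ) → ‖∑ i ∈ s, ∑ l ∈ t, e i * e' l * c i l‖ ≤ δ * Q := by
    intro s t c δ hδ hs ht hc
    calc _ ≤ ∑ i ∈ s, ∑ l ∈ t, ‖e i‖ * ‖e' l‖ * δ := by
          refine (norm_sum_le _ _).trans (sum_le_sum fun i hi => (norm_sum_le _ _).trans (sum_le_sum fun l hl => ?_))
          rw [norm_mul, norm_mul]
          have := hc i hi l hl
          gcongr
      _ = δ * ((∑ i ∈ s, ‖e i‖) * ∑ l ∈ t, ‖e' l‖) := by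
          rw [sum_mul_sum, mul_sum]
          refine sum_congr rfl fun i _ => ?_
          rw [mul_sum]
          refine sum_congr rfl fun l _ => ?_
          ring
      _ ≤ δ * Q := by
          rw [hQ]
          gcongr
  have split : ∀ (S : Finset ι) (R : Finset κ) (c : ι → κ → ℂ), ∑ i ∈ S, ∑ l ∈ R, c i l =
      ∑ i ∈ S ∩ UI, ∑ l ∈ R, c i l + (∑ i ∈ S \ UI, ∑ l ∈ R ∩ UR, c i l + ∑ i ∈ S \ UI, ∑ l ∈ R \ UR, c i l) := by
    intro S R c
    rw [← sum_add_distrib, ← sum_inter_add_sum_sdiff S UI]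
    congr 1
    refine sum_congr rfl fun i _ => ?_
    rw [sum_inter_add_sum_sdiff]
  rw [split S R, split S' R']
  have a1 := key (S \ UI) (R ∩ UR) (fun i l => m (p i - q l)) ε hε (sdiff_subset.trans hS) (inter_subset_left.trans hR)
    (by
      intro i hi l hl
      rw [mem_sdiff] at hi; rw [mem_inter] at hl
      exact hf _ (h1 i (hS hi.1) hi.2 l (hR hl.1) hl.2))
  have a2 := key (S' \ UI) (R' ∩ UR) (fun i l => m' (p i - q l)) ε hε sdiff_subset inter_subset_left
    (by
      intro i hi l hl
      rw [mem_sdiff] at hi; rw [mem_inter] at hl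
      exact hf' _ (h1 i hi.1 hi.2 l hl.1 hl.2))
  have a3 := key (S' \ UI) (R' \ UR) (fun i l => m (p i - q l) - m' (p i - q l)) (2 * ε) (by positivity) sdiff_subset sdiff_subset
    (by
      intro i hi l hl
      rw [mem_sdiff] at hi hl
      rcases h2 i hi.1 hi.2 l hl.1 hl.2 with h | h
      · refine (norm_sub_le _ _).trans ?_
        linarith [hf _ h, hf' _ h]
      · have : m (p i - q l) - m' (p i - q l) = (m (p i - q l) - 1) - (m' (p i - q l) - 1) := by ring
        rw [this]
        refine (norm_sub_le _ _).trans ?_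
        linarith [hn _ h, hn' _ h])
  simp only [mul_sub, sum_sub_distrib] at a3
  rw [hSd, hRd]
  rw [hSd] at a1
  set x1 := ∑ i ∈ S ∩ UI, ∑ l ∈ R, e i * e' l * m (p i - q l)
  set x2 := ∑ i ∈ S' ∩ UI, ∑ l ∈ R', e i * e' l * m' (p i - q l)
  set y1 := ∑ i ∈ S' \ UI, ∑ l ∈ R ∩ UR, e i * e' l * m (p i - q l)
  set y2 := ∑ i ∈ S' \ UI, ∑ l ∈ R' ∩ UR, e i * e' l * m' (p i - q l)
  set z1 := ∑ i ∈ S' \ UI, ∑ l ∈ R' \ UR, e i * e' l * m (p i - q l)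
  set z2 := ∑ i ∈ S' \ UI, ∑ l ∈ R' \ UR, e i * e' l * m' (p i - q l)
  have : (x1 + (y1 + z1)) - (x2 + (y2 + z2)) = x1 - x2 + (y1 - y2) + (z1 - z2) := by ring
  rw [this]
  refine (norm_add_le _ _).trans ?_
  refine (add_le_add ((norm_add_le _ _).trans (add_le_add (norm_sub_le _ _) (norm_sub_le _ _))) le_rfl).trans ?_
  linarith

/-- an exponential sum -/
noncomputable def tp {ι : Type*} (S : Finset ι) (c : ι → ℂ) (θ : ι → TT) (y : ℤ) : ℂ := ∑ i ∈ S, c i * ch y (θ i)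

lemma ch_pair (a b x n : ℤ) (θ φ : TT) :
    ch (x + a * n) θ * ch (x + b * n) φ = ch x θ * ch x φ * ch n (a • θ - (-(b • φ))) := by
  rw [ch_add_left, ch_add_left, sub_neg_eq_add, ch_add_right, ch_zsmul, ch_zsmul, mul_comm n a, mul_comm n b]
  ring

/-- pairs form of bilinear average of exponential sums -/
lemma av_pair {ι κ : Type*} (N H D : ℕ) (S : Finset ι) (R : Finset κ) (c : ι → ℂ) (θ : ι → TT) (d : κ → ℂ) (φ : κ → TT)
    (a b x : ℤ) :
    av N H D (fun n => tp S c θ (x + a * n) * tp R d φ (x + b * n)) =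
      ∑ i ∈ S, ∑ l ∈ R, (c i * ch x (θ i)) * (d l * ch x (φ l)) * mu N H D (a • θ i - (-(b • φ l))) := by
  have : ∀ n : ℤ, tp S c θ (x + a * n) * tp R d φ (x + b * n) =
      ∑ i ∈ S, ∑ l ∈ R, ((c i * ch x (θ i)) * (d l * ch x (φ l))) * ch n (a • θ i - (-(b • φ l))) := by
    intro n
    rw [tp, tp, sum_mul_sum]
    refine sum_congr rfl fun i _ => sum_congr rfl fun l _ => ?_
    have := ch_pair a b x n (θ i) (φ l)
    linear_combination c i * d l * this
  simp only [this]
  rw [av_sum]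
  refine sum_congr rfl fun i _ => ?_
  rw [av_sum]
  refine sum_congr rfl fun l _ => ?_
  rw [av_mul_left]; rfl

/-- the localized sum -/
lemma V_eq {ι κ : Type*} (N H D : ℕ) (S : Finset ι) (R : Finset κ) (c : ι → ℂ) (θ : ι → TT) (d : κ → ℂ) (φ : κ → TT)
    (a b x : ℤ) (s : TT) :
    ∑ i ∈ S, (∑ l ∈ R, (c i * ch x (θ i)) * (d l * ch x (φ l)) * mu N H D (a • θ i - (-(b • φ l)))) * mu 1 H D (a • θ i - s)
      = av N H D (fun n => av 1 H D (fun n' => tp S c θ ((x + a * n) + a * n') * ch n' (-s)) * tp R d φ (x + b * n)) := by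
  have h1 : ∀ y : ℤ, av 1 H D (fun n' => tp S c θ (y + a * n') * ch n' (-s)) =
      tp S (fun i => c i * mu 1 H D (a • θ i - s)) θ y := by
    intro y
    simp only [tp, sum_mul]
    rw [av_sum]
    refine sum_congr rfl fun i _ => ?_
    rw [mu, mul_right_comm, ← av_mul_left]
    congr 1; funext n'
    rw [ch_add_left, sub_eq_add_neg, ch_add_right, ch_zsmul, mul_comm n' a]; ring
  simp only [h1]
  rw [av_pair]
  refine sum_congr rfl fun i _ => ?_
  rw [sum_mul]
  refine sum_congr rfl fun l _ => ?_
  ring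

lemma V_bound {ι κ : Type*} (N H D : ℕ) (hD : 1 ≤ D) (hH : 0 < H)
    (S : Finset ι) (R : Finset κ) (c : ι → ℂ) (θ : ι → TT) (d : κ → ℂ) (φ : κ → TT)
    (a b x : ℤ) (ha : a ≠ 0) (hb : b ≠ 0) (s : TT) (Q : Finset ℤ) (A : ℝ) 
    (hA : ∀ ψ : TT, ‖∑ y ∈ Q, tp S c θ y * ch y ψ‖ ≤ A)
    (hx : ∀ n : ℤ, |n| ≤ rad N H D + rad 1 H D → x + a * n ∈ Q)
    (hxb : ∀ n : ℤ, |n| ≤ rad N H D → x + b * n ∈ Q) (W : ℝ) (hW : ∑ y ∈ Q, ‖tp R d φ y‖ ≤ W) :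
    ‖∑ i ∈ S, (∑ l ∈ R, (c i * ch x (θ i)) * (d l * ch x (φ l)) * mu N H D (a • θ i - (-(b • φ l)))) * mu 1 H D (a • θ i - s)‖
      ≤ A * (1 / H) * ((N : ℝ)⁻¹ * W) := by
  have hA0 : 0 ≤ A := (norm_nonneg _).trans (hA 0)
  rw [V_eq]
  refine (norm_av_le_l1 _).trans ?_
  have h1 : ∀ n ∈ Icc (-(rad N H D : ℤ)) (rad N H D),
      ‖av 1 H D (fun n' => tp S c θ ((x + a * n) + a * n') * ch n' (-s)) * tp R d φ (x + b * n)‖ ≤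
        A * (1 / H) * ‖tp R d φ (x + b * n)‖ := by
    intro n hn
    rw [norm_mul]
    gcongr
    refine linear_bound_one hD hH a ha (tp S c θ) A hA (x + a * n) ?_ (-s)
    intro n' hn'
    have : x + a * n + a * n' = x + a * (n + n') := by ring
    rw [this]
    apply hx
    rw [mem_Icc, ← abs_le] at hn
    exact (abs_add_le _ _).trans (add_le_add hn hn')
  have h2 : ∑ n ∈ Icc (-(rad N H D : ℤ)) (rad N H D), ‖tp R d φ (x + b * n)‖ ≤ W := by
    refine le_trans ?_ hW
    have hinj : Set.InjOn (fun n : ℤ => x + b * n) (Icc (-(rad N H D : ℤ)) (rad N H D)) := by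
      intro n _ n' _ h
      simpa [hb] using h
    rw [← sum_image (f := fun y => ‖tp R d φ y‖) hinj]
    refine sum_le_sum_of_subset_of_nonneg ?_ fun _ _ _ => norm_nonneg _
    intro y hy
    rw [mem_image] at hy
    obtain ⟨n, hn, rfl⟩ := hy
    rw [mem_Icc, ← abs_le] at hn
    exact hxb n hn
  calc _ ≤ (N : ℝ)⁻¹ * (A * (1 / H) * W) := by
        gcongr
        refine (sum_le_sum h1).trans ?_
        rw [← mul_sum]
        gcongr
    _ = _ := by ring

end DR
end

section
namespace DR
open Finset

/-- admissible families of averaging lengths -/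
structure Adm (a b : ℤ) (C1 : ℝ) (k0 : ℕ) (N H : ℕ → ℕ) : Prop where
  ha : a ≠ 0
  hb : b ≠ 0
  hab : a ≠ b
  k3 : 3 ≤ k0
  Hpos : ∀ k, k0 ≤ k → 0 < H k
  HN : ∀ k, k0 ≤ k → H k ≤ N k
  big : ∀ k, k0 ≤ k → (2 : ℝ) ^ k ≤ C1 * H k
  small : ∀ k, k0 ≤ k → 8 * ((|a| + |b|) * (rad (N k) (H k) 100 + rad 1 (H k) 100)) ≤ 2 ^ k

noncomputable def blk (k m : ℕ) : Finset ℤ := Ico ((m : ℤ) * 2 ^ k) ((m + 1) * 2 ^ k)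

def good (k x : ℕ) : Prop := 2 ^ k ≤ 8 * (x % 2 ^ k) ∧ 8 * (x % 2 ^ k) < 7 * 2 ^ k

lemma card_blk (k m : ℕ) : (blk k m).card = 2 ^ k := by
  rw [blk, Int.card_Ico]
  have : ((m : ℤ) + 1) * 2 ^ k - m * 2 ^ k = ((2 ^ k : ℕ) : ℤ) := by push_cast; ring
  rw [this]; rfl

lemma mem_blk {k m x : ℕ} : (x : ℤ) ∈ blk k m ↔ x / 2 ^ k = m := by
  rw [blk, mem_Ico, Nat.div_eq_iff (by positivity)]
  have h : 0 < 2 ^ k := by positivity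
  constructor
  · rintro ⟨h1, h2⟩
    have h1' : m * 2 ^ k ≤ x := by exact_mod_cast h1
    have h2' : x < (m + 1) * 2 ^ k := by exact_mod_cast h2
    refine ⟨h1', ?_⟩
    have e : (m + 1) * 2 ^ k = m * 2 ^ k + 2 ^ k := by ring
    omega
  · rintro ⟨h1, h2⟩
    have e : (m + 1) * 2 ^ k = m * 2 ^ k + 2 ^ k := by ring
    have h2' : x < (m + 1) * 2 ^ k := by omega
    exact ⟨by exact_mod_cast h1, by exact_mod_cast h2'⟩

lemma good_mem {k x : ℕ} (hg : good k x) {t : ℤ} (ht : 8 * |t| ≤ 2 ^ k) : (x : ℤ) + t ∈ blk k (x / 2 ^ k) := by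
  obtain ⟨h1, h2⟩ := hg
  have e := Nat.div_add_mod x (2 ^ k)
  rw [blk, mem_Ico]
  have e' : (x : ℤ) = (x / 2 ^ k : ℕ) * 2 ^ k + (x % 2 ^ k : ℕ) := by
    conv_lhs => rw [← e]
    push_cast; ring
  have h1' : (2 ^ k : ℤ) ≤ 8 * (x % 2 ^ k : ℕ) := by exact_mod_cast h1
  have h2' : (8 * (x % 2 ^ k : ℕ) : ℤ) < 7 * 2 ^ k := by exact_mod_cast h2
  set r : ℤ := ((x % 2 ^ k : ℕ) : ℤ)
  set m : ℤ := ((x / 2 ^ k : ℕ) : ℤ)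
  have := abs_le.1 (le_refl |t|)
  rw [e']
  constructor
  · linarith
  · linarith

lemma Adm.mem_a {a b : ℤ} {C1 : ℝ} {k0 : ℕ} {N H : ℕ → ℕ} (h : Adm a b C1 k0 N H) {k x : ℕ} (hk : k0 ≤ k) (hg : good k x)
    {n : ℤ} (hn : |n| ≤ rad (N k) (H k) 100 + rad 1 (H k) 100) : (x : ℤ) + a * n ∈ blk k (x / 2 ^ k) := by
  apply good_mem hg
  refine le_trans ?_ (h.small k hk)
  rw [abs_mul]
  have := abs_nonneg b
  gcongr
  linarith

lemma Adm.mem_b {a b : ℤ} {C1 : ℝ} {k0 : ℕ} {N H : ℕ → ℕ} (h : Adm a b C1 k0 N H) {k x : ℕ} (hk : k0 ≤ k) (hg : good k x)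
    {n : ℤ} (hn : |n| ≤ rad (N k) (H k) 100 + rad 1 (H k) 100) : (x : ℤ) + b * n ∈ blk k (x / 2 ^ k) := by
  apply good_mem hg
  refine le_trans ?_ (h.small k hk)
  rw [abs_mul]
  have := abs_nonneg a
  gcongr
  linarith

lemma Adm.rad_le {a b : ℤ} {C1 : ℝ} {k0 : ℕ} {N H : ℕ → ℕ} (h : Adm a b C1 k0 N H) {k : ℕ} (hk : k0 ≤ k) :
    8 * (rad (N k) (H k) 100 : ℝ) ≤ 2 ^ k := by
  have h1 := h.small k hk
  have h2 : (1 : ℤ) ≤ |a| := Int.one_le_abs h.ha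
  have h3 := abs_nonneg b
  have h4 : (8 * (rad (N k) (H k) 100 : ℤ)) ≤ 2 ^ k := by
    refine le_trans ?_ h1
    have : (0:ℤ) ≤ rad (N k) (H k) 100 := by positivity
    have h5 : (0:ℤ) ≤ rad 1 (H k) 100 := by positivity
    nlinarith
  exact_mod_cast h4

lemma Adm.C1pos {a b : ℤ} {C1 : ℝ} {k0 : ℕ} {N H : ℕ → ℕ} (h : Adm a b C1 k0 N H) : 0 < C1 := by
  have h1 := h.big k0 le_rfl
  have h2 : (0:ℝ) < 2 ^ k0 := by positivity
  by_contra hc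
  push Not at hc
  have : C1 * H k0 ≤ 0 := mul_nonpos_of_nonpos_of_nonneg hc (by positivity)
  linarith

set_option linter.unusedSectionVars false
section compare
variable {a b : ℤ} {C1 : ℝ} {k0 : ℕ} {N H : ℕ → ℕ} {ι κ : Type*} [DecidableEq ι] [DecidableEq κ]

/-- pair sum at level k -/
noncomputable def FF (a b : ℤ) (N H : ℕ → ℕ) (x : ℤ) (k : ℕ) (S : Finset ι) (R : Finset κ) (c : ι → ℂ) (θ : ι → TT)
    (d : κ → ℂ) (φ : κ → TT) : ℂ :=
  av (N k) (H k) 100 (fun n => tp S c θ (x + a * n) * tp R d φ (x + b * n))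

noncomputable def ptt (a b : ℤ) (θ : ι → TT) (φ : κ → TT) : ι ⊕ κ → TT :=
  Sum.elim (fun i => a • θ i) (fun l => -(b • φ l))

lemma ptt_inl (a b : ℤ) (θ : ι → TT) (φ : κ → TT) (i : ι) : ptt a b θ φ (Sum.inl i) = a • θ i := rfl
lemma ptt_inr (a b : ℤ) (θ : ι → TT) (φ : κ → TT) (i : κ) : ptt a b θ φ (Sum.inr i) = -(b • φ i) := rfl

lemma X_bound (h : Adm a b C1 k0 N H) {k x : ℕ} (hk : k0 ≤ k) (hg : good k x)
    (S : Finset ι) (R : Finset κ) (c : ι → ℂ) (θ : ι → TT) (d : κ → ℂ) (φ : κ → TT)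
    (η Λ b0 q : ℝ) (hq : (2 * C1 / b0) ^ 198 ≤ q) (hb0 : 0 < b0)
    (hη : ∀ ψ : TT, ‖∑ y ∈ blk k (x / 2 ^ k), tp S c θ y * ch y ψ‖ ≤ η * 2 ^ k)
    (hΛ : ∑ y ∈ blk k (x / 2 ^ k), ‖tp R d φ y‖ ≤ Λ * 2 ^ k)
    (UI : Finset ι) (C : Finset (ι ⊕ κ))
    (hC : ∀ i ∈ S, i ∈ UI → ∃ c ∈ C, ‖a • θ i - ptt a b θ φ c‖ ≤ b0 / 2 ^ k / 4)
    (hfar : ∀ i ∈ S, i ∉ UI → ∀ c ∈ C, b0 / 2 ^ k ≤ ‖ptt a b θ φ c - a • θ i‖) :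
    ‖∑ i ∈ S ∩ UI, ∑ l ∈ R, (c i * ch x (θ i)) * (d l * ch x (φ l)) * mu (N k) (H k) 100 (a • θ i - (-(b • φ l)))‖
      ≤ 3200 * (C.card * b0 * η * Λ * C1) + 3200 * q * ((∑ i ∈ S, ‖c i‖) * ∑ l ∈ R, ‖d l‖) := by
  have hH := h.Hpos k hk
  have hN : 0 < N k := hH.trans_le (h.HN k hk)
  have hH' : (0:ℝ) < H k := by exact_mod_cast hH
  have hN' : (0:ℝ) < N k := by exact_mod_cast hN
  have hbig := h.big k hk
  have h2k : (0:ℝ) < 2 ^ k := by positivity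
  have hC1 := h.C1pos
  set V : ℝ := (η * 2 ^ k) * (1 / H k) * ((N k : ℝ)⁻¹ * (Λ * 2 ^ k)) with hV
  have hΛ0 : 0 ≤ Λ := by
    have : 0 ≤ Λ * 2 ^ k := le_trans (sum_nonneg fun _ _ => norm_nonneg _) hΛ
    exact nonneg_of_mul_nonneg_left this h2k
  have hη0 : 0 ≤ η := by
    have : 0 ≤ η * 2 ^ k := (norm_nonneg _).trans (hη 0)
    exact nonneg_of_mul_nonneg_left this h2k
  set E : ι ⊕ κ → ℂ := Sum.elim (fun i => ∑ l ∈ R, (c i * ch x (θ i)) * (d l * ch x (φ l)) *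
    mu (N k) (H k) 100 (a • θ i - (-(b • φ l)))) (fun _ => 0) with hE
  have hbox := box (S.map Function.Embedding.inl) ((S ∩ UI).map Function.Embedding.inl)
    (map_subset_map.2 inter_subset_left) E (ptt a b θ φ) C (H k) 100 hH (by norm_num) (b0 / 2 ^ k) V (by positivity)
    (by
      intro s
      rw [sum_map]
      exact V_bound (N k) (H k) 100 (by norm_num) hH S R c θ d φ a b x h.ha h.hb s (blk k (x / 2 ^ k)) (η * 2 ^ k) hη
        (fun n hn => h.mem_a hk hg (by exact_mod_cast hn))
        (fun n hn => h.mem_b hk hg (by have : (0:ℤ) ≤ rad 1 (H k) 100 := by positivity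
                                       linarith)) _ hΛ)
    (by
      intro i hi
      rw [mem_map] at hi
      obtain ⟨i, hi, rfl⟩ := hi
      rw [mem_inter] at hi
      exact hC i hi.1 hi.2)
    (by
      intro i hi hiU
      rw [mem_map] at hi
      obtain ⟨i, hi, rfl⟩ := hi
      refine hfar i hi fun hiU' => hiU ?_
      exact mem_map_of_mem _ (mem_inter.2 ⟨hi, hiU'⟩))
  rw [sum_map, sum_map] at hbox
  refine hbox.trans ?_
  have hpi := Real.pi_lt_four
  have hpi0 := Real.pi_pos
  have t1 : ∑ i ∈ S, ‖E (Function.Embedding.inl i)‖ ≤ (∑ i ∈ S, ‖c i‖) * ∑ l ∈ R, ‖d l‖ := by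
    rw [sum_mul]
    refine sum_le_sum fun i _ => ?_
    rw [hE]
    simp only [Function.Embedding.inl_apply, Sum.elim_inl]
    refine (norm_sum_le _ _).trans ?_
    rw [mul_sum]
    refine sum_le_sum fun l _ => ?_
    rw [norm_mul, norm_mul, norm_mul, norm_mul, norm_ch, norm_ch, mul_one, mul_one]
    have := norm_mu_le_one (N k) (H k) 100 (a • θ i - (-(b • φ l)))
    nlinarith [mul_nonneg (norm_nonneg (c i)) (norm_nonneg (d l))]
  have t2 : (2 / (H k * (b0 / 2 ^ k))) ≤ 2 * C1 / b0 := by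
    rw [div_le_div_iff₀ (by positivity) hb0]
    have : 2 * C1 * (H k * (b0 / 2 ^ k)) = 2 * b0 * (C1 * H k / 2 ^ k) := by field_simp
    rw [this]
    have : 1 ≤ C1 * H k / 2 ^ k := (one_le_div h2k).2 hbig
    nlinarith
  have t3 : (2:ℝ) ^ k / N k ≤ C1 := by
    rw [div_le_iff₀ hN']
    refine hbig.trans ?_
    gcongr
    exact_mod_cast h.HN k hk
  have t4 : (H k : ℝ) * (C.card * (b0 / 2 ^ k) * V) = C.card * b0 * η * Λ * (2 ^ k / N k) := by
    rw [hV]; field_simp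
  have t5 : 8 * Real.pi * (100:ℕ) ≤ 3200 := by push_cast; linarith
  have t6 : 8 * Real.pi * (100:ℕ) * H k * (C.card * (b0 / 2 ^ k) * V) = 8 * Real.pi * (100:ℕ) * (C.card * b0 * η * Λ * (2 ^ k / N k)) := by
    rw [← t4]; ring
  rw [t6]
  have hq0 : 0 ≤ q := le_trans (by positivity) hq
  have t7 : (2 / (H k * (b0 / 2 ^ k))) ^ (2 * 100 - 2) ≤ q := by
    refine le_trans ?_ hq
    have : 0 ≤ (2 / (H k * (b0 / 2 ^ k))) := by positivity
    exact pow_le_pow_left₀ this t2 198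
  gcongr

set_option maxHeartbeats 400000 in
lemma compare_level (h : Adm a b C1 k0 N H) {k k' x : ℕ} (hk' : k0 ≤ k') (hkk : k' ≤ k)
    (S S' : Finset ι) (R R' : Finset κ) (hS : S ⊆ S') (hR : R ⊆ R')
    (c : ι → ℂ) (θ : ι → TT) (d : κ → ℂ) (φ : κ → TT) (a0 b0 M q : ℝ) (ha0 : 0 ≤ a0) (hq : (2 * C1 / b0) ^ 198 ≤ q) (hb0 : 2 * C1 ≤ b0)
    (hM : (S'.card : ℝ) + R'.card ≤ M) (hMab : M * a0 ≤ b0 / 4) (hab : a0 ≤ b0) (mm : ℕ) (η Λ : ℝ)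
    (hmm : cl (ptt a b θ φ) (a0 / 2 ^ k) (S'.disjSum R') - cl (ptt a b θ φ) (b0 / 2 ^ k') (S'.disjSum R') +
      ((S'.disjSum R').card - (S.disjSum R).card) ≤ mm)
    (hgood : mm ≠ 0 → good k x ∧ good k' x ∧
      (∀ ψ : TT, ‖∑ y ∈ blk k (x / 2 ^ k), tp S c θ y * ch y ψ‖ ≤ η * 2 ^ k) ∧
      (∀ ψ : TT, ‖∑ y ∈ blk k' (x / 2 ^ k'), tp S' c θ y * ch y ψ‖ ≤ η * 2 ^ k') ∧
      (∑ y ∈ blk k (x / 2 ^ k), ‖tp R d φ y‖ ≤ Λ * 2 ^ k) ∧ (∑ y ∈ blk k' (x / 2 ^ k'), ‖tp R' d φ y‖ ≤ Λ * 2 ^ k')) :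
    ‖FF a b N H x k S R c θ d φ - FF a b N H x k' S' R' c θ d φ‖ ≤
      12800 * (mm * b0 * η * Λ * C1) +
        6404 * (q + M * a0) * ((∑ i ∈ S', ‖c i‖) * ∑ l ∈ R', ‖d l‖) := by
  have hk : k0 ≤ k := hk'.trans hkk
  have hC1 := h.C1pos
  have hb0p : 0 < b0 := by linarith
  set A := a0 / 2 ^ k with hA
  set B := b0 / 2 ^ k' with hB
  have h2kk : (2:ℝ) ^ k' ≤ 2 ^ k := pow_le_pow_right₀ (by norm_num) hkk
  have h2k' : (0:ℝ) < 2 ^ k' := by positivity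
  have hBB : b0 / 2 ^ k ≤ B := by rw [hB]; gcongr
  have hAB : A ≤ B := le_trans (by rw [hA]; gcongr) hBB
  have hM0 : 0 ≤ M := le_trans (by positivity) hM
  obtain ⟨U, hUZ, hYU, hU1, hU2, C, hCU, hCc, hC⟩ := exists_U (ptt a b θ φ) A B (by positivity) hAB (S'.disjSum R')
    ((S'.disjSum R') \ (S.disjSum R)) sdiff_subset
  have hZZ : S.disjSum R ⊆ S'.disjSum R' := disjSum_mono hS hR
  rw [card_sdiff_of_subset hZZ] at hCc
  have hCm : C.card ≤ 2 * mm := by omega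
  have hZM : ((S'.disjSum R').card : ℝ) ≤ M := by rw [card_disjSum]; push_cast; exact hM
  have hr : ((S'.disjSum R').card : ℝ) * A ≤ M * a0 / 2 ^ k := by
    rw [hA, mul_div_assoc]; gcongr
  set ε := q + M * a0 with hε
  have hq0 : 0 ≤ q := le_trans (by positivity) hq
  have hε0 : 0 ≤ ε := by positivity
  have hq1 : 2 * C1 / b0 ≤ 1 := (div_le_one hb0p).2 hb0
  have far : ∀ l, k0 ≤ l → k' ≤ l → ∀ z : TT, B ≤ ‖z‖ → ‖mu (N l) (H l) 100 z‖ ≤ ε := by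
    intro l hl hl' z hz
    have hHl : (0:ℝ) < H l := by exact_mod_cast h.Hpos l hl
    refine (norm_mu_far (N l) (H l) 100 (h.Hpos l hl) z B (by positivity) hz).trans ?_
    have h1 : 1 / (2 * (H l:ℝ) * B) ≤ 2 * C1 / b0 := by
      rw [div_le_div_iff₀ (by positivity) hb0p, one_mul, hB]
      have h2l : (2:ℝ) ^ k' ≤ 2 ^ l := pow_le_pow_right₀ (by norm_num) hl'
      have hb := h.big l hl
      have : 2 * C1 * (2 * (H l:ℝ) * (b0 / 2 ^ k')) = 4 * b0 * (C1 * H l / 2 ^ k') := by ring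
      rw [this]
      have : 1 ≤ C1 * H l / 2 ^ k' := (one_le_div h2k').2 (h2l.trans hb)
      nlinarith
    have h2 : (1 / (2 * (H l:ℝ) * B)) ^ (2 * 100) ≤ (2 * C1 / b0) ^ (2 * 100) := by
      have : 0 ≤ 1 / (2 * (H l:ℝ) * B) := by positivity
      gcongr
    have h3 : (2 * C1 / b0) ^ (2 * 100) ≤ q :=
      le_trans (pow_le_pow_of_le_one (by positivity) hq1 (by norm_num)) hq
    have : 0 ≤ M * a0 := by positivity
    linarith
  have near : ∀ l, k0 ≤ l → l ≤ k → ∀ z : TT, ‖z‖ ≤ ((S'.disjSum R').card : ℝ) * A → ‖mu (N l) (H l) 100 z - 1‖ ≤ ε := by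
    intro l hl hl' z hz
    refine (norm_mu_sub_one (N l) (H l) 100 ((h.Hpos l hl).trans_le (h.HN l hl)) (h.Hpos l hl) z).trans ?_
    have h1 := h.rad_le hl
    have h2l : (2:ℝ) ^ l ≤ 2 ^ k := pow_le_pow_right₀ (by norm_num) hl'
    have hz' := hz.trans hr
    have hpi := Real.pi_lt_four
    have h2 : 2 * Real.pi * rad (N l) (H l) 100 * ‖z‖ ≤ 2 * 4 * (2 ^ k / 8) * (M * a0 / 2 ^ k) := by
      gcongr
      linarith
    have h3 : 2 * 4 * ((2:ℝ) ^ k / 8) * (M * a0 / 2 ^ k) = M * a0 := by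
      field_simp; norm_num
    linarith
  set UI : Finset ι := S'.filter (fun i => Sum.inl i ∈ U) with hUI
  set UR : Finset κ := R'.filter (fun i => Sum.inr i ∈ U) with hUR
  have memS : ∀ i, (Sum.inl i : ι ⊕ κ) ∈ S'.disjSum R' ↔ i ∈ S' := fun i => inl_mem_disjSum
  have memR : ∀ i, (Sum.inr i : ι ⊕ κ) ∈ S'.disjSum R' ↔ i ∈ R' := fun i => inr_mem_disjSum
  set X : ℝ := 6400 * (mm * b0 * η * Λ * C1) + 3200 * q * ((∑ i ∈ S', ‖c i‖) * ∑ l ∈ R', ‖d l‖) with hX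
  have hXb : ∀ l S1 R1, k0 ≤ l → k' ≤ l → l ≤ k → S1 ⊆ S' → R1 ⊆ R' → (mm ≠ 0 → good l x ∧
      (∀ ψ : TT, ‖∑ y ∈ blk l (x / 2 ^ l), tp S1 c θ y * ch y ψ‖ ≤ η * 2 ^ l) ∧
      (∑ y ∈ blk l (x / 2 ^ l), ‖tp R1 d φ y‖ ≤ Λ * 2 ^ l)) →
      ‖∑ i ∈ S1 ∩ UI, ∑ l' ∈ R1, (c i * ch x (θ i)) * (d l' * ch x (φ l')) * mu (N l) (H l) 100 (a • θ i - (-(b • φ l')))‖ ≤ X := by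
    intro l S1 R1 hl hl1 hl2 hS1 hR1 hgd
    by_cases hm0 : mm = 0
    · have hC0 : C = ∅ := by rw [← card_eq_zero]; omega
      have hU0 : UI = ∅ := by
        rw [hUI, filter_eq_empty_iff]
        intro i _ hiU
        obtain ⟨c, hc, _⟩ := hC _ hiU
        rw [hC0] at hc; simp at hc
      rw [hU0, inter_empty, sum_empty, norm_zero, hX, hm0]
      simp only [Nat.cast_zero, zero_mul, mul_zero, zero_add]
      positivity
    · obtain ⟨g1, g2, g3⟩ := hgd hm0
      have h2l : (0:ℝ) < 2 ^ l := by positivity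
      have hΛ0 : 0 ≤ Λ := by
        have : 0 ≤ Λ * 2 ^ l := le_trans (sum_nonneg fun _ _ => norm_nonneg _) g3
        exact nonneg_of_mul_nonneg_left this h2l
      have hη0 : 0 ≤ η := by
        have : 0 ≤ η * 2 ^ l := (norm_nonneg _).trans (g2 0)
        exact nonneg_of_mul_nonneg_left this h2l
      refine (X_bound h hl g1 S1 R1 c θ d φ η Λ b0 q hq hb0p g2 g3 UI C ?_ ?_).trans ?_
      · intro i hi hiU
        rw [hUI, mem_filter] at hiU
        obtain ⟨c, hc, hcd⟩ := hC _ hiU.2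
        rw [ptt_inl] at hcd
        refine ⟨c, hc, (hcd.trans hr).trans ?_⟩
        have : M * a0 / 2 ^ k ≤ (b0 / 4) / 2 ^ l := by gcongr; norm_num
        refine this.trans (le_of_eq (by ring))
      · intro i hi hiU c hc
        have hiU' : (Sum.inl i : ι ⊕ κ) ∉ U := by
          intro hh; exact hiU (by rw [hUI, mem_filter]; exact ⟨hS1 hi, hh⟩)
        have := hU1 c (hCU hc) (Sum.inl i) ((memS i).2 (hS1 hi)) hiU'
        rw [ptt_inl] at this
        refine le_trans ?_ this
        rw [hB]
        gcongr
        norm_num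
      · rw [hX]
        have hc1 : (C.card : ℝ) ≤ 2 * mm := by exact_mod_cast hCm
        have e1 : (C.card : ℝ) * b0 * η * Λ * C1 ≤ 2 * mm * b0 * η * Λ * C1 := by gcongr
        have e2 : (∑ i ∈ S1, ‖c i‖) * ∑ l ∈ R1, ‖d l‖ ≤ (∑ i ∈ S', ‖c i‖) * ∑ l ∈ R', ‖d l‖ := by gcongr
        have e3 : 3200 * q * ((∑ i ∈ S1, ‖c i‖) * ∑ l ∈ R1, ‖d l‖) ≤
          3200 * q * ((∑ i ∈ S', ‖c i‖) * ∑ l ∈ R', ‖d l‖) := by gcongr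
        linarith
  have main := compare_abs S S' R R' hS hR (fun i => c i * ch x (θ i)) (fun l => d l * ch x (φ l))
    (fun i => a • θ i) (fun l => -(b • φ l)) (mu (N k) (H k) 100) (mu (N k') (H k') 100) B
    (((S'.disjSum R').card : ℝ) * A) ε X X hε0 (far k hk hkk) (far k' hk' le_rfl) (near k hk le_rfl) (near k' hk' hkk)
    UI UR
    (by
      intro i hi hiS
      rw [hUI, mem_filter]
      refine ⟨hi, hYU ?_⟩
      rw [mem_sdiff, memS, inl_mem_disjSum]; exact ⟨hi, hiS⟩)
    (by
      intro i hi hiS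
      rw [hUR, mem_filter]
      refine ⟨hi, hYU ?_⟩
      rw [mem_sdiff, memR, inr_mem_disjSum]; exact ⟨hi, hiS⟩)
    (by
      intro i hi hiU l hl hlU
      have hiU' : (Sum.inl i : ι ⊕ κ) ∉ U := by
        intro hh; exact hiU (by rw [hUI, mem_filter]; exact ⟨hi, hh⟩)
      rw [hUR, mem_filter] at hlU
      have := hU1 _ hlU.2 (Sum.inl i) ((memS i).2 hi) hiU'
      rw [norm_sub_rev, ptt_inl, ptt_inr] at this
      exact this)
    (by
      intro i hi hiU l hl hlU
      have hiU' : (Sum.inl i : ι ⊕ κ) ∉ U := by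
        intro hh; exact hiU (by rw [hUI, mem_filter]; exact ⟨hi, hh⟩)
      have hlU' : (Sum.inr l : ι ⊕ κ) ∉ U := by
        intro hh; exact hlU (by rw [hUR, mem_filter]; exact ⟨hl, hh⟩)
      have := hU2 _ ((memS i).2 hi) hiU' _ ((memR l).2 hl) hlU'
      rw [ptt_inl, ptt_inr] at this
      exact this)
    (hXb k S R hk hkk le_rfl hS hR (fun hm => by
      obtain ⟨g1, g2, g3, g4, g5, g6⟩ := hgood hm
      exact ⟨g1, g3, g5⟩))
    (hXb k' S' R' hk' le_rfl hkk subset_rfl subset_rfl (fun hm => by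
      obtain ⟨g1, g2, g3, g4, g5, g6⟩ := hgood hm
      exact ⟨g2, g4, g6⟩))
  rw [FF, FF, av_pair, av_pair]
  refine main.trans ?_
  simp only [norm_mul, norm_ch, mul_one]
  rw [hX]
  have hRR : 0 ≤ (∑ i ∈ S', ‖c i‖) * ∑ l ∈ R', ‖d l‖ := by positivity
  have hMa : 0 ≤ M * a0 := by positivity
  have : q * ((∑ i ∈ S', ‖c i‖) * ∑ l ∈ R', ‖d l‖) ≤ ε * ((∑ i ∈ S', ‖c i‖) * ∑ l ∈ R', ‖d l‖) := by
    gcongr; linarith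
  linarith

end compare
end DR
end

section
namespace DR
open Finset

abbrev En := ℕ × TT × ℂ

noncomputable def ev (s : Finset En) (y : ℤ) : ℂ := tp s (fun i => i.2.2) (fun i => i.2.1) y

lemma exists_fresh (s : Finset En) : ∃ n : ℕ, ∀ i ∈ s, i.1 < n := by
  refine ⟨s.sup (fun i => i.1) + 1, fun i hi => ?_⟩
  have : i.1 ≤ s.sup (fun i => i.1) := le_sup (f := fun i : En => i.1) hi
  omega

lemma norm_sub_sq_complex (z w : ℂ) : ‖z - w‖ ^ 2 = ‖z‖ ^ 2 - 2 * (z * (starRingEnd ℂ) w).re + ‖w‖ ^ 2 := by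
  rw [← Complex.normSq_eq_norm_sq, ← Complex.normSq_eq_norm_sq, ← Complex.normSq_eq_norm_sq, Complex.normSq_sub]
  ring

lemma conj_ch (n : ℤ) (z : TT) : (starRingEnd ℂ) (ch n z) = ch n (-z) := by
  have h := ch_mul_conj n z
  have h2 : ch n z * ch n (-z) = 1 := by rw [← ch_add_right]; simp [ch_zero_right]
  have h3 := ch_ne_zero n z
  exact mul_left_cancel₀ h3 (h.trans h2.symm)

lemma greedy_step (Q : Finset ℤ) (h : ℤ → ℂ) (η : ℝ) (hη : 0 < η) (s0 : Finset En) (ψ : TT)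
    (hψ : η * Q.card < ‖∑ y ∈ Q, (h y - ev s0 y) * ch y ψ‖) :
    ∃ s : Finset En, s0 ⊆ s ∧ s.card = s0.card + 1 ∧ (∀ i ∈ s, i ∈ s0 ∨ ‖i.2.2‖ = η) ∧
      ∑ y ∈ Q, ‖h y - ev s y‖ ^ 2 + η ^ 2 * Q.card ≤ ∑ y ∈ Q, ‖h y - ev s0 y‖ ^ 2 := by
  classical
  set I := ∑ y ∈ Q, (h y - ev s0 y) * ch y ψ with hI
  have hI0 : 0 < ‖I‖ := lt_of_le_of_lt (by positivity) hψ
  have hIc : (‖I‖ : ℂ) ≠ 0 := by exact_mod_cast hI0.ne'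
  set c : ℂ := η * (I / ‖I‖) with hc
  have hcn : ‖c‖ = η := by
    rw [hc, norm_mul, norm_div, Complex.norm_real, Complex.norm_real, norm_norm, div_self hI0.ne', mul_one,
      Real.norm_eq_abs, abs_of_pos hη]
  obtain ⟨n, hn⟩ := exists_fresh s0
  have hni : ((n, -ψ, c) : En) ∉ s0 := fun hh => lt_irrefl _ (hn _ hh)
  refine ⟨insert (n, -ψ, c) s0, subset_insert _ _, card_insert_of_notMem hni, ?_, ?_⟩
  · intro i hi
    rw [mem_insert] at hi
    rcases hi with rfl | hi
    · right; exact hcn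
    · left; exact hi
  · have e1 : ∀ y, h y - ev (insert (n, -ψ, c) s0) y = (h y - ev s0 y) - c * ch y (-ψ) := by
      intro y; rw [ev, tp, sum_insert hni, ev, tp]; ring
    have e2 : ∀ y, ‖h y - ev (insert (n, -ψ, c) s0) y‖ ^ 2 = ‖h y - ev s0 y‖ ^ 2 -
        2 * (((h y - ev s0 y) * ch y ψ) * (starRingEnd ℂ) c).re + η ^ 2 := by
      intro y
      rw [e1, norm_sub_sq_complex, norm_mul, norm_ch, hcn, mul_one, map_mul, conj_ch, neg_neg]
      congr 4; ring
    have e3 : ∑ y ∈ Q, (((h y - ev s0 y) * ch y ψ) * (starRingEnd ℂ) c).re = η * ‖I‖ := by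
      rw [← Complex.re_sum, ← sum_mul, ← hI, hc, map_mul, map_div₀, Complex.conj_ofReal, Complex.conj_ofReal]
      have : I * (η * ((starRingEnd ℂ) I / ‖I‖)) = ((η * ‖I‖ : ℝ) : ℂ) := by
        have h1 : I * (starRingEnd ℂ) I = (‖I‖ : ℂ) ^ 2 := by
          rw [Complex.mul_conj, Complex.normSq_eq_norm_sq]; push_cast; rfl
        rw [show I * (η * ((starRingEnd ℂ) I / ‖I‖)) = η * (I * (starRingEnd ℂ) I) / ‖I‖ by ring, h1]
        push_cast
        field_simp
      rw [this, Complex.ofReal_re]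
    simp only [e2]
    rw [sum_add_distrib, sum_sub_distrib, ← mul_sum, e3, sum_const, nsmul_eq_mul]
    nlinarith

lemma greedy_exists (Q : Finset ℤ) (hQ : Q.Nonempty) (h : ℤ → ℂ) (η : ℝ) (hη : 0 < η) (s0 : Finset En) :
    ∃ s : Finset En, s0 ⊆ s ∧ (∀ i ∈ s, i ∈ s0 ∨ ‖i.2.2‖ = η) ∧
      (∀ ψ : TT, ‖∑ y ∈ Q, (h y - ev s y) * ch y ψ‖ ≤ η * Q.card) ∧
      ∑ y ∈ Q, ‖h y - ev s y‖ ^ 2 + η ^ 2 * Q.card * s.card ≤ ∑ y ∈ Q, ‖h y - ev s0 y‖ ^ 2 + η ^ 2 * Q.card * s0.card := by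
  have hQc : (0:ℝ) < Q.card := by exact_mod_cast hQ.card_pos
  obtain ⟨n, hn⟩ := exists_nat_ge ((∑ y ∈ Q, ‖h y - ev s0 y‖ ^ 2) / (η ^ 2 * Q.card))
  rw [div_le_iff₀ (by positivity)] at hn
  induction n generalizing s0 with
  | zero =>
    refine ⟨s0, subset_rfl, fun i hi => Or.inl hi, ?_, le_rfl⟩
    by_contra hcon
    push Not at hcon
    obtain ⟨ψ, hψ⟩ := hcon
    obtain ⟨s, _, _, _, h4⟩ := greedy_step Q h η hη s0 ψ hψ
    have : 0 ≤ ∑ y ∈ Q, ‖h y - ev s y‖ ^ 2 := by positivity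
    have h6 : 0 < η ^ 2 * Q.card := by positivity
    simp only [Nat.cast_zero, zero_mul] at hn
    linarith
  | succ n ih =>
    by_cases hcon : ∀ ψ : TT, ‖∑ y ∈ Q, (h y - ev s0 y) * ch y ψ‖ ≤ η * Q.card
    · exact ⟨s0, subset_rfl, fun i hi => Or.inl hi, hcon, le_rfl⟩
    · push Not at hcon
      obtain ⟨ψ, hψ⟩ := hcon
      obtain ⟨s, h1, h2, h3, h4⟩ := greedy_step Q h η hη s0 ψ hψ
      push_cast at hn
      obtain ⟨s', g1, g2, g3, g4⟩ := ih s (by nlinarith)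
      refine ⟨s', h1.trans g1, ?_, g3, ?_⟩
      · intro i hi
        rcases g2 i hi with h' | h'
        · exact h3 i h'
        · exact Or.inr h'
      · rw [h2] at g4; push_cast at g4
        nlinarith

lemma blk_nonempty (k m : ℕ) : (blk k m).Nonempty := by
  rw [← card_pos, card_blk]; positivity

noncomputable def gr (f : ℤ → ℂ) (η : ℝ) (k m : ℕ) (s0 : Finset En) : Finset En :=
  if hη : 0 < η then Classical.choose (greedy_exists (blk k m) (blk_nonempty k m) f η hη s0) else ∅

/-- states at depth j -/
noncomputable def st (f : ℤ → ℂ) (η : ℝ) (K : ℕ) : ℕ → ℕ → Finset En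
  | 0, m => gr f η K m ∅
  | (j + 1), m => gr f η (K - (j + 1)) m (st f η K j (m / 2))

noncomputable def sp (f : ℤ → ℂ) (η : ℝ) (K x j : ℕ) : Finset En := st f η K j (x / 2 ^ (K - j))


lemma gr_spec {f : ℤ → ℂ} {η : ℝ} (hη : 0 < η) (k m : ℕ) (s0 : Finset En) : s0 ⊆ gr f η k m s0 ∧ (∀ i ∈ gr f η k m s0, i ∈ s0 ∨ ‖i.2.2‖ = η) ∧
      (∀ ψ : TT, ‖∑ y ∈ blk k m, (f y - ev (gr f η k m s0) y) * ch y ψ‖ ≤ η * 2 ^ k) ∧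
      ∑ y ∈ blk k m, ‖f y - ev (gr f η k m s0) y‖ ^ 2 + η ^ 2 * 2 ^ k * (gr f η k m s0).card ≤
        ∑ y ∈ blk k m, ‖f y - ev s0 y‖ ^ 2 + η ^ 2 * 2 ^ k * s0.card := by
  have h := Classical.choose_spec (greedy_exists (blk k m) (blk_nonempty k m) f η hη s0)
  have hgr : gr f η k m s0 = Classical.choose (greedy_exists (blk k m) (blk_nonempty k m) f η hη s0) := by
    rw [gr, dif_pos hη]
  rw [← hgr, card_blk] at h
  push_cast at h
  exact h

lemma st_norm {f : ℤ → ℂ} {η : ℝ} (hη : 0 < η) (K j m : ℕ) : ∀ i ∈ st f η K j m, ‖i.2.2‖ = η := by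
  induction j generalizing m with
  | zero =>
    intro i hi
    rcases (gr_spec hη K m ∅).2.1 i hi with h | h
    · simp at h
    · exact h
  | succ j ih =>
    intro i hi
    rcases (gr_spec hη (K - (j + 1)) m (st f η K j (m / 2))).2.1 i hi with h | h
    · exact ih _ i h
    · exact h

lemma st_sup {f : ℤ → ℂ} {η : ℝ} (hη : 0 < η) (K j m : ℕ) (ψ : TT) : ‖∑ y ∈ blk (K - j) m, (f y - ev (st f η K j m) y) * ch y ψ‖ ≤ η * 2 ^ (K - j) := by
  cases j with
  | zero => exact (gr_spec hη K m ∅).2.2.1 ψ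
  | succ j => exact (gr_spec hη (K - (j + 1)) m (st f η K j (m / 2))).2.2.1 ψ

lemma sp_mono {f : ℤ → ℂ} {η : ℝ} (hη : 0 < η) (K x j : ℕ) (hj : j < K) : sp f η K x j ⊆ sp f η K x (j + 1) := by
  have h := (gr_spec (f := f) hη (K - (j + 1)) (x / 2 ^ (K - (j + 1))) (st f η K j (x / 2 ^ (K - (j + 1)) / 2))).1
  rw [Nat.div_div_eq_div_mul, ← pow_succ, show K - (j + 1) + 1 = K - j by omega] at h
  rw [sp, sp, st, Nat.div_div_eq_div_mul, ← pow_succ, show K - (j + 1) + 1 = K - j by omega]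
  exact h

lemma sp_mono_le {f : ℤ → ℂ} {η : ℝ} (hη : 0 < η) (K x : ℕ) {i j : ℕ} (hij : i ≤ j) (hj : j ≤ K) : sp f η K x i ⊆ sp f η K x j := by
  induction j, hij using Nat.le_induction with
  | base => exact subset_rfl
  | succ j hij ih => exact (ih (by omega)).trans (sp_mono hη K x j (by omega))

/-- energy, by level -/
noncomputable def en (f : ℤ → ℂ) (η : ℝ) (K t m : ℕ) : ℝ :=
  (∑ y ∈ blk t m, ‖f y - ev (st f η K (K - t) m) y‖ ^ 2) / 2 ^ t + η ^ 2 * (st f η K (K - t) m).card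

lemma blk_succ (t m : ℕ) (F : ℤ → ℝ) : ∑ y ∈ blk (t + 1) m, F y = ∑ y ∈ blk t (2 * m), F y + ∑ y ∈ blk t (2 * m + 1), F y := by
  unfold blk
  have e1 : (m : ℤ) * 2 ^ (t + 1) = ((2 * m : ℕ) : ℤ) * 2 ^ t := by push_cast; ring
  have e2 : ((m : ℤ) + 1) * 2 ^ (t + 1) = (((2 * m + 1 : ℕ) : ℤ) + 1) * 2 ^ t := by push_cast; ring
  have e3 : (((2 * m : ℕ) : ℤ) + 1) * 2 ^ t = ((2 * m + 1 : ℕ) : ℤ) * 2 ^ t := by push_cast; ring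
  rw [e1, e2, e3]
  have h : (0:ℤ) < 2 ^ t := by positivity
  rw [← sum_union]
  · rw [Ico_union_Ico_eq_Ico]
    · gcongr; omega
    · gcongr; omega
  · exact Ico_disjoint_Ico_consecutive _ _ _

lemma en_nonneg (f : ℤ → ℂ) (η : ℝ) (K t m : ℕ) : 0 ≤ en f η K t m := by unfold en; positivity

lemma en_super {f : ℤ → ℂ} {η : ℝ} (hη : 0 < η) (K t m : ℕ) (ht : t < K) :
    en f η K t (2 * m) + en f η K t (2 * m + 1) ≤ 2 * en f η K (t + 1) m := by
  have key : ∀ m', m' / 2 = m → en f η K t m' ≤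
      (∑ y ∈ blk t m', ‖f y - ev (st f η K (K - (t + 1)) m) y‖ ^ 2) / 2 ^ t + η ^ 2 * (st f η K (K - (t + 1)) m).card := by
    intro m' hm'
    have e : K - t = (K - (t + 1)) + 1 := by omega
    have h := (gr_spec (f := f) hη t m' (st f η K (K - (t + 1)) m)).2.2.2
    have e2 : st f η K (K - t) m' = gr f η t m' (st f η K (K - (t + 1)) m) := by
      rw [e, st, hm']; congr 1; omega
    rw [en, e2]
    have h2 : (0:ℝ) < 2 ^ t := by positivity
    rw [div_add' _ _ _ h2.ne', div_add' _ _ _ h2.ne']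
    gcongr ?_ / _
    linarith
  have k1 := key (2 * m) (by omega)
  have k2 := key (2 * m + 1) (by omega)
  refine (add_le_add k1 k2).trans (le_of_eq ?_)
  rw [en, blk_succ]
  have h2 : (0:ℝ) < 2 ^ t := by positivity
  rw [pow_succ]; field_simp; ring

lemma en_root {f : ℤ → ℂ} {η : ℝ} (hη : 0 < η) (hf : ∀ y, ‖f y‖ ≤ 1) (K m : ℕ) : en f η K K m ≤ 1 := by
  have h := (gr_spec (f := f) hη K m ∅).2.2.2
  have e2 : st f η K (K - K) m = gr f η K m ∅ := by
    rw [Nat.sub_self, st]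
  rw [en, e2]
  have h2 : (0:ℝ) < 2 ^ K := by positivity
  rw [div_add' _ _ _ h2.ne', div_le_one h2]
  have h3 : ∑ y ∈ blk K m, ‖f y - ev ∅ y‖ ^ 2 ≤ 2 ^ K := by
    calc _ ≤ ∑ y ∈ blk K m, (1:ℝ) := by
          refine sum_le_sum fun y _ => ?_
          have : ev ∅ y = 0 := by simp [ev, tp]
          rw [this, sub_zero]
          exact pow_le_one₀ (norm_nonneg _) (hf y)
      _ = 2 ^ K := by rw [sum_const, card_blk]; simp
  simp only [card_empty, Nat.cast_zero, mul_zero, add_zero] at h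
  linarith

/-- natural number version of blocks -/
def fib (t m : ℕ) : Finset ℕ := Ico (m * 2 ^ t) ((m + 1) * 2 ^ t)

lemma card_fib (t m : ℕ) : (fib t m).card = 2 ^ t := by
  rw [fib, Nat.card_Ico, add_mul, one_mul, Nat.add_sub_cancel_left]

lemma mem_fib {t m x : ℕ} : x ∈ fib t m ↔ x / 2 ^ t = m := by
  rw [← mem_blk, fib, blk, mem_Ico, mem_Ico]
  norm_cast

lemma fib_succ (t m : ℕ) : fib (t + 1) m = fib t (2 * m) ∪ fib t (2 * m + 1) := by
  ext x
  rw [mem_union, mem_fib, mem_fib, mem_fib, pow_succ, ← Nat.div_div_eq_div_mul]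
  omega

def exc (e : ℕ → ℕ → ℝ) (lam : ℝ) (t x : ℕ) : Prop := ∃ i ≤ t, lam < e i (x / 2 ^ i)

open Classical in
lemma maximal_aux (e : ℕ → ℕ → ℝ) (K : ℕ) (he0 : ∀ t m, 0 ≤ e t m)
    (he : ∀ t m, t < K → e t (2 * m) + e t (2 * m + 1) ≤ 2 * e (t + 1) m) (lam : ℝ) (hl : 0 ≤ lam)
    (t m : ℕ) (ht : t ≤ K) :
    lam * (((fib t m).filter (exc e lam t)).card : ℝ) ≤ 2 ^ t * e t m := by
  induction t generalizing m with
  | zero =>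
    by_cases h : lam < e 0 m
    · have : ((fib 0 m).filter (exc e lam 0)).card ≤ 1 :=
        (card_filter_le _ _).trans (by rw [card_fib]; simp)
      have h' : (((fib 0 m).filter (exc e lam 0)).card : ℝ) ≤ 1 := by exact_mod_cast this
      nlinarith
    · have : (fib 0 m).filter (exc e lam 0) = ∅ := by
        rw [filter_eq_empty_iff]
        rintro x hx ⟨i, hi, hlt⟩
        rw [mem_fib] at hx
        have : i = 0 := by omega
        subst this
        rw [hx] at hlt
        exact h hlt
      rw [this]; simp [he0]
  | succ t ih =>
    by_cases h : lam < e (t + 1) m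
    · have : ((fib (t + 1) m).filter (exc e lam (t + 1))).card ≤ 2 ^ (t + 1) :=
        (card_filter_le _ _).trans (by rw [card_fib])
      have h' : (((fib (t + 1) m).filter (exc e lam (t + 1))).card : ℝ) ≤ 2 ^ (t + 1) := by exact_mod_cast this
      have h3 : (0:ℝ) < 2 ^ (t + 1) := by positivity
      nlinarith
    · have hsub : (fib (t + 1) m).filter (exc e lam (t + 1)) ⊆
          (fib t (2 * m)).filter (exc e lam t) ∪
          (fib t (2 * m + 1)).filter (exc e lam t) := by
        intro x hx
        rw [mem_filter] at hx
        obtain ⟨hx, i, hi, hlt⟩ := hx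
        have hit : i ≤ t := by
          by_contra hcon
          have : i = t + 1 := by omega
          subst this
          rw [mem_fib] at hx
          rw [hx] at hlt
          exact h hlt
        rw [fib_succ, mem_union] at hx
        rw [mem_union, mem_filter, mem_filter]
        rcases hx with hx | hx
        · exact Or.inl ⟨hx, i, hit, hlt⟩
        · exact Or.inr ⟨hx, i, hit, hlt⟩
      have hc := (card_le_card hsub).trans (card_union_le _ _)
      have hc' : (((fib (t + 1) m).filter (exc e lam (t + 1))).card : ℝ) ≤
          ((fib t (2 * m)).filter (exc e lam t)).card +
          ((fib t (2 * m + 1)).filter (exc e lam t)).card := by exact_mod_cast hc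
      have i1 := ih (2 * m) (by omega)
      have i2 := ih (2 * m + 1) (by omega)
      have hs := he t m (by omega)
      have h2 : (0:ℝ) < 2 ^ t := by positivity
      calc _ ≤ lam * _ := mul_le_mul_of_nonneg_left hc' hl
        _ ≤ 2 ^ t * e t (2 * m) + 2 ^ t * e t (2 * m + 1) := by rw [mul_add]; exact add_le_add i1 i2
        _ ≤ _ := by rw [pow_succ]; nlinarith

lemma fib_root (K : ℕ) : fib K 0 = range (2 ^ K) := by
  ext x; simp [fib]

open Classical in
lemma maximal {f : ℤ → ℂ} {η : ℝ} (hη : 0 < η) (hf : ∀ y, ‖f y‖ ≤ 1) (K : ℕ) (lam : ℝ) (hl : 0 < lam) :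
    ∃ E : Finset ℕ, (E.card : ℝ) ≤ 2 ^ K / lam ∧ ∀ x < 2 ^ K, x ∉ E → ∀ i ≤ K, en f η K i (x / 2 ^ i) ≤ lam := by
  have h := maximal_aux (en f η K) K (en_nonneg f η K) (fun t m ht => en_super hη K t m ht) lam hl.le K 0 le_rfl
  have h1 := en_root hη hf K 0
  have h2 : (0:ℝ) < 2 ^ K := by positivity
  refine ⟨(fib K 0).filter (exc (en f η K) lam K), ?_, ?_⟩
  · rw [le_div_iff₀ hl, mul_comm]
    nlinarith
  · intro x hx hxE i hi
    by_contra hcon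
    push Not at hcon
    apply hxE
    rw [mem_filter, fib_root, mem_range]
    exact ⟨hx, i, hi, hcon⟩

end DR
end

section
namespace DR
open Finset

def anch (r : ℕ → ℕ → ℕ) (mm : ℕ) : ℕ → ℕ
  | 0 => 0
  | (j + 1) => if mm < r (anch r mm j) (j + 1) then j + 1 else anch r mm j

lemma anch_le (r : ℕ → ℕ → ℕ) (mm j : ℕ) : anch r mm j ≤ j := by
  induction j with
  | zero => simp [anch]
  | succ j ih => rw [anch]; split_ifs <;> omega

lemma anch_congr {r r' : ℕ → ℕ → ℕ} {mm j : ℕ} (h : ∀ i j', i ≤ j' → j' ≤ j → r i j' = r' i j') :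
    anch r mm j = anch r' mm j := by
  induction j with
  | zero => simp [anch]
  | succ j ih =>
    have h1 := ih (fun i j' hi hj => h i j' hi (by omega))
    rw [anch, anch, ← h1, h _ _ (by have := anch_le r mm j; omega) le_rfl]

lemma anch_r (r : ℕ → ℕ → ℕ) (mm j : ℕ) (h : anch r mm j ≠ j) : r (anch r mm j) j ≤ mm := by
  cases j with
  | zero => exact absurd rfl h
  | succ j =>
    rw [anch] at h ⊢
    split_ifs at h ⊢ with hc
    · exact absurd rfl h
    · omega

/-- anchor is constant on the run starting at it -/
lemma anch_between (r : ℕ → ℕ → ℕ) (mm : ℕ) {i j : ℕ} (h1 : anch r mm j ≤ i) (h2 : i ≤ j) : anch r mm i = anch r mm j := by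
  induction j with
  | zero => have : i = 0 := by omega
            subst this; rfl
  | succ j ih =>
    rcases Nat.lt_or_ge i (j + 1) with h | h
    · have hne : anch r mm (j + 1) = anch r mm j := by
        rw [anch] at h1 ⊢
        split_ifs at h1 ⊢ with hc
        · omega
        · rfl
      rw [hne] at h1 ⊢
      exact ih h1 (by omega)
    · have : i = j + 1 := by omega
      subst this; rfl

lemma anch_idem (r : ℕ → ℕ → ℕ) (mm j : ℕ) : anch r mm (anch r mm j) = anch r mm j :=
  anch_between r mm le_rfl (anch_le r mm j)

lemma anch_next (r : ℕ → ℕ → ℕ) (mm : ℕ) {i j : ℕ} (hij : i < j) (hi : anch r mm i = i) (hj : anch r mm j = j)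
    (hno : ∀ l, i < l → l < j → anch r mm l ≠ l) : mm < r i j := by
  obtain ⟨j, rfl⟩ : ∃ j', j = j' + 1 := ⟨j - 1, by omega⟩
  have h1 : anch r mm j = i := by
    set l := anch r mm j with hl
    have hl1 := anch_le r mm j
    have hl2 := anch_idem r mm j
    rw [← hl] at hl1 hl2
    rcases lt_trichotomy i l with h | h | h
    · exact absurd hl2 (hno l h (by omega))
    · exact h.symm
    · have := anch_between r mm (i := i) (j := j) (by omega) (by omega)
      omega
  rw [anch, h1] at hj
  split_ifs at hj with hc
  · exact hc
  · omega

lemma anch_count (r : ℕ → ℕ → ℕ) (mm l0 : ℕ) (hl0 : 1 ≤ l0) (J : ℕ) (Ψ : ℕ → ℤ) (hΨ : ∀ i ≤ J, 0 ≤ Ψ i)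
    (H : ∀ i j i', i < j → j + l0 ≤ i' + 1 → i' ≤ J → (r i j : ℤ) ≤ Ψ i - Ψ i') (i : ℕ) (hiJ : i ≤ J)
    (hi : anch r mm i = i) :
    ((((Ioc i J).filter (fun j => anch r mm j = j)).card : ℤ)) * (mm + 1) ≤ l0 * (Ψ i + mm + 1) := by
  induction hn : J - i using Nat.strong_induction_on generalizing i with
  | _ n ih =>
  subst hn
  have hpos := hΨ i hiJ
  have hl0' : (1:ℤ) ≤ l0 := by exact_mod_cast hl0
  by_cases hex : ∃ j, i < j ∧ j ≤ J ∧ anch r mm j = j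
  · obtain ⟨hj1, hj2, hj3⟩ := Nat.find_spec hex
    have hmin : ∀ l, i < l → l < Nat.find hex → anch r mm l ≠ l := by
      intro l h1 h2 h3
      exact Nat.find_min hex h2 ⟨h1, by omega, h3⟩
    set j := Nat.find hex with hj
    have hr := anch_next r mm hj1 hi hj3 hmin
    have hsubA : ((Ioc i J).filter (fun j => anch r mm j = j)).card ≤ l0 - 1 +
        (((Icc (j + l0 - 1) J).filter (fun j => anch r mm j = j)).card) := by
      have hs : (Ioc i J).filter (fun j => anch r mm j = j) ⊆ Ico j (j + l0 - 1) ∪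
          (Icc (j + l0 - 1) J).filter (fun j => anch r mm j = j) := by
        intro l hl
        rw [mem_filter, mem_Ioc] at hl
        rw [mem_union, mem_Ico, mem_filter, mem_Icc]
        have : j ≤ l := by
          by_contra hcon; exact hmin l hl.1.1 (by omega) hl.2
        by_cases h : l < j + l0 - 1
        · left; omega
        · right; exact ⟨⟨by omega, hl.1.2⟩, hl.2⟩
      refine (card_le_card hs).trans ((card_union_le _ _).trans ?_)
      rw [Nat.card_Ico]
      omega
    by_cases hex2 : ∃ l, j + l0 - 1 ≤ l ∧ l ≤ J ∧ anch r mm l = l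
    · obtain ⟨hi1, hi2, hi3⟩ := Nat.find_spec hex2
      have hmin2 : ∀ l, j + l0 - 1 ≤ l → l < Nat.find hex2 → anch r mm l ≠ l := by
        intro l h1 h2 h3
        exact Nat.find_min hex2 h2 ⟨h1, by omega, h3⟩
      set i' := Nat.find hex2 with hi'
      have h1 := H i j i' hj1 (by omega) hi2
      have hsub2 : ((Icc (j + l0 - 1) J).filter (fun j => anch r mm j = j)).card ≤
          1 + ((Ioc i' J).filter (fun j => anch r mm j = j)).card := by
        have hs : (Icc (j + l0 - 1) J).filter (fun j => anch r mm j = j) ⊆ {i'} ∪ (Ioc i' J).filter (fun j => anch r mm j = j) := by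
          intro l hl
          rw [mem_filter, mem_Icc] at hl
          rw [mem_union, mem_singleton, mem_filter, mem_Ioc]
          have : i' ≤ l := by
            by_contra hcon; exact hmin2 l hl.1.1 (by omega) hl.2
          by_cases h : l = i'
          · left; exact h
          · right; exact ⟨⟨by omega, hl.1.2⟩, hl.2⟩
        refine (card_le_card hs).trans ((card_union_le _ _).trans ?_)
        simp
      have ih' := ih (J - i') (by omega) i' hi2 hi3 rfl
      have hA : ((((Ioc i J).filter (fun j => anch r mm j = j)).card : ℤ)) ≤ l0 + (((Ioc i' J).filter (fun j => anch r mm j = j)).card : ℤ) := by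
        omega
      have hr' : (mm : ℤ) + 1 ≤ r i j := by exact_mod_cast hr
      nlinarith
    · have h0 : ((Icc (j + l0 - 1) J).filter (fun j => anch r mm j = j)) = ∅ := by
        rw [filter_eq_empty_iff]
        intro l hl h
        rw [mem_Icc] at hl
        exact hex2 ⟨l, hl.1, hl.2, h⟩
      rw [h0, card_empty, add_zero] at hsubA
      have : ((((Ioc i J).filter (fun j => anch r mm j = j)).card : ℤ)) ≤ l0 := by omega
      have hm : (0:ℤ) ≤ mm := by positivity
      nlinarith
  · have h0 : ((Ioc i J).filter (fun j => anch r mm j = j)) = ∅ := by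
      rw [filter_eq_empty_iff]
      intro l hl h
      rw [mem_Ioc] at hl
      exact hex ⟨l, hl.1, hl.2, h⟩
    rw [h0, card_empty]
    have hm : (0:ℤ) ≤ mm := by positivity
    simp only [Nat.cast_zero, zero_mul]
    positivity

/-- the drift between depth i and depth j -/
noncomputable def rr {ι : Type*} (pt : ι → TT) (A B : ℕ → ℝ) (Z : ℕ → Finset ι) (i j : ℕ) : ℕ :=
  cl pt (A i) (Z j) - cl pt (B j) (Z j) + ((Z j).card - (Z i).card)

lemma rr_anti {ι : Type*} (pt : ι → TT) (A B : ℕ → ℝ) (Z : ℕ → Finset ι) {i i' j : ℕ} (hii : i ≤ i')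
    (hA : A i ≤ A i') (hZ : Z i ⊆ Z i') : rr pt A B Z i' j ≤ rr pt A B Z i j := by
  unfold rr
  have h1 := cl_anti (pt := pt) (Z := Z j) hA
  have h2 := card_le_card hZ
  omega

lemma rr_count {ι : Type*} (pt : ι → TT) (A B : ℕ → ℝ) (Z : ℕ → Finset ι) (J l0 mm M : ℕ) (hl0 : 1 ≤ l0)
    (hZ : ∀ i j, i ≤ j → j ≤ J → Z i ⊆ Z j) (hA : ∀ i j, i ≤ j → A i ≤ A j) (hAB : ∀ i j, i ≤ j → A i ≤ B j) (hBA : ∀ j, B (j + 1) ≤ A (j + l0))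
    (hM : (Z J).card ≤ M) :
    (((range (J + 1)).filter (fun j => anch (rr pt A B Z) mm j = j)).card : ℤ) * (mm + 1) ≤ l0 * (3 * M + mm + 1) + (mm + 1) := by
  have hcard : ∀ i ≤ J, (Z i).card ≤ M := fun i hi => (card_le_card (hZ i J hi le_rfl)).trans hM
  have h := anch_count (rr pt A B Z) mm l0 hl0 J (fun i => (cl pt (A i) (Z i) : ℤ) - 2 * (Z i).card + 2 * M)
    (by intro i hi; have := hcard i hi; omega)
    (by
      intro i j i' hij hji hi'
      have c1 := cl_subset (pt := pt) (r := A i) (hZ i j (by omega) (by omega))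
      have c2 := cl_subset (pt := pt) (r := B j) (hZ j i' (by omega) hi')
      have c3 : cl pt (A i') (Z i') ≤ cl pt (B j) (Z i') := by
        apply cl_anti
        obtain ⟨j', rfl⟩ : ∃ j', j = j' + 1 := ⟨j - 1, by omega⟩
        exact (hBA j').trans (hA _ _ (by omega))
      have c4 := card_le_card (hZ i j (by omega) (by omega))
      have c5 := card_le_card (hZ j i' (by omega) hi')
      have c6 := card_le_card (hZ i i' (by omega) hi')
      have c7 : cl pt (A i') (Z i') ≤ cl pt (B j) (Z j) + ((Z i').card - (Z j).card) := by omega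
      have c8 : cl pt (A i) (Z j) ≤ cl pt (A i) (Z i) + ((Z j).card - (Z i).card) := by omega
      have c9 : cl pt (B j) (Z j) ≤ cl pt (A i) (Z j) := cl_anti (hAB i j (by omega))
      unfold rr
      omega)
    0 (Nat.zero_le _) rfl
  have hΨ0 : (cl pt (A 0) (Z 0) : ℤ) ≤ M := by
    have := (cl_le_card (pt := pt) (r := A 0) (Z := Z 0)).trans (hcard 0 (Nat.zero_le _))
    exact_mod_cast this
  have hs : (range (J + 1)).filter (fun j => anch (rr pt A B Z) mm j = j) ⊆
      {0} ∪ (Ioc 0 J).filter (fun j => anch (rr pt A B Z) mm j = j) := by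
    intro l hl
    rw [mem_filter, mem_range] at hl
    rw [mem_union, mem_singleton, mem_filter, mem_Ioc]
    by_cases h : l = 0
    · left; exact h
    · right; exact ⟨⟨by omega, by omega⟩, hl.2⟩
  have hc := (card_le_card hs).trans (card_union_le _ _)
  rw [card_singleton] at hc
  have hc' : (((range (J + 1)).filter (fun j => anch (rr pt A B Z) mm j = j)).card : ℤ) ≤ 1 +
     (((Ioc 0 J).filter (fun j => anch (rr pt A B Z) mm j = j)).card : ℤ) := by exact_mod_cast hc
  have hm : (0:ℤ) ≤ mm := by positivity
  have hZ0 : (0:ℤ) ≤ (Z 0).card := by positivity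
  have hl0' : (1:ℤ) ≤ l0 := by exact_mod_cast hl0
  nlinarith

end DR
end

section
namespace DR
open Finset

lemma fib_eq_filter {K k m : ℕ} (hk : k ≤ K) (hm : m < 2 ^ (K - k)) :
    (range (2 ^ K)).filter (fun x => x / 2 ^ k = m) = fib k m := by
  ext x
  rw [mem_filter, mem_range, mem_fib]
  constructor
  · exact fun h => h.2
  · intro h
    refine ⟨?_, h⟩
    have e : 2 ^ K = 2 ^ (K - k) * 2 ^ k := by rw [← pow_add]; congr 1; omega
    rw [e]
    rw [← Nat.div_lt_iff_lt_mul (by positivity)]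
    omega

lemma block_sum {K k : ℕ} (hk : k ≤ K) (F : ℕ → ℝ) :
    ∑ x ∈ range (2 ^ K), F x = ∑ m ∈ range (2 ^ (K - k)), ∑ x ∈ fib k m, F x := by
  rw [← sum_fiberwise_of_maps_to (s := range (2 ^ K)) (t := range (2 ^ (K - k))) (g := fun x => x / 2 ^ k)]
  · apply sum_congr rfl
    intro m hm
    rw [fib_eq_filter hk (mem_range.1 hm)]
  · intro x hx
    rw [mem_range] at hx ⊢
    rw [Nat.div_lt_iff_lt_mul (by positivity), ← pow_add]
    rwa [show K - k + k = K by omega]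

lemma card_eq_sum_ite (s : Finset ℕ) (p : ℕ → Prop) [DecidablePred p] : ((s.filter p).card : ℝ) = ∑ x ∈ s, if p x then (1:ℝ) else 0 := by
  rw [card_filter]; push_cast; rfl

open Classical in
lemma tree_count (K J : ℕ) (hJ : J ≤ K) (ν τ : ℝ) (hτ : 0 ≤ τ) (V B : ℕ → ℕ → Prop)
    (hV : ∀ j ≤ J, ∀ x x', x / 2 ^ (K - j) = x' / 2 ^ (K - j) → (V j x → V j x'))
    (hν : ∀ x < 2 ^ K, (((range (J + 1)).filter (fun j => V j x)).card : ℝ) ≤ ν)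
    (hB : ∀ j ≤ J, ∀ m, (((fib (K - j) m).filter (fun x => B j x)).card : ℝ) ≤ τ * 2 ^ (K - j)) :
    (((range (2 ^ K)).filter (fun x => ∃ j ≤ J, V j x ∧ B j x)).card : ℝ) ≤ ν * τ * 2 ^ K := by
  have h1 : (((range (2 ^ K)).filter (fun x => ∃ j ≤ J, V j x ∧ B j x)).card : ℝ) ≤
      ∑ j ∈ range (J + 1), (((range (2 ^ K)).filter (fun x => V j x ∧ B j x)).card : ℝ) := by
    have hs : (range (2 ^ K)).filter (fun x => ∃ j ≤ J, V j x ∧ B j x) ⊆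
        (range (J + 1)).biUnion (fun j => (range (2 ^ K)).filter (fun x => V j x ∧ B j x)) := by
      intro x hx
      rw [mem_filter] at hx
      obtain ⟨hx, j, hj, h⟩ := hx
      rw [mem_biUnion]
      exact ⟨j, mem_range.2 (by omega), mem_filter.2 ⟨hx, h⟩⟩
    have := (card_le_card hs).trans card_biUnion_le
    exact_mod_cast this
  have h2 : ∀ j ∈ range (J + 1), (((range (2 ^ K)).filter (fun x => V j x ∧ B j x)).card : ℝ) ≤
      τ * ∑ x ∈ range (2 ^ K), if V j x then (1:ℝ) else 0 := by
    intro j hj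
    have hj' : j ≤ J := by have := mem_range.1 hj; omega
    rw [card_eq_sum_ite, block_sum (K := K) (k := K - j) (by omega) (fun x => if V j x ∧ B j x then (1:ℝ) else 0),
      block_sum (K := K) (k := K - j) (by omega) (fun x => if V j x then (1:ℝ) else 0), mul_sum]
    apply sum_le_sum
    intro m _
    by_cases hm : ∃ x0 ∈ fib (K - j) m, V j x0
    · obtain ⟨x0, hx0, hV0⟩ := hm
      have hall : ∀ x ∈ fib (K - j) m, V j x := by
        intro x hx
        rw [mem_fib] at hx hx0
        exact hV j hj' x0 x (by rw [hx, hx0]) hV0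
      have e1 : ∑ x ∈ fib (K - j) m, (if V j x then (1:ℝ) else 0) = 2 ^ (K - j) := by
        rw [sum_congr rfl (fun x hx => if_pos (hall x hx)), sum_const, card_fib]
        simp
      rw [e1]
      refine le_trans ?_ (hB j hj' m)
      rw [card_eq_sum_ite]
      apply sum_le_sum
      intro x hx
      split_ifs <;> first | tauto | norm_num
    · push Not at hm
      have e0 : ∑ x ∈ fib (K - j) m, (if V j x ∧ B j x then (1:ℝ) else 0) = 0 :=
        sum_eq_zero (fun x hx => if_neg (fun h => hm x hx h.1))
      rw [e0]
      apply mul_nonneg hτ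
      apply sum_nonneg
      intro x _
      split_ifs <;> norm_num
  refine h1.trans ((sum_le_sum h2).trans ?_)
  rw [← mul_sum, sum_comm]
  have h3 : ∑ x ∈ range (2 ^ K), ∑ j ∈ range (J + 1), (if V j x then (1:ℝ) else 0) ≤ ∑ x ∈ range (2 ^ K), ν := by
    apply sum_le_sum
    intro x hx
    rw [← card_eq_sum_ite]
    exact hν x (mem_range.1 hx)
  rw [sum_const, card_range, nsmul_eq_mul] at h3
  push_cast at h3
  calc _ ≤ τ * (2 ^ K * ν) := mul_le_mul_of_nonneg_left h3 hτ
    _ = _ := by ring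

open Classical in
lemma tree_count_ex (K J : ℕ) (hJ : J ≤ K) (ν τ : ℝ) (hτ : 0 ≤ τ) (V B : ℕ → ℕ → Prop)
    (hV : ∀ j ≤ J, ∀ x x', x / 2 ^ (K - j) = x' / 2 ^ (K - j) → (V j x → V j x'))
    (hν : ∀ x < 2 ^ K, (((range (J + 1)).filter (fun j => V j x)).card : ℝ) ≤ ν)
    (hB : ∀ j ≤ J, ∀ m, (((fib (K - j) m).filter (fun x => B j x)).card : ℝ) ≤ τ * 2 ^ (K - j)) :
    ∃ E : Finset ℕ, (E.card : ℝ) ≤ ν * τ * 2 ^ K ∧ ∀ x < 2 ^ K, x ∉ E → ∀ j ≤ J, V j x → ¬ B j x := by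
  refine ⟨_, tree_count K J hJ ν τ hτ V B hV hν hB, ?_⟩
  intro x hx hxE j hj hVj hBj
  exact hxE (mem_filter.2 ⟨mem_range.2 hx, j, hj, hVj, hBj⟩)

lemma bad_run (x : ℕ) (G : ℕ) : ∀ k, G + 3 ≤ k → (∀ l ≤ k, k ≤ l + G → ¬ good l x) →
    8 * (x % 2 ^ k) < 2 ^ (k - G) ∨ 8 * 2 ^ k ≤ 8 * (x % 2 ^ k) + 2 ^ (k - G) := by
  induction G with
  | zero =>
    intro k hk h
    have h1 := h k le_rfl (by omega)
    unfold good at h1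
    rw [Nat.sub_zero]
    omega
  | succ G ih =>
    intro k hk h
    have h1 := h k le_rfl (by omega)
    have h2 := ih (k - 1) (by omega) (fun l hl hl2 => h l (by omega) (by omega))
    unfold good at h1
    have e1 : 2 ^ k = 2 * 2 ^ (k - 1) := by rw [← pow_succ']; congr 1; omega
    have e2 : x % 2 ^ k % 2 ^ (k - 1) = x % 2 ^ (k - 1) := Nat.mod_mod_of_dvd _ (Dvd.intro_left 2 e1.symm)
    have e3 : x % 2 ^ k < 2 ^ k := Nat.mod_lt _ (by positivity)
    have e4 : 2 ^ (k - 1 - G) ≤ 2 ^ (k - 1) := Nat.pow_le_pow_right (by norm_num) (by omega)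
    rw [show k - (G + 1) = k - 1 - G by omega]
    rw [← e2] at h2
    rw [e1] at h1 e3 h2 ⊢
    generalize x % (2 * 2 ^ (k - 1)) = y at *
    generalize 2 ^ (k - 1) = P at *
    generalize 2 ^ (k - 1 - G) = Q at *
    rcases Nat.lt_or_ge y P with hy | hy
    · rw [Nat.mod_eq_of_lt hy] at h2
      omega
    · have : y % P = y - P := by
        rw [Nat.mod_eq_sub_mod hy, Nat.mod_eq_of_lt (by omega)]
      rw [this] at h2
      omega

open Classical in
lemma bad_run_card (G k m : ℕ) (hk : G + 3 ≤ k) :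
    (((fib k m).filter (fun x => ∀ l ≤ k, k ≤ l + G → ¬ good l x)).card : ℝ) ≤ (1 / 2 ^ G) * 2 ^ k := by
  obtain ⟨t, rfl⟩ : ∃ t, k = t + 3 + G := ⟨k - G - 3, by omega⟩
  have e : (1 / 2 ^ G : ℝ) * 2 ^ (t + 3 + G) = ((8 * 2 ^ t : ℕ) : ℝ) := by
    rw [pow_add _ (t + 3) G]; field_simp; push_cast; ring
  rw [e]
  set P := 2 ^ (t + 3 + G) with hP
  have hs : (fib (t + 3 + G) m).filter (fun x => ∀ l ≤ t + 3 + G, t + 3 + G ≤ l + G → ¬ good l x) ⊆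
      Ico (m * P) (m * P + 2 ^ t) ∪ Ico ((m + 1) * P - 2 ^ t) ((m + 1) * P) := by
    intro x hx
    rw [mem_filter, mem_fib] at hx
    have h := bad_run x G _ hk hx.2
    have e2 := Nat.div_add_mod x P
    have e3 : x % P < P := Nat.mod_lt _ (by positivity)
    rw [hx.1] at e2
    rw [show t + 3 + G - G = t + 3 by omega, ← hP, pow_add 2 t 3] at h
    have e4 : (m + 1) * P = P * m + P := by ring
    rw [mem_union, mem_Ico, mem_Ico, e4, mul_comm m P]
    omega
  have h := (card_le_card hs).trans (card_union_le _ _)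
  rw [Nat.card_Ico, Nat.card_Ico] at h
  have : ((fib (t + 3 + G) m).filter (fun x => ∀ l ≤ t + 3 + G, t + 3 + G ≤ l + G → ¬ good l x)).card ≤ 8 * 2 ^ t := by
    omega
  exact_mod_cast this

open Classical in
/-- number of depths in windows -/
lemma window_count (r : ℕ → ℕ → ℕ) (mm J G : ℕ) (P : ℕ → Prop) (ν : ℝ) (hν0 : 0 ≤ ν)
    (hν : ∀ J' ≤ J, P J' → (((range (J' + 1)).filter (fun j => anch r mm j = j)).card : ℝ) ≤ ν) :
    (((range (J + 1)).filter (fun j => P j ∧ j ≤ anch r mm j + G)).card : ℝ) ≤ ν * (G + 1) := by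
  by_cases hex : ∃ j ≤ J, P j
  · obtain ⟨j0, hj0, hPj0⟩ := hex
    obtain ⟨J', hJ', hmax⟩ : ∃ J', (J' ≤ J ∧ P J') ∧ ∀ j, j ≤ J → P j → j ≤ J' := by
      have hne : ((range (J + 1)).filter P).Nonempty := ⟨j0, by rw [mem_filter, mem_range]; exact ⟨by omega, hPj0⟩⟩
      refine ⟨((range (J + 1)).filter P).max' hne, ?_, ?_⟩
      · have := max'_mem _ hne
        rw [mem_filter, mem_range] at this
        exact ⟨by omega, this.2⟩
      · intro j hj hPj
        apply le_max'
        rw [mem_filter, mem_range]; exact ⟨by omega, hPj⟩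
    have h := hν J' hJ'.1 hJ'.2
    have hs : (range (J + 1)).filter (fun j => P j ∧ j ≤ anch r mm j + G) ⊆
        ((range (J' + 1)).filter (fun j => anch r mm j = j)).biUnion (fun i => Icc i (i + G)) := by
      intro j hj
      rw [mem_filter, mem_range] at hj
      rw [mem_biUnion]
      refine ⟨anch r mm j, ?_, ?_⟩
      · rw [mem_filter, mem_range]
        have := hmax j (by omega) hj.2.1
        have := anch_le r mm j
        exact ⟨by omega, anch_idem r mm j⟩
      · rw [mem_Icc]; exact ⟨anch_le r mm j, hj.2.2⟩
    have h2 := (card_le_card hs).trans card_biUnion_le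
    have h3 : ∀ i ∈ (range (J' + 1)).filter (fun j => anch r mm j = j), (Icc i (i + G)).card = G + 1 := by
      intro i _; rw [Nat.card_Icc]; omega
    rw [sum_congr rfl h3, sum_const, smul_eq_mul] at h2
    have h4 : (((range (J + 1)).filter (fun j => P j ∧ j ≤ anch r mm j + G)).card : ℝ) ≤
      (((range (J' + 1)).filter (fun j => anch r mm j = j)).card : ℝ) * (G + 1) := by exact_mod_cast h2
    exact h4.trans (mul_le_mul_of_nonneg_right h (by positivity))
  · push Not at hex
    rw [filter_false_of_mem]
    · simp; positivity
    · intro j hj h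
      rw [mem_range] at hj
      exact hex j (by omega) h.1

end DR
end

section
namespace DR
open Finset

noncomputable def Av (a b : ℤ) (N H : ℕ → ℕ) (k : ℕ) (x : ℤ) (u w : ℤ → ℂ) : ℂ :=
  av (N k) (H k) 100 (fun n => u (x + a * n) * w (x + b * n))

lemma Av_add_left (a b : ℤ) (N H : ℕ → ℕ) (k : ℕ) (x : ℤ) (u u' w : ℤ → ℂ) :
    Av a b N H k x (fun y => u y + u' y) w = Av a b N H k x u w + Av a b N H k x u' w := by
  unfold Av
  rw [← av_add]; congr 1; funext n; ring

lemma Av_sub_left (a b : ℤ) (N H : ℕ → ℕ) (k : ℕ) (x : ℤ) (u u' w : ℤ → ℂ) :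
    Av a b N H k x (fun y => u y - u' y) w = Av a b N H k x u w - Av a b N H k x u' w := by
  unfold Av
  rw [← av_sub]; congr 1; funext n; ring

lemma Av_sub_right (a b : ℤ) (N H : ℕ → ℕ) (k : ℕ) (x : ℤ) (u w w' : ℤ → ℂ) :
    Av a b N H k x u (fun y => w y - w' y) = Av a b N H k x u w - Av a b N H k x u w' := by
  unfold Av
  rw [← av_sub]; congr 1; funext n; ring

section
variable {a b : ℤ} {C1 : ℝ} {k0 : ℕ} {N H : ℕ → ℕ} {ι κ : Type*}

lemma Adm.Npos (h : Adm a b C1 k0 N H) {k : ℕ} (hk : k0 ≤ k) : 0 < N k :=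
  lt_of_lt_of_le (h.Hpos k hk) (h.HN k hk)

lemma Adm.sqrt_bound (h : Adm a b C1 k0 N H) {k : ℕ} (hk : k0 ≤ k) :
    (2:ℝ) ^ k * (1 / Real.sqrt (N k * H k)) ≤ C1 := by
  have hH : (0:ℝ) < H k := by exact_mod_cast h.Hpos k hk
  have hHN : (H k : ℝ) ≤ N k := by exact_mod_cast h.HN k hk
  have h1 : (H k : ℝ) ≤ Real.sqrt (N k * H k) := by
    apply Real.le_sqrt_of_sq_le
    nlinarith
  rw [mul_one_div, div_le_iff₀ (by linarith)]
  exact (h.big k hk).trans (mul_le_mul_of_nonneg_left h1 h.C1pos.le)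

lemma Av_linear (h : Adm a b C1 k0 N H) {k x : ℕ} (hk : k0 ≤ k) (hg : good k x) (S : Finset ι) (c : ι → ℂ) (θ : ι → TT)
    (w : ℤ → ℂ) (η : ℝ) (hη : 0 ≤ η) (hw : ∀ ψ : TT, ‖∑ y ∈ blk k (x / 2 ^ k), w y * ch y ψ‖ ≤ η * 2 ^ k) :
    ‖Av a b N H k x (tp S c θ) w‖ ≤ (∑ i ∈ S, ‖c i‖) * (C1 * η) := by
  have e : Av a b N H k x (tp S c θ) w =
      ∑ i ∈ S, (c i * ch x (θ i)) * av (N k) (H k) 100 (fun n => w (x + b * n) * ch n (a • θ i)) := by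
    unfold Av tp
    simp_rw [← av_mul_left]
    rw [← av_sum]
    congr 1; funext n
    rw [sum_mul]
    apply sum_congr rfl
    intro i _
    rw [ch_add_left, ch_zsmul, mul_comm n a]; ring
  rw [e, sum_mul]
  refine (norm_sum_le _ _).trans (sum_le_sum fun i _ => ?_)
  rw [norm_mul, norm_mul, norm_ch, mul_one]
  apply mul_le_mul_of_nonneg_left _ (norm_nonneg _)
  have := linear_bound (D := 100) (by norm_num) (h.Npos hk) (h.Hpos k hk) b h.hb w (η * 2 ^ k) hw x
    (fun n hn => h.mem_b hk hg (by have : (0:ℤ) ≤ rad 1 (H k) 100 := by positivity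
                                   linarith)) (a • θ i)
  refine this.trans ?_
  rw [mul_assoc, mul_comm C1]
  exact mul_le_mul_of_nonneg_left (h.sqrt_bound hk) hη

open Classical in
lemma Av_cheb (h : Adm a b C1 k0 N H) {k m : ℕ} (hk : k0 ≤ k) (u g : ℤ → ℂ) (hg : ∀ y, ‖g y‖ ≤ 1) (η t : ℝ) (ht : 0 < t)
    (hu : ∀ ψ : TT, ‖∑ y ∈ blk k m, u y * ch y ψ‖ ≤ η * 2 ^ k) :
    (((fib k m).filter (fun x => good k x ∧ t < ‖Av a b N H k x u g‖)).card : ℝ) ≤ (C1 * η / t) ^ 2 * 2 ^ k := by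
  set F := (fib k m).filter (fun x => good k x ∧ t < ‖Av a b N H k x u g‖) with hF
  have hFm : ∀ x ∈ F, x / 2 ^ k = m ∧ good k x ∧ t < ‖Av a b N H k x u g‖ := by
    intro x hx
    rw [hF, mem_filter, mem_fib] at hx
    exact hx
  have hb := bilinear_bound (D := 100) (by norm_num) (h.Npos hk) (h.Hpos k hk) a b h.ha h.hab u g (η * 2 ^ k) hu
    (F.map Nat.castEmbedding) (by
      intro y hy
      rw [mem_map] at hy
      obtain ⟨x, hx, rfl⟩ := hy
      exact mem_blk.2 (hFm x hx).1) (by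
      intro y hy n hn
      rw [mem_map] at hy
      obtain ⟨x, hx, rfl⟩ := hy
      obtain ⟨h1, h2, -⟩ := hFm x hx
      have h3 : (0:ℤ) ≤ rad 1 (H k) 100 := by positivity
      rw [← h1]
      exact ⟨h.mem_a hk h2 (by linarith), h.mem_b hk h2 (by linarith)⟩)
  rw [sum_map] at hb
  have h1 : (F.card : ℝ) * t ^ 2 ≤ ∑ x ∈ F, ‖Av a b N H k x u g‖ ^ 2 := by
    rw [← nsmul_eq_mul, ← sum_const]
    apply sum_le_sum
    intro x hx
    have := (hFm x hx).2.2
    gcongr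
  have h2 : ∑ y ∈ blk k m, ‖g y‖ ^ 2 ≤ 2 ^ k := by
    have : ∑ y ∈ blk k m, ‖g y‖ ^ 2 ≤ ∑ y ∈ blk k m, (1:ℝ) := by
      apply sum_le_sum
      intro y _
      exact pow_le_one₀ (norm_nonneg _) (hg y)
    rw [sum_const, card_blk] at this
    simpa using this
  have h3 : (η * 2 ^ k) ^ 2 / (N k * H k) ≤ (C1 * η) ^ 2 := by
    have h4 := h.sqrt_bound hk
    have hH : (0:ℝ) < H k := by exact_mod_cast h.Hpos k hk
    have hN : (0:ℝ) < N k := by exact_mod_cast h.Npos hk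
    have h5 : ((2:ℝ) ^ k * (1 / Real.sqrt (N k * H k))) ^ 2 ≤ C1 ^ 2 := by gcongr
    rw [mul_pow, one_div, inv_pow, Real.sq_sqrt (by positivity)] at h5
    calc (η * 2 ^ k) ^ 2 / (N k * H k) = η ^ 2 * ((2 ^ k) ^ 2 * (N k * H k : ℝ)⁻¹) := by rw [div_eq_mul_inv]; ring
      _ ≤ η ^ 2 * C1 ^ 2 := by gcongr
      _ = _ := by ring
  have h6 : (F.card : ℝ) * t ^ 2 ≤ (C1 * η) ^ 2 * 2 ^ k := by
    refine h1.trans (hb.trans ?_)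
    exact mul_le_mul h3 h2 (by positivity) (by positivity)
  rw [div_pow, div_mul_eq_mul_div, le_div_iff₀ (by positivity)]
  exact h6

def path (S : ℕ → ℕ → Finset ι) (K x j : ℕ) : Finset ι := S j (x / 2 ^ (K - j))

noncomputable def Af (K : ℕ) (a0 : ℝ) (j : ℕ) : ℝ := a0 * 2 ^ j / 2 ^ K

lemma Af_eq {K : ℕ} (a0 : ℝ) {j : ℕ} (hj : j ≤ K) : Af K a0 j = a0 / 2 ^ (K - j) := by
  unfold Af
  rw [div_eq_div_iff (by positivity) (by positivity), mul_assoc, ← pow_add]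
  congr 2; omega

lemma Af_mono {K : ℕ} {a0 : ℝ} (ha0 : 0 ≤ a0) {i j : ℕ} (hij : i ≤ j) : Af K a0 i ≤ Af K a0 j := by
  unfold Af
  gcongr
  norm_num

lemma path_congr (S : ℕ → ℕ → Finset ι) {K x x' j i : ℕ} (hj : j ≤ K) (hij : i ≤ j) (h : x / 2 ^ (K - j) = x' / 2 ^ (K - j)) :
    path S K x i = path S K x' i := by
  unfold path
  have e : K - i = (K - j) + (j - i) := by omega
  rw [e, pow_add, ← Nat.div_div_eq_div_mul, ← Nat.div_div_eq_div_mul, h]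

def zz (S : ℕ → ℕ → Finset ι) (R : ℕ → ℕ → Finset κ) (K x j : ℕ) : Finset (ι ⊕ κ) :=
  (path S K x j).disjSum (path R K x j)

/-- drift along the path to x -/
noncomputable def rx (pt : ι ⊕ κ → TT) (a0 b0 : ℝ) (S : ℕ → ℕ → Finset ι) (R : ℕ → ℕ → Finset κ) (K x : ℕ) : ℕ → ℕ → ℕ :=
  rr pt (Af K a0) (Af K b0) (zz S R K x)

lemma anch_rx_congr (pt : ι ⊕ κ → TT) (a0 b0 : ℝ) (S : ℕ → ℕ → Finset ι) (R : ℕ → ℕ → Finset κ) (mm : ℕ) {K x x' j : ℕ} (hj : j ≤ K)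
    (h : x / 2 ^ (K - j) = x' / 2 ^ (K - j)) :
    anch (rx pt a0 b0 S R K x) mm j = anch (rx pt a0 b0 S R K x') mm j := by
  apply anch_congr
  intro i j' hi hj'
  unfold rx rr zz
  rw [path_congr S hj hj' h, path_congr R hj hj' h, path_congr S hj (hi.trans hj') h, path_congr R hj (hi.trans hj') h]

lemma rx_count (pt : ι ⊕ κ → TT) {a0 b0 : ℝ} (ha0 : 0 ≤ a0) (hab : a0 ≤ b0) (S : ℕ → ℕ → Finset ι) (R : ℕ → ℕ → Finset κ) (K x : ℕ)
    (hS : ∀ i j, i ≤ j → j ≤ K → path S K x i ⊆ path S K x j) (hR : ∀ i j, i ≤ j → j ≤ K → path R K x i ⊆ path R K x j)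
    (l0 mm M : ℕ) (hl0 : 1 ≤ l0) (hl : b0 * 2 ≤ a0 * 2 ^ l0) (ν : ℝ)
    (hν : (l0 : ℝ) * (3 * M + mm + 1) + (mm + 1) ≤ ν * (mm + 1)) (J : ℕ) (hJ : J ≤ K) (hM : (zz S R K x J).card ≤ M) :
    (((range (J + 1)).filter (fun j => anch (rx pt a0 b0 S R K x) mm j = j)).card : ℝ) ≤ ν := by
  have h := rr_count pt (Af K a0) (Af K b0) (zz S R K x) J l0 mm M hl0
    (fun i j hij hj => disjSum_mono (hS i j hij (hj.trans hJ)) (hR i j hij (hj.trans hJ)))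
    (fun i j hij => Af_mono ha0 hij) (fun i j hij => (Af_mono ha0 hij).trans (by unfold Af; gcongr))
    (fun j => by
      unfold Af
      apply div_le_div_of_nonneg_right _ (by positivity)
      rw [pow_add, pow_add]
      have : (0:ℝ) < 2 ^ j := by positivity
      nlinarith) hM
  have h' : (((range (J + 1)).filter (fun j => anch (rx pt a0 b0 S R K x) mm j = j)).card : ℝ) * (mm + 1) ≤
    (l0 : ℝ) * (3 * M + mm + 1) + (mm + 1) := by exact_mod_cast h
  have hm : (0:ℝ) < mm + 1 := by positivity
  exact le_of_mul_le_mul_right (h'.trans hν) hm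

end
end DR
end

section
namespace DR
open Finset

set_option linter.unusedSectionVars false
section
variable {a b : ℤ} {C1 : ℝ} {k0 : ℕ} {N H : ℕ → ℕ} {ι κ : Type*} [DecidableEq ι] [DecidableEq κ]

/-- monotone tree of finite sets -/
def Mono (K : ℕ) (S : ℕ → ℕ → Finset ι) : Prop := ∀ x i j, i ≤ j → j ≤ K → path S K x i ⊆ path S K x j

/-- window property -/
def Win (pt : ι ⊕ κ → TT) (a0 b0 : ℝ) (S : ℕ → ℕ → Finset ι) (R : ℕ → ℕ → Finset κ) (K mm M G j x : ℕ) : Prop :=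
  (zz S R K x j).card ≤ M ∧ j ≤ anch (rx pt a0 b0 S R K x) mm j + G

lemma Win_congr (pt : ι ⊕ κ → TT) (a0 b0 : ℝ) (S : ℕ → ℕ → Finset ι) (R : ℕ → ℕ → Finset κ) {K mm M G j x x' : ℕ} (hj : j ≤ K)
    (h : x / 2 ^ (K - j) = x' / 2 ^ (K - j)) (hw : Win pt a0 b0 S R K mm M G j x) : Win pt a0 b0 S R K mm M G j x' := by
  unfold Win zz at hw ⊢
  rwa [← anch_rx_congr pt a0 b0 S R mm hj h, ← path_congr S hj le_rfl h, ← path_congr R hj le_rfl h]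

/-- parameters bundle for the comparison -/
structure Par (C1 a0 b0 q ν : ℝ) (l0 mm M : ℕ) : Prop where
  ha0 : 0 ≤ a0
  hab : a0 ≤ b0
  hq : (2 * C1 / b0) ^ 198 ≤ q
  hb0 : 2 * C1 ≤ b0
  hMab : M * a0 ≤ b0 / 4
  hl0 : 1 ≤ l0
  hl : b0 * 2 ≤ a0 * 2 ^ l0
  hν : (l0 : ℝ) * (3 * M + mm + 1) + (mm + 1) ≤ ν * (mm + 1)


open Classical in
lemma Win_count {a0 b0 q ν : ℝ} {l0 mm M : ℕ} (hp : Par C1 a0 b0 q ν l0 mm M) (pt : ι ⊕ κ → TT) (S : ℕ → ℕ → Finset ι)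
    (R : ℕ → ℕ → Finset κ) (K J G x : ℕ) (hJ : J ≤ K) (hS : Mono K S) (hR : Mono K R) :
    (((range (J + 1)).filter (fun j => Win pt a0 b0 S R K mm M G j x)).card : ℝ) ≤ ν * (G + 1) := by
  have hν0 : 0 ≤ ν := by
    have h1 := hp.hν
    have h2 : (0:ℝ) ≤ (l0 : ℝ) * (3 * M + mm + 1) + (mm + 1) := by positivity
    have h3 : (0:ℝ) < mm + 1 := by positivity
    exact nonneg_of_mul_nonneg_left (h2.trans h1) h3
  unfold Win
  convert window_count (rx pt a0 b0 S R K x) mm J G (fun j => (zz S R K x j).card ≤ M) ν hν0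
    (fun J' hJ' hM => rx_count pt hp.ha0 hp.hab S R K x (hS x) (hR x) l0 mm M hp.hl0 hp.hl ν hp.hν J' (hJ'.trans hJ) hM)

lemma zz_card (S : ℕ → ℕ → Finset ι) (R : ℕ → ℕ → Finset κ) (K x j : ℕ) :
    (zz S R K x j).card = (path S K x j).card + (path R K x j).card := card_disjSum _ _

/-- comparison along the path, for depths i ≤ j -/
lemma compare_path (h : Adm a b C1 k0 N H) {a0 b0 q ν : ℝ} {l0 mm M : ℕ} (hp : Par C1 a0 b0 q ν l0 mm M)
    (S : ℕ → ℕ → Finset ι) (R : ℕ → ℕ → Finset κ) (c : ι → ℂ) (θ : ι → TT) (d : κ → ℂ) (φ : κ → TT)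
    {K x i j : ℕ} (hij : i ≤ j) (hj : j + k0 ≤ K) (hS : Mono K S) (hR : Mono K R) (η Λ P P' : ℝ)
    (hM : (zz S R K x j).card ≤ M)
    (hmm : rx (ptt a b θ φ) a0 b0 S R K x i j ≤ mm)
    (hgood : mm ≠ 0 → good (K - i) x ∧ good (K - j) x ∧ ∀ l ≤ K, 
      (∀ ψ : TT, ‖∑ y ∈ blk (K - l) (x / 2 ^ (K - l)), tp (path S K x l) c θ y * ch y ψ‖ ≤ η * 2 ^ (K - l)) ∧
      (∑ y ∈ blk (K - l) (x / 2 ^ (K - l)), ‖tp (path R K x l) d φ y‖ ≤ Λ * 2 ^ (K - l)))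
    (hP : ∑ i ∈ path S K x j, ‖c i‖ ≤ P) (hP' : ∑ l ∈ path R K x j, ‖d l‖ ≤ P') :
    ‖FF a b N H x (K - i) (path S K x i) (path R K x i) c θ d φ - FF a b N H x (K - j) (path S K x j) (path R K x j) c θ d φ‖ ≤
      12800 * (mm * b0 * η * Λ * C1) + 6404 * (q + M * a0) * (P * P') := by
  have hC1 := h.C1pos
  have hb0 : 0 < b0 := by linarith [hp.hb0]
  have h1 := compare_level h (k := K - i) (k' := K - j) (x := x) (by omega) (by omega) (path S K x i) (path S K x j)
    (path R K x i) (path R K x j) (hS x i j hij (by omega)) (hR x i j hij (by omega)) c θ d φ a0 b0 M q hp.ha0 hp.hq hp.hb0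
    (by rw [zz_card] at hM; exact_mod_cast hM) hp.hMab hp.hab mm η Λ
    (by
      unfold rx rr at hmm
      rw [Af_eq a0 (by omega), Af_eq b0 (by omega)] at hmm
      exact hmm)
    (fun hmm0 => by
      obtain ⟨g1, g2, g3⟩ := hgood hmm0
      exact ⟨g1, g2, (g3 i (by omega)).1, (g3 j (by omega)).1, (g3 i (by omega)).2, (g3 j (by omega)).2⟩)
  refine h1.trans ?_
  have hq0 : 0 ≤ q := le_trans (by positivity) hp.hq
  have ha0 := hp.ha0
  gcongr
  exact le_trans (by positivity) hP

theorem level_prop (h : Adm a b C1 k0 N H) {a0 b0 q ν : ℝ} {l0 mm M : ℕ} (hp : Par C1 a0 b0 q ν l0 mm M)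
    (S : ℕ → ℕ → Finset ι) (R : ℕ → ℕ → Finset κ) (c : ι → ℂ) (θ : ι → TT) (d : κ → ℂ) (φ : κ → TT)
    (K G : ℕ) (hK : k0 ≤ K) (hS : Mono K S) (hR : Mono K R) (η ηg Λ P P' t : ℝ) (hηg : 0 ≤ ηg) (ht : 0 < t)
    (g : ℤ → ℂ) (hg : ∀ y, ‖g y‖ ≤ 1)
    (hsup : ∀ l ≤ K, ∀ m, ∀ ψ : TT, ‖∑ y ∈ blk (K - l) m, tp (S l m) c θ y * ch y ψ‖ ≤ η * 2 ^ (K - l))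
    (hgsup : ∀ l ≤ K, ∀ m, ∀ ψ : TT, ‖∑ y ∈ blk (K - l) m, (g y - tp (R l m) d φ y) * ch y ψ‖ ≤ ηg * 2 ^ (K - l))
    (E0 : Finset ℕ)
    (hE0 : ∀ x < 2 ^ K, x ∉ E0 → ∀ l ≤ K, (zz S R K x l).card ≤ M ∧ ∑ i ∈ path S K x l, ‖c i‖ ≤ P ∧ ∑ i ∈ path R K x l, ‖d i‖ ≤ P' ∧
      ∑ y ∈ blk (K - l) (x / 2 ^ (K - l)), ‖tp (path R K x l) d φ y‖ ≤ Λ * 2 ^ (K - l)) :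
    ∃ E : Finset ℕ, (E.card : ℝ) ≤ E0.card + (ν * (G + 1) * (C1 * η / t) ^ 2 + ν * (1 / 2 ^ G)) * 2 ^ K ∧
      ∀ x < 2 ^ K, x ∉ E → ∀ k, k0 ≤ k → k ≤ K → good k x →
        ‖Av a b N H k x (tp (path S K x (K - k)) c θ) g‖ ≤
          t + (12800 * (mm * b0 * η * Λ * C1) + 6404 * (q + M * a0) * (P * P')) + 2 * (P * (C1 * ηg)) := by
  classical
  set pt := ptt a b θ φ with hpt
  set J := K - k0 with hJ
  obtain ⟨B1, hB1⟩ : ∃ B1 : ℕ → ℕ → Prop, ∀ j x, B1 j x ↔ (good (K - j) x ∧ t < ‖Av a b N H (K - j) x (tp (path S K x j) c θ) g‖) :=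
    ⟨_, fun _ _ => Iff.rfl⟩
  obtain ⟨B2, hB2⟩ : ∃ B2 : ℕ → ℕ → Prop, ∀ j x, B2 j x ↔ (j + G ≤ J ∧ ∀ l ≤ K - j, K - j ≤ l + G → ¬ good l x) :=
    ⟨_, fun _ _ => Iff.rfl⟩
  obtain ⟨E1, hE1c, hE1⟩ := by
    refine tree_count_ex K J (by omega) (ν * (G + 1)) ((C1 * η / t) ^ 2) (by positivity) (fun j x => Win pt a0 b0 S R K mm M G j x) B1 ?_ ?_ ?_
    · intro j hj x x' hxx hw
      exact Win_congr pt a0 b0 S R (by omega) hxx hw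
    · intro x _
      convert Win_count hp pt S R K J G x (by omega) hS hR
    · intro j hj m
      have := Av_cheb h (k := K - j) (m := m) (by omega) (tp (S j m) c θ) g hg η t ht (hsup j (by omega) m)
      refine le_trans ?_ this
      rw [Nat.cast_le]
      apply card_le_card
      intro x hx
      rw [mem_filter] at hx ⊢
      have hxm := mem_fib.1 hx.1
      refine ⟨hx.1, ?_⟩
      have h2 := (hB1 _ _).1 hx.2
      simp only [path, hxm] at h2
      exact h2
  obtain ⟨E2, hE2c, hE2⟩ := by
    refine tree_count_ex K J (by omega) (ν * ((0:ℕ) + 1)) (1 / 2 ^ G) (by positivity) (fun j x => Win pt a0 b0 S R K mm M 0 j x) B2 ?_ ?_ ?_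
    · intro j hj x x' hxx hw
      exact Win_congr pt a0 b0 S R (by omega) hxx hw
    · intro x _
      convert Win_count hp pt S R K J 0 x (by omega) hS hR
    · intro j hj m
      by_cases hjG : j + G ≤ J
      · have h3 := h.k3
        have := bad_run_card G (K - j) m (by omega)
        refine le_trans ?_ this
        rw [Nat.cast_le]
        apply card_le_card
        intro x hx
        rw [mem_filter] at hx ⊢
        exact ⟨hx.1, ((hB2 _ _).1 hx.2).2⟩
      · rw [filter_false_of_mem]
        · simp
        · intro x _ hx
          exact hjG ((hB2 _ _).1 hx).1
  refine ⟨E0 ∪ (E1 ∪ E2), ?_, ?_⟩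
  · have hc : ((E0 ∪ (E1 ∪ E2)).card : ℝ) ≤ E0.card + (E1.card + E2.card) := by
      have h1 := card_union_le E0 (E1 ∪ E2)
      have h2 := card_union_le E1 E2
      exact_mod_cast h1.trans (by omega)
    refine hc.trans ?_
    push_cast at hE2c
    linarith
  · intro x hx hxE k hk hkK hgx
    rw [mem_union, mem_union, not_or, not_or] at hxE
    obtain ⟨hx0, hx1, hx2⟩ := hxE
    have hlive := hE0 x hx hx0
    have hW : ∀ j ≤ J, good (K - j) x → j ≤ anch (rx pt a0 b0 S R K x) mm j + G →
        ‖Av a b N H (K - j) x (tp (path S K x j) c θ) g‖ ≤ t := by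
      intro j hj hgj hjw
      by_contra hcon
      push Not at hcon
      exact hE1 x hx hx1 j hj ⟨(hlive j (by omega)).1, hjw⟩ ((hB1 _ _).2 ⟨hgj, hcon⟩)
    have hP0 : 0 ≤ P := le_trans (by positivity) (hlive 0 (by omega)).2.1
    have hlin : ∀ j ≤ J, good (K - j) x → ‖Av a b N H (K - j) x (tp (path S K x j) c θ) g -
        FF a b N H x (K - j) (path S K x j) (path R K x j) c θ d φ‖ ≤ P * (C1 * ηg) := by
      intro j hj hgj
      have e : FF a b N H x (K - j) (path S K x j) (path R K x j) c θ d φ =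
        Av a b N H (K - j) x (tp (path S K x j) c θ) (tp (path R K x j) d φ) := rfl
      rw [e, ← Av_sub_right]
      have hC1 := h.C1pos
      refine (Av_linear h (by omega) hgj _ c θ _ ηg hηg (hgsup j (by omega) _)).trans ?_
      exact mul_le_mul_of_nonneg_right (hlive j (by omega)).2.1 (by positivity)
    obtain ⟨j, rfl⟩ : ∃ j, k = K - j := ⟨K - k, by omega⟩
    set j' := K - (K - j) with hj'
    have hkj : K - j = K - j' := by omega
    rw [hkj] at hgx ⊢
    have hj'J : j' ≤ J := by omega
    clear_value j'
    set i := anch (rx pt a0 b0 S R K x) mm j' with hi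
    have hiJ := anch_le (rx pt a0 b0 S R K x) mm j'
    have hC1 := h.C1pos
    have hb0 : 0 < b0 := by linarith [hp.hb0]
    have herr2 : 0 ≤ 2 * (P * (C1 * ηg)) := by positivity
    by_cases hjw : j' ≤ i + G
    · have h1 := hW j' hj'J hgx hjw
      have hq0 : 0 ≤ q := le_trans (by positivity) hp.hq
      have ha0 := hp.ha0
      have hP'0 : 0 ≤ P' := le_trans (by positivity) (hlive 0 (by omega)).2.2.1
      have hη : 0 ≤ η := by
        have h5 := hsup 0 (by omega) 0 0
        have : 0 ≤ η * 2 ^ (K - 0) := le_trans (norm_nonneg _) h5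
        exact nonneg_of_mul_nonneg_left this (by positivity)
      have hΛ : 0 ≤ Λ := by
        have h5 := (hlive 0 (by omega)).2.2.2
        have : 0 ≤ Λ * 2 ^ (K - 0) := le_trans (by positivity) h5
        exact nonneg_of_mul_nonneg_left this (by positivity)
      have : 0 ≤ 12800 * (mm * b0 * η * Λ * C1) + 6404 * (q + M * a0) * (P * P') := by positivity
      linarith
    · push Not at hjw
      have hex : ∃ l, i ≤ l ∧ l ≤ i + G ∧ good (K - l) x := by
        by_contra hcon
        push Not at hcon
        refine hE2 x hx hx2 i (by omega) ⟨(hlive i (by omega)).1, ?_⟩ ((hB2 _ _).2 ⟨by omega, ?_⟩)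
        · rw [hi, anch_idem]; omega
        · intro l hl hl2
          have := hcon (K - l) (by omega) (by omega)
          rwa [show K - (K - l) = l by omega] at this
      obtain ⟨l, hil, hlG, hgl⟩ := hex
      have hal : anch (rx pt a0 b0 S R K x) mm l = i := anch_between _ _ hil (by omega)
      have h1 := hW l (by omega) hgl (by rw [hal]; exact hlG)
      have h2 := hlin l (by omega) hgl
      have h3 := hlin j' hj'J hgx
      have hr : rx pt a0 b0 S R K x l j' ≤ mm := by
        refine le_trans (rr_anti pt _ _ _ hil (Af_mono hp.ha0 hil) ?_) (anch_r (rx pt a0 b0 S R K x) mm j' (by omega))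
        exact disjSum_mono (hS x i l hil (by omega)) (hR x i l hil (by omega))
      have h4 := compare_path h hp S R c θ d φ (K := K) (x := x) (i := l) (j := j') (by omega) (by omega) hS hR η Λ P P'
        (hlive j' (by omega)).1 hr
        (fun _ => ⟨hgl, hgx, fun l hl => ⟨hsup l hl _, (hlive l hl).2.2.2⟩⟩) (hlive j' (by omega)).2.1 (hlive j' (by omega)).2.2.1
      have e1 := norm_sub_norm_le (Av a b N H (K - j') x (tp (path S K x j') c θ) g)
        (FF a b N H x (K - j') (path S K x j') (path R K x j') c θ d φ)
      have e2 := norm_sub_norm_le (FF a b N H x (K - l) (path S K x l) (path R K x l) c θ d φ)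
        (Av a b N H (K - l) x (tp (path S K x l) c θ) g)
      rw [norm_sub_rev] at e2
      have e3 := norm_sub_norm_le (FF a b N H x (K - j') (path S K x j') (path R K x j') c θ d φ)
        (FF a b N H x (K - l) (path S K x l) (path R K x l) c θ d φ)
      rw [norm_sub_rev] at e3
      linarith

end
end DR
end

section
namespace DR
open Finset

lemma st_Mono {f : ℤ → ℂ} {η : ℝ} (hη : 0 < η) (K : ℕ) : Mono K (st f η K) :=
  fun x _ _ hij hj => sp_mono_le hη K x hij hj

/-- consequences of bounded energy -/
lemma live {f : ℤ → ℂ} {η : ℝ} (hη : 0 < η) (hf : ∀ y, ‖f y‖ ≤ 1) (K : ℕ) (lam : ℝ) (hl : 0 < lam) :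
    ∃ E : Finset ℕ, (E.card : ℝ) ≤ 2 ^ K / lam ∧ ∀ x < 2 ^ K, x ∉ E → ∀ l ≤ K,
      ((path (st f η K) K x l).card : ℝ) ≤ lam / η ^ 2 ∧ ∑ i ∈ path (st f η K) K x l, ‖i.2.2‖ ≤ lam / η ∧
      ∑ y ∈ blk (K - l) (x / 2 ^ (K - l)), ‖ev (path (st f η K) K x l) y‖ ≤ (2 + lam) * 2 ^ (K - l) := by
  obtain ⟨E, hE, h⟩ := maximal hη hf K lam hl
  refine ⟨E, hE, fun x hx hxE l hlK => ?_⟩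
  have h1 := h x hx hxE (K - l) (by omega)
  unfold en at h1
  rw [show K - (K - l) = l by omega] at h1
  change _ + η ^ 2 * ((path (st f η K) K x l).card : ℝ) ≤ lam at h1
  change (∑ y ∈ blk (K - l) (x / 2 ^ (K - l)), ‖f y - ev (path (st f η K) K x l) y‖ ^ 2) / 2 ^ (K - l) + _ ≤ _ at h1
  have hn := fun i (hi : i ∈ path (st f η K) K x l) => st_norm hη K l _ i hi
  set s := path (st f η K) K x l with hs
  set Q := blk (K - l) (x / 2 ^ (K - l)) with hQ
  have hQc : Q.card = 2 ^ (K - l) := card_blk _ _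
  have h2 : (0:ℝ) < 2 ^ (K - l) := by positivity
  have hsq : 0 ≤ (∑ y ∈ Q, ‖f y - ev s y‖ ^ 2) / 2 ^ (K - l) := by positivity
  have hcard : η ^ 2 * (s.card : ℝ) ≤ lam := by linarith
  have hsum : ∑ y ∈ Q, ‖f y - ev s y‖ ^ 2 ≤ lam * 2 ^ (K - l) := by
    rw [← div_le_iff₀ h2]
    have : 0 ≤ η ^ 2 * (s.card : ℝ) := by positivity
    linarith
  refine ⟨?_, ?_, ?_⟩
  · rw [le_div_iff₀ (by positivity)]; linarith
  · rw [sum_congr rfl hn, sum_const, nsmul_eq_mul, le_div_iff₀ hη]; linarith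
  · have h3 : ∑ y ∈ Q, ‖ev s y‖ ≤ ∑ y ∈ Q, (2 + ‖f y - ev s y‖ ^ 2) := by
      apply sum_le_sum
      intro y _
      have e : ev s y = f y - (f y - ev s y) := by ring
      have h4 : ‖ev s y‖ ≤ ‖f y‖ + ‖f y - ev s y‖ := by
        conv_lhs => rw [e]
        exact norm_sub_le _ _
      have h5 := hf y
      nlinarith [sq_nonneg (‖f y - ev s y‖ - 1)]
    refine h3.trans ?_
    rw [sum_add_distrib, sum_const, hQc, nsmul_eq_mul]
    push_cast
    linarith

/-- difference tree -/
noncomputable def dt (f : ℤ → ℂ) (η' η : ℝ) (K l m : ℕ) : Finset (En ⊕ En) := (st f η' K l m).disjSum (st f η K l m)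

noncomputable def dc : En ⊕ En → ℂ := Sum.elim (fun i => i.2.2) (fun i => -i.2.2)
noncomputable def dθ : En ⊕ En → TT := Sum.elim (fun i => i.2.1) (fun i => i.2.1)

lemma tp_dt (f : ℤ → ℂ) (η' η : ℝ) (K l m : ℕ) (y : ℤ) :
    tp (dt f η' η K l m) dc dθ y = ev (st f η' K l m) y - ev (st f η K l m) y := by
  unfold tp dt ev tp
  rw [sum_disjSum]
  simp only [dc, dθ, Sum.elim_inl, Sum.elim_inr]
  rw [sub_eq_add_neg, ← sum_neg_distrib]
  congr 1
  apply sum_congr rfl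
  intro i _
  ring

lemma path_dt (f : ℤ → ℂ) (η' η : ℝ) (K x l : ℕ) :
    path (dt f η' η K) K x l = (path (st f η' K) K x l).disjSum (path (st f η K) K x l) := rfl

lemma dt_Mono {f : ℤ → ℂ} {η' η : ℝ} (hη' : 0 < η') (hη : 0 < η) (K : ℕ) : Mono K (dt f η' η K) :=
  fun x i j hij hj => by
    rw [path_dt, path_dt]
    exact disjSum_mono (st_Mono hη' K x i j hij hj) (st_Mono hη K x i j hij hj)

lemma dt_sup {f : ℤ → ℂ} {η' η : ℝ} (hη' : 0 < η') (hη : 0 < η) (hηη : η' ≤ η) (K l m : ℕ) (ψ : TT) :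
    ‖∑ y ∈ blk (K - l) m, tp (dt f η' η K l m) dc dθ y * ch y ψ‖ ≤ (2 * η) * 2 ^ (K - l) := by
  have h1 := st_sup (f := f) hη' K l m ψ
  have h2 := st_sup (f := f) hη K l m ψ
  have e : ∑ y ∈ blk (K - l) m, tp (dt f η' η K l m) dc dθ y * ch y ψ =
      ∑ y ∈ blk (K - l) m, (f y - ev (st f η K l m) y) * ch y ψ - ∑ y ∈ blk (K - l) m, (f y - ev (st f η' K l m) y) * ch y ψ := by
    rw [← sum_sub_distrib]
    apply sum_congr rfl
    intro y _
    rw [tp_dt]; ring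
  rw [e]
  refine (norm_sub_le _ _).trans ?_
  have h3 : (0:ℝ) < 2 ^ (K - l) := by positivity
  nlinarith

/-- frequency thresholds -/
noncomputable def eta (T : ℕ) : ℝ := 1 / ((2:ℝ) ^ T) ^ 40
noncomputable def etag (T : ℕ) : ℝ := 1 / ((2:ℝ) ^ T) ^ 46

lemma eta_pos (T : ℕ) : 0 < eta T := by unfold eta; positivity
lemma etag_pos (T : ℕ) : 0 < etag T := by unfold etag; positivity

structure Big (C1 : ℝ) (T : ℕ) : Prop where
  h1 : (2:ℝ) ^ 41 ≤ 2 ^ T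
  h2 : 51200 * C1 ≤ 2 ^ T
  h3 : (302 * T + 1 : ℝ) ≤ 2 ^ T

lemma exists_Big (C1 : ℝ) : ∃ T0, ∀ T ≥ T0, Big C1 T := by
  obtain ⟨n, hn⟩ := pow_unbounded_of_one_lt (51200 * C1) (one_lt_two)
  refine ⟨max n 41, fun T hT => ⟨?_, ?_, ?_⟩⟩
  · exact pow_le_pow_right₀ (by norm_num) (le_trans (le_max_right _ _) hT)
  · exact hn.le.trans (pow_le_pow_right₀ (by norm_num) (le_trans (le_max_left _ _) hT))
  · have h : 41 ≤ T := le_trans (le_max_right _ _) hT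
    have : ∀ T, 41 ≤ T → 302 * T + 1 ≤ 2 ^ T := by
      intro T h
      induction T, h using Nat.le_induction with
      | base => norm_num
      | succ T hT' ih =>
        rw [pow_succ]
        omega
    have := this T h
    exact_mod_cast this

lemma par_ok {C1 : ℝ} (hC1 : 0 < C1) {T : ℕ} (hT : Big C1 T) :
    Par C1 (1 / ((2:ℝ) ^ T) ^ 300) (((2:ℝ) ^ T) ^ 2) (1 / ((2:ℝ) ^ T) ^ 198) (((2:ℝ) ^ T) ^ 74) (302 * T + 1) (2 ^ (24 * T)) (2 ^ (96 * T)) := by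
  obtain ⟨h1, h2, h3⟩ := hT
  have e : ∀ n : ℕ, (2:ℝ) ^ (n * T) = (2 ^ T) ^ n := fun n => by rw [← pow_mul, mul_comm]
  set X : ℝ := 2 ^ T with hX
  have hX0 : 1 ≤ X := le_trans (by norm_num) h1
  have hXp : 0 < X := by linarith
  have hX8 : 8 ≤ X := le_trans (by norm_num) h1
  refine ⟨by positivity, ?_, ?_, ?_, ?_, by omega, ?_, ?_⟩
  · rw [div_le_iff₀ (by positivity)]
    have : 1 ≤ X ^ 302 := one_le_pow₀ hX0
    calc (1:ℝ) ≤ X ^ 302 := this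
      _ = _ := by ring
  · rw [← one_div_pow]
    apply pow_le_pow_left₀ (by positivity)
    rw [div_le_div_iff₀ (by positivity) hXp]
    nlinarith
  · nlinarith
  · push_cast
    rw [e]
    rw [mul_one_div, div_le_div_iff₀ (by positivity) (by norm_num)]
    have h5 : (1:ℝ) ≤ X ^ 205 := one_le_pow₀ hX0
    calc X ^ 96 * 4 ≤ X ^ 96 * X := by gcongr; linarith
      _ ≤ X ^ 96 * X * X ^ 205 := le_mul_of_one_le_right (by positivity) h5
      _ = _ := by ring
  · rw [pow_add, e, pow_one]
    apply le_of_eq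
    field_simp
  · push_cast
    rw [e, e]
    have a1 : (1:ℝ) ≤ X ^ 96 := one_le_pow₀ hX0
    have a2 : X ^ 24 ≤ X ^ 96 := pow_le_pow_right₀ hX0 (by norm_num)
    have a3 : X ^ 96 ≤ X ^ 97 := pow_le_pow_right₀ hX0 (by norm_num)
    have a4 : (0:ℝ) ≤ X ^ 74 := by positivity
    calc (302 * (T:ℝ) + 1) * (3 * X ^ 96 + X ^ 24 + 1) + (X ^ 24 + 1) ≤ X * (3 * X ^ 96 + X ^ 96 + X ^ 96) + (X ^ 97 + X ^ 97) := by
          gcongr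
          linarith
          linarith
      _ = 7 * X ^ 97 := by ring
      _ ≤ X * X ^ 97 := by gcongr; linarith
      _ = X ^ 74 * X ^ 24 := by ring
      _ ≤ _ := by nlinarith

/-- the same with mm = 0, used for the main term -/
lemma par_zero {C1 : ℝ} (hC1 : 0 < C1) {T : ℕ} (hT : Big C1 T) :
    ∃ ν : ℕ, Par C1 (1 / ((2:ℝ) ^ T) ^ 300) (((2:ℝ) ^ T) ^ 2) (1 / ((2:ℝ) ^ T) ^ 198) ν (302 * T + 1) 0 (2 ^ (96 * T)) := by
  have h := par_ok hC1 hT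
  refine ⟨(302 * T + 1) * (3 * 2 ^ (96 * T) + 1) + 1, h.ha0, h.hab, h.hq, h.hb0, h.hMab, h.hl0, h.hl, ?_⟩
  push_cast
  apply le_of_eq; ring

lemma eta_succ (T : ℕ) : eta (T + 1) = 1 / (2 ^ 40 * ((2:ℝ) ^ T) ^ 40) := by
  unfold eta
  rw [pow_succ 2 T, mul_pow, mul_comm]

lemma eta_anti (T : ℕ) : eta (T + 1) ≤ eta T := by
  rw [eta_succ, eta]
  apply one_div_le_one_div_of_le (by positivity)
  have : (0:ℝ) < (2 ^ T) ^ 40 := by positivity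
  nlinarith

theorem level_T {a b : ℤ} {C1 : ℝ} {k0 : ℕ} {N H : ℕ → ℕ} (h : Adm a b C1 k0 N H) {T : ℕ} (hT : Big C1 T) (K : ℕ) (hK : k0 ≤ K)
    (f g : ℤ → ℂ) (hf : ∀ y, ‖f y‖ ≤ 1) (hg : ∀ y, ‖g y‖ ≤ 1) :
    ∃ E : Finset ℕ, (E.card : ℝ) ≤ 3 * (1 / 2 ^ T) * 2 ^ K ∧
      ∀ x < 2 ^ K, x ∉ E → ∀ k, k0 ≤ k → k ≤ K → good k x →
        ‖Av a b N H k x (fun y => ev (path (st f (eta (T + 1)) K) K x (K - k)) y - ev (path (st f (eta T) K) K x (K - k)) y) g‖ ≤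
          4 * (1 / 2 ^ T) := by
  have hC1 := h.C1pos
  have hp := par_ok hC1 hT
  obtain ⟨h1, h2, h3⟩ := hT
  have e : ∀ n : ℕ, (2:ℝ) ^ (n * T) = (2 ^ T) ^ n := fun n => by rw [← pow_mul, mul_comm]
  have hes := eta_succ T
  have he : eta T = 1 / ((2:ℝ) ^ T) ^ 40 := rfl
  have heg : etag T = 1 / ((2:ℝ) ^ T) ^ 46 := rfl
  set X : ℝ := 2 ^ T with hX
  have hX0 : 1 ≤ X := le_trans (by norm_num) h1
  have hXp : 0 < X := by linarith
  have hX8 : 8 ≤ X := le_trans (by norm_num) h1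
  obtain ⟨F1, hF1, hL1⟩ := live (eta_pos (T + 1)) hf K (X ^ 2) (by positivity)
  obtain ⟨F2, hF2, hL2⟩ := live (eta_pos T) hf K (X ^ 2) (by positivity)
  obtain ⟨F3, hF3, hL3⟩ := live (etag_pos T) hg K (X ^ 2) (by positivity)
  obtain ⟨E, hE, hfin⟩ := level_prop h hp (dt f (eta (T + 1)) (eta T) K) (st g (etag T) K) dc dθ (fun i => i.2.2) (fun i => i.2.1)
    K (100 * T) hK (dt_Mono (eta_pos _) (eta_pos _) K) (st_Mono (etag_pos T) K) (2 * eta T) (etag T) (2 + X ^ 2) (X ^ 43) (X ^ 48) (1 / X)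
    (etag_pos T).le (by positivity) g hg
    (fun l hl m ψ => dt_sup (eta_pos _) (eta_pos _) (eta_anti T) K l m ψ)
    (fun l hl m ψ => st_sup (etag_pos T) K l m ψ)
    (F1 ∪ (F2 ∪ F3)) (by
      intro x hx hxE l hl
      rw [mem_union, mem_union, not_or, not_or] at hxE
      obtain ⟨a1, a2, -⟩ := hL1 x hx hxE.1 l hl
      obtain ⟨b1, b2, -⟩ := hL2 x hx hxE.2.1 l hl
      obtain ⟨c1, c2, c3⟩ := hL3 x hx hxE.2.2 l hl
      refine ⟨?_, ?_, ?_, c3⟩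
      · rw [zz_card, path_dt, card_disjSum]
        have : (((path (st f (eta (T + 1)) K) K x l).card : ℝ) + (path (st f (eta T) K) K x l).card +
            (path (st g (etag T) K) K x l).card) ≤ (2:ℝ) ^ (96 * T) := by
          rw [e]
          refine (add_le_add (add_le_add a1 b1) c1).trans ?_
          rw [hes, he, heg]
          have d1 : X ^ 2 / (1 / (2 ^ 40 * X ^ 40)) ^ 2 = 2 ^ 80 * X ^ 82 := by field_simp
          have d2 : X ^ 2 / (1 / X ^ 40) ^ 2 = X ^ 82 := by field_simp
          have d3 : X ^ 2 / (1 / X ^ 46) ^ 2 = X ^ 94 := by field_simp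
          rw [d1, d2, d3]
          have d4 : (2:ℝ) ^ 80 ≤ X ^ 2 := by
            calc (2:ℝ) ^ 80 ≤ (2 ^ 41) ^ 2 := by norm_num
              _ ≤ _ := by gcongr
          have d5 : X ^ 82 ≤ X ^ 95 := pow_le_pow_right₀ hX0 (by norm_num)
          have d6 : X ^ 94 ≤ X ^ 95 := pow_le_pow_right₀ hX0 (by norm_num)
          have d7 : X ^ 84 ≤ X ^ 95 := pow_le_pow_right₀ hX0 (by norm_num)
          calc 2 ^ 80 * X ^ 82 + X ^ 82 + X ^ 94 ≤ X ^ 2 * X ^ 82 + X ^ 95 + X ^ 95 := by gcongr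
            _ = X ^ 84 + X ^ 95 + X ^ 95 := by ring
            _ ≤ 8 * X ^ 95 := by linarith [show 0 ≤ X ^ 95 by positivity]
            _ ≤ X * X ^ 95 := by gcongr
            _ = X ^ 96 := by ring
        exact_mod_cast this
      · rw [path_dt, sum_disjSum]
        simp only [dc, Sum.elim_inl, Sum.elim_inr, norm_neg]
        refine (add_le_add a2 b2).trans ?_
        rw [hes, he]
        have d1 : X ^ 2 / (1 / (2 ^ 40 * X ^ 40)) = 2 ^ 40 * X ^ 42 := by field_simp
        have d2 : X ^ 2 / (1 / X ^ 40) = X ^ 42 := by field_simp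
        rw [d1, d2]
        have : 0 ≤ X ^ 42 := by positivity
        calc 2 ^ 40 * X ^ 42 + X ^ 42 ≤ 2 ^ 41 * X ^ 42 := by linarith
          _ ≤ X * X ^ 42 := by gcongr
          _ = _ := by ring
      · refine c2.trans (le_of_eq ?_)
        rw [heg]; field_simp)
  refine ⟨E, ?_, ?_⟩
  · refine hE.trans ?_
    have hc : ((F1 ∪ (F2 ∪ F3)).card : ℝ) ≤ F1.card + (F2.card + F3.card) := by
      have h1 := card_union_le F1 (F2 ∪ F3)
      have h2 := card_union_le F2 F3
      exact_mod_cast h1.trans (by omega)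
    have hG : (((100 * T : ℕ) : ℝ) + 1) ≤ X := by
      push_cast
      have : (0:ℝ) ≤ T := by positivity
      linarith
    have d1 : (C1 * (2 * eta T) / (1 / X)) ^ 2 ≤ 1 / X ^ 76 := by
      have d2 : C1 * (2 * eta T) / (1 / X) ≤ 1 / X ^ 38 := by
        rw [he, div_div_eq_mul_div, div_one, le_div_iff₀ (by positivity)]
        have : C1 * (2 * (1 / X ^ 40)) * X * X ^ 38 = (2 * C1) / X := by field_simp
        rw [this, div_le_one hXp]
        linarith
      have d3 : 0 ≤ C1 * (2 * eta T) / (1 / X) := by have := eta_pos T; positivity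
      calc _ ≤ (1 / X ^ 38) ^ 2 := by gcongr
        _ = _ := by rw [one_div_pow, ← pow_mul]
    have d4 : X ^ 74 * (((100 * T : ℕ) : ℝ) + 1) * (C1 * (2 * eta T) / (1 / X)) ^ 2 ≤ 1 / X := by
      calc _ ≤ X ^ 74 * X * (1 / X ^ 76) := by gcongr
        _ = _ := by field_simp
    have d5 : X ^ 74 * (1 / 2 ^ (100 * T)) ≤ (1/2) * (1 / X) := by
      rw [e]
      have : X ^ 74 * (1 / X ^ 100) = 1 / X ^ 26 := by field_simp
      rw [this]
      have h9 : X ≤ X ^ 25 := le_self_pow₀ hX0 (by norm_num)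
      rw [div_mul_div_comm, div_le_div_iff₀ (by positivity) (by positivity)]
      calc 1 * (2 * X) ≤ X * X := by nlinarith
        _ ≤ X ^ 25 * X := by gcongr
        _ = _ := by ring
    have hK0 : (0:ℝ) < 2 ^ K := by positivity
    have d6 : (2:ℝ) ^ K / X ^ 2 ≤ (1 / 6) * (1 / X) * 2 ^ K := by
      rw [div_le_iff₀ (by positivity)]
      have : (1:ℝ) / 6 * (1 / X) * 2 ^ K * X ^ 2 = 2 ^ K * (X / 6) := by field_simp
      rw [this]
      nlinarith
    have hXi : (0:ℝ) < 1 / X := by positivity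
    calc _ ≤ 3 * ((1 / 6) * (1 / X) * 2 ^ K) + (1 / X + (1/2) * (1 / X)) * 2 ^ K := by
          gcongr
          linarith
      _ ≤ _ := by nlinarith [mul_pos hXi hK0]
  · intro x hx hxE k hk hkK hgx
    have hm := hfin x hx hxE k hk hkK hgx
    have efun : (tp (path (dt f (eta (T + 1)) (eta T) K) K x (K - k)) dc dθ) =
        (fun y => ev (path (st f (eta (T + 1)) K) K x (K - k)) y - ev (path (st f (eta T) K) K x (K - k)) y) := by
      funext y
      exact tp_dt f _ _ K (K - k) _ y
    rw [efun] at hm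
    refine hm.trans ?_
    push_cast
    rw [e, e, he, heg]
    have d1 : 12800 * (X ^ 24 * X ^ 2 * (2 * (1 / X ^ 40)) * (2 + X ^ 2) * C1) ≤ 1 / X := by
      have : 2 + X ^ 2 ≤ 2 * X ^ 2 := by nlinarith
      calc _ ≤ 12800 * (X ^ 24 * X ^ 2 * (2 * (1 / X ^ 40)) * (2 * X ^ 2) * C1) := by gcongr
        _ = (51200 * C1) / X ^ 12 := by field_simp; ring
        _ ≤ X / X ^ 12 := by gcongr
        _ = 1 / X ^ 11 := by field_simp
        _ ≤ _ := one_div_le_one_div_of_le hXp (le_self_pow₀ hX0 (by norm_num))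
    have d2 : 6404 * (1 / X ^ 198 + X ^ 96 * (1 / X ^ 300)) * (X ^ 43 * X ^ 48) ≤ 1 / X := by
      have : 1 / X ^ 198 + X ^ 96 * (1 / X ^ 300) ≤ 2 * (1 / X ^ 198) := by
        have : X ^ 96 * (1 / X ^ 300) = 1 / X ^ 204 := by field_simp
        rw [this]
        have : 1 / X ^ 204 ≤ 1 / X ^ 198 := one_div_le_one_div_of_le (by positivity) (pow_le_pow_right₀ hX0 (by norm_num))
        linarith
      calc _ ≤ 6404 * (2 * (1 / X ^ 198)) * (X ^ 43 * X ^ 48) := by gcongr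
        _ = 12808 / X ^ 107 := by field_simp; ring
        _ ≤ X / X ^ 107 := by
          gcongr
          exact le_trans (by norm_num) h1
        _ = 1 / X ^ 106 := by field_simp
        _ ≤ _ := one_div_le_one_div_of_le hXp (le_self_pow₀ hX0 (by norm_num))
    have d3 : 2 * (X ^ 43 * (C1 * (1 / X ^ 46))) ≤ 1 / X := by
      calc _ = (2 * C1) / X ^ 3 := by field_simp
        _ ≤ X / X ^ 3 := by gcongr; linarith
        _ = 1 / X ^ 2 := by field_simp
        _ ≤ _ := one_div_le_one_div_of_le hXp (le_self_pow₀ hX0 (by norm_num))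
    linarith

end DR
end

section
namespace DR
open Finset

section
variable {a b : ℤ} {C1 : ℝ} {k0 : ℕ} {N H : ℕ → ℕ}

/-- the structured function at threshold index T, seen from x at level k -/
noncomputable def sT (f : ℤ → ℂ) (K x T k : ℕ) (y : ℤ) : ℂ := ev (path (st f (eta T) K) K x (K - k)) y

theorem base_T (h : Adm a b C1 k0 N H) {T : ℕ} (hT : Big C1 T) : ∃ ν : ℕ, ∀ K, k0 ≤ K → 
    ∀ f g : ℤ → ℂ, (∀ y, ‖f y‖ ≤ 1) → (∀ y, ‖g y‖ ≤ 1) →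
    ∃ E : Finset ℕ, (E.card : ℝ) ≤ (1 / 2 ^ T) * 2 ^ K ∧ ∀ x < 2 ^ K, x ∉ E → ∃ D : Finset ℕ, D.card ≤ ν ∧
      ∀ k k', k0 ≤ k → k ≤ k' → k' ≤ K → good k x → good k' x → (∀ l ∈ D, ¬ (k ≤ l ∧ l < k')) →
        ‖Av a b N H k' x (sT f K x T k') g - Av a b N H k x (sT f K x T k) g‖ ≤ 2 * (1 / 2 ^ T) := by
  have hC1 := h.C1pos
  obtain ⟨ν, hp⟩ := par_zero hC1 hT
  refine ⟨ν, fun K hK f g hf hg => ?_⟩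
  obtain ⟨h1, h2, h3⟩ := hT
  have e : ∀ n : ℕ, (2:ℝ) ^ (n * T) = (2 ^ T) ^ n := fun n => by rw [← pow_mul, mul_comm]
  have he : eta T = 1 / ((2:ℝ) ^ T) ^ 40 := rfl
  have heg : etag T = 1 / ((2:ℝ) ^ T) ^ 46 := rfl
  set X : ℝ := 2 ^ T with hX
  have hX0 : 1 ≤ X := le_trans (by norm_num) h1
  have hXp : 0 < X := by linarith
  have hX8 : 8 ≤ X := le_trans (by norm_num) h1
  obtain ⟨F2, hF2, hL2⟩ := live (eta_pos T) hf K (X ^ 2) (by positivity)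
  obtain ⟨F3, hF3, hL3⟩ := live (etag_pos T) hg K (X ^ 2) (by positivity)
  refine ⟨F2 ∪ F3, ?_, ?_⟩
  · have hc : ((F2 ∪ F3).card : ℝ) ≤ F2.card + F3.card := by exact_mod_cast card_union_le F2 F3
    have hK0 : (0:ℝ) < 2 ^ K := by positivity
    have d6 : (2:ℝ) ^ K / X ^ 2 ≤ (1 / 2) * (1 / X) * 2 ^ K := by
      rw [div_le_iff₀ (by positivity)]
      have : (1:ℝ) / 2 * (1 / X) * 2 ^ K * X ^ 2 = 2 ^ K * (X / 2) := by field_simp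
      rw [this]
      nlinarith
    linarith
  · intro x hx hxE
    rw [mem_union, not_or] at hxE
    set S := st f (eta T) K with hS
    set R := st g (etag T) K with hR
    set pt := ptt a b (fun i : En => i.2.1) (fun i : En => i.2.1) with hpt
    set r := rx pt (1 / X ^ 300) (X ^ 2) S R K x with hr
    have hSm : Mono K S := st_Mono (eta_pos T) K
    have hRm : Mono K R := st_Mono (etag_pos T) K
    have hcard : ∀ l ≤ K, (zz S R K x l).card ≤ 2 ^ (96 * T) := by
      intro l hl
      obtain ⟨b1, -⟩ := hL2 x hx hxE.1 l hl
      obtain ⟨c1, -⟩ := hL3 x hx hxE.2 l hl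
      rw [zz_card]
      have : ((path S K x l).card : ℝ) + (path R K x l).card ≤ (2:ℝ) ^ (96 * T) := by
        rw [e]
        refine (add_le_add b1 c1).trans ?_
        rw [he, heg]
        have d2 : X ^ 2 / (1 / X ^ 40) ^ 2 = X ^ 82 := by field_simp
        have d3 : X ^ 2 / (1 / X ^ 46) ^ 2 = X ^ 94 := by field_simp
        rw [d2, d3]
        have d5 : X ^ 82 ≤ X ^ 95 := pow_le_pow_right₀ hX0 (by norm_num)
        have d6 : X ^ 94 ≤ X ^ 95 := pow_le_pow_right₀ hX0 (by norm_num)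
        calc X ^ 82 + X ^ 94 ≤ X ^ 95 + X ^ 95 := by gcongr
          _ ≤ 8 * X ^ 95 := by linarith [show 0 ≤ X ^ 95 by positivity]
          _ ≤ X * X ^ 95 := by gcongr
          _ = X ^ 96 := by ring
      exact_mod_cast this
    refine ⟨((range (K - k0 + 1)).filter (fun j => anch r 0 j = j)).image (fun j => K - j), ?_, ?_⟩
    · have := rx_count pt hp.ha0 hp.hab S R K x (hSm x) (hRm x) _ 0 _ hp.hl0 hp.hl ν hp.hν (K - k0) (by omega) (hcard _ (by omega))
      exact card_image_le.trans (by exact_mod_cast this)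
    · intro k k' hk hkk hk' hgk hgk' hD
      have hP : ∀ l ≤ K, ∑ i ∈ path S K x l, ‖i.2.2‖ ≤ X ^ 42 := by
        intro l hl
        obtain ⟨-, b2, -⟩ := hL2 x hx hxE.1 l hl
        refine b2.trans (le_of_eq ?_)
        rw [he]; field_simp
      have hP' : ∀ l ≤ K, ∑ i ∈ path R K x l, ‖i.2.2‖ ≤ X ^ 48 := by
        intro l hl
        obtain ⟨-, b2, -⟩ := hL3 x hx hxE.2 l hl
        refine b2.trans (le_of_eq ?_)
        rw [heg]; field_simp
      have hlin : ∀ k, k0 ≤ k → k ≤ K → good k x → ‖Av a b N H k x (sT f K x T k) g -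
          FF a b N H x k (path S K x (K - k)) (path R K x (K - k)) (fun i => i.2.2) (fun i => i.2.1) (fun i => i.2.2) (fun i => i.2.1)‖ ≤
            (1 / 2) * (1 / X) := by
        intro k hk hkK hgk
        have e1 : FF a b N H x k (path S K x (K - k)) (path R K x (K - k)) (fun i => i.2.2) (fun i => i.2.1) (fun i => i.2.2) (fun i => i.2.1) =
          Av a b N H k x (sT f K x T k) (ev (path R K x (K - k))) := rfl
        rw [e1, ← Av_sub_right]
        have hsup := st_sup (f := g) (etag_pos T) K (K - k) (x / 2 ^ (K - (K - k)))
        rw [show K - (K - k) = k by omega] at hsup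
        have h5 := Av_linear h hk hgk (path S K x (K - k)) (fun i => i.2.2) (fun i => i.2.1)
          (fun y => g y - ev (path R K x (K - k)) y) (etag T) (etag_pos T).le (by
            unfold path
            rw [show K - (K - k) = k by omega]
            exact hsup)
        refine h5.trans ?_
        refine (mul_le_mul_of_nonneg_right (hP (K - k) (by omega)) (by have := etag_pos T; positivity)).trans ?_
        rw [heg]
        calc X ^ 42 * (C1 * (1 / X ^ 46)) = C1 / X ^ 4 := by field_simp
          _ ≤ X / X ^ 4 := by gcongr; linarith
          _ = 1 / X ^ 3 := by field_simp
          _ ≤ 1 / (2 * X) := by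
            apply one_div_le_one_div_of_le (by positivity)
            nlinarith [mul_pos hXp hXp]
          _ = _ := by field_simp
      have hcmp : ‖FF a b N H x k' (path S K x (K - k')) (path R K x (K - k')) (fun i => i.2.2) (fun i => i.2.1) (fun i => i.2.2) (fun i => i.2.1) -
          FF a b N H x k (path S K x (K - k)) (path R K x (K - k)) (fun i => i.2.2) (fun i => i.2.1) (fun i => i.2.2) (fun i => i.2.1)‖ ≤ 1 / X := by
        rcases Nat.eq_or_lt_of_le hkk with heq | hlt
        · subst heq
          rw [sub_self, norm_zero]; positivity
        · set p := anch r 0 (K - k) with hpd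
          have hpj := anch_le r 0 (K - k)
          have hpi : p ≤ K - k' := by
            by_contra hcon
            apply hD (K - p)
            · rw [mem_image]
              refine ⟨p, ?_, rfl⟩
              rw [mem_filter, mem_range]
              exact ⟨by omega, anch_idem r 0 (K - k)⟩
            · omega
          have hrr : rx pt (1 / X ^ 300) (X ^ 2) S R K x (K - k') (K - k) ≤ 0 := by
            refine le_trans (rr_anti pt _ _ _ hpi (Af_mono hp.ha0 hpi) ?_) (anch_r r 0 (K - k) (by omega))
            exact disjSum_mono (hSm x _ _ hpi (by omega)) (hRm x _ _ hpi (by omega))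
          have h4 := compare_path h hp S R (fun i : En => i.2.2) (fun i : En => i.2.1) (fun i : En => i.2.2) (fun i : En => i.2.1)
            (K := K) (x := x) (i := K - k') (j := K - k) (by omega) (by omega) hSm hRm 0 0 (X ^ 42) (X ^ 48)
            (hcard _ (by omega)) hrr (fun hcon => absurd rfl hcon) (hP _ (by omega)) (hP' _ (by omega))
          rw [show K - (K - k') = k' by omega, show K - (K - k) = k by omega] at h4
          refine h4.trans ?_
          push_cast
          rw [e]
          have : 1 / X ^ 198 + X ^ 96 * (1 / X ^ 300) ≤ 2 * (1 / X ^ 198) := by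
            have : X ^ 96 * (1 / X ^ 300) = 1 / X ^ 204 := by field_simp
            rw [this]
            have : 1 / X ^ 204 ≤ 1 / X ^ 198 := one_div_le_one_div_of_le (by positivity) (pow_le_pow_right₀ hX0 (by norm_num))
            linarith
          calc _ = 6404 * (1 / X ^ 198 + X ^ 96 * (1 / X ^ 300)) * (X ^ 42 * X ^ 48) := by ring
            _ ≤ 6404 * (2 * (1 / X ^ 198)) * (X ^ 42 * X ^ 48) := by gcongr
            _ = 12808 / X ^ 108 := by field_simp; ring
            _ ≤ X / X ^ 108 := by
              gcongr
              exact le_trans (by norm_num) h1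
            _ = 1 / X ^ 107 := by field_simp
            _ ≤ _ := one_div_le_one_div_of_le hXp (le_self_pow₀ hX0 (by norm_num))
      have l1 := hlin k hk (by omega) hgk
      have l2 := hlin k' (by omega) hk' hgk'
      rw [← dist_eq_norm] at l1 l2 hcmp ⊢
      rw [dist_comm] at l1
      refine (dist_triangle4 _ _ _ _).trans (le_trans (add_le_add (add_le_add l2 hcmp) l1) ?_)
      linarith

open Classical in
lemma remainder (h : Adm a b C1 k0 N H) (K : ℕ) (hK : k0 ≤ K) (f g : ℤ → ℂ) (hg : ∀ y, ‖g y‖ ≤ 1) (T : ℕ) (t : ℝ) (ht : 0 < t) :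
    ∃ E : Finset ℕ, (E.card : ℝ) ≤ (K + 1) * (C1 * eta T / t) ^ 2 * 2 ^ K ∧ ∀ x < 2 ^ K, x ∉ E → ∀ k, k0 ≤ k → k ≤ K → good k x →
      ‖Av a b N H k x f g - Av a b N H k x (sT f K x T k) g‖ ≤ t := by
  obtain ⟨B1, hB1⟩ : ∃ B1 : ℕ → ℕ → Prop, ∀ j x, B1 j x ↔
      (good (K - j) x ∧ t < ‖Av a b N H (K - j) x (fun y => f y - ev (path (st f (eta T) K) K x j) y) g‖) := ⟨_, fun _ _ => Iff.rfl⟩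
  obtain ⟨E, hE, hE2⟩ := by
    refine tree_count_ex K (K - k0) (by omega) (K + 1) ((C1 * eta T / t) ^ 2) (by positivity) (fun _ _ => True) B1 ?_ ?_ ?_
    · intro j _ x x' _ _; trivial
    · intro x _
      have := card_filter_le (range (K - k0 + 1)) (fun _ => True)
      rw [card_range] at this
      have h2 : (((range (K - k0 + 1)).filter (fun _ => True)).card : ℝ) ≤ K + 1 := by
        exact_mod_cast this.trans (by omega)
      convert h2
    · intro j hj m
      have := Av_cheb h (k := K - j) (m := m) (by omega) (fun y => f y - ev (st f (eta T) K j m) y) g hg (eta T) t ht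
        (st_sup (eta_pos T) K j m)
      refine le_trans ?_ this
      rw [Nat.cast_le]
      apply card_le_card
      intro x hx
      rw [mem_filter] at hx ⊢
      have hxm := mem_fib.1 hx.1
      refine ⟨hx.1, ?_⟩
      have h2 := (hB1 _ _).1 hx.2
      simp only [path, hxm] at h2
      exact h2
  refine ⟨E, hE, fun x hx hxE k hk hkK hgk => ?_⟩
  have h1 := hE2 x hx hxE (K - k) (by omega) trivial
  rw [hB1, show K - (K - k) = k by omega] at h1
  rw [← Av_sub_left]
  by_contra hcon
  push Not at hcon
  exact h1 ⟨hgk, hcon⟩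

lemma tele (h : Adm a b C1 k0 N H) {T0 : ℕ} (hT0 : ∀ T ≥ T0, Big C1 T) (K : ℕ) (hK : k0 ≤ K)
    (f g : ℤ → ℂ) (hf : ∀ y, ‖f y‖ ≤ 1) (hg : ∀ y, ‖g y‖ ≤ 1) (n : ℕ) :
    ∃ E : Finset ℕ, (E.card : ℝ) ≤ 6 * (1 / 2 ^ T0 - 1 / 2 ^ (T0 + n)) * 2 ^ K ∧ ∀ x < 2 ^ K, x ∉ E → ∀ k, k0 ≤ k → k ≤ K → good k x →
      ‖Av a b N H k x (sT f K x (T0 + n) k) g - Av a b N H k x (sT f K x T0 k) g‖ ≤ 8 * (1 / 2 ^ T0 - 1 / 2 ^ (T0 + n)) := by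
  induction n with
  | zero => exact ⟨∅, by simp, fun x _ _ k _ _ _ => by simp⟩
  | succ n ih =>
    obtain ⟨E, hE, hE2⟩ := ih
    obtain ⟨F, hF, hF2⟩ := level_T h (hT0 (T0 + n) (by omega)) K hK f g hf hg
    refine ⟨E ∪ F, ?_, fun x hx hxE k hk hkK hgk => ?_⟩
    · have hc : ((E ∪ F).card : ℝ) ≤ E.card + F.card := by exact_mod_cast card_union_le E F
      refine hc.trans ((add_le_add hE hF).trans (le_of_eq ?_))
      rw [← add_assoc, pow_succ _ (T0 + n)]; field_simp; ring
    · rw [mem_union, not_or] at hxE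
      have h1 := hE2 x hx hxE.1 k hk hkK hgk
      have h2 := hF2 x hx hxE.2 k hk hkK hgk
      rw [Av_sub_left] at h2
      change ‖Av a b N H k x (sT f K x (T0 + n + 1) k) g - Av a b N H k x (sT f K x (T0 + n) k) g‖ ≤ _ at h2
      rw [← dist_eq_norm] at h1 h2 ⊢
      refine (dist_triangle _ _ _).trans ((add_le_add h2 h1).trans (le_of_eq ?_))
      rw [← add_assoc, pow_succ _ (T0 + n)]; field_simp; ring

theorem core (h : Adm a b C1 k0 N H) (ε : ℝ) (hε : 0 < ε) : ∃ ν : ℕ, ∀ K, k0 ≤ K → 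
    ∀ f g : ℤ → ℂ, (∀ y, ‖f y‖ ≤ 1) → (∀ y, ‖g y‖ ≤ 1) →
    ∃ E : Finset ℕ, (E.card : ℝ) ≤ ε * 2 ^ K ∧ ∀ x < 2 ^ K, x ∉ E → ∃ D : Finset ℕ, D.card ≤ ν ∧
      ∀ k k', k0 ≤ k → k ≤ k' → k' ≤ K → good k x → good k' x → (∀ l ∈ D, ¬ (k ≤ l ∧ l < k')) →
        ‖Av a b N H k' x f g - Av a b N H k x f g‖ ≤ ε := by
  obtain ⟨T1, hT1⟩ := exists_Big C1
  obtain ⟨T2, hT2⟩ := pow_unbounded_of_one_lt (20 / ε) (one_lt_two)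
  set T0 := max T1 T2 with hT0
  have hbig : ∀ T ≥ T0, Big C1 T := fun T hT => hT1 T ((le_max_left _ _).trans hT)
  obtain ⟨ν, hν⟩ := base_T h (hbig T0 le_rfl)
  have hX : 20 * (1 / (2:ℝ) ^ T0) ≤ ε := by
    have h1 : (2:ℝ) ^ T2 ≤ 2 ^ T0 := pow_le_pow_right₀ (by norm_num) (le_max_right _ _)
    rw [mul_one_div, div_le_iff₀ (by positivity)]
    rw [div_lt_iff₀ hε] at hT2
    nlinarith
  set t : ℝ := 1 / 2 ^ T0 with ht
  have htp : 0 < t := by positivity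
  refine ⟨ν, fun K hK f g hf hg => ?_⟩
  obtain ⟨E1, hE1, h1⟩ := hν K hK f g hf hg
  have hlim : Filter.Tendsto (fun n : ℕ => ((K:ℝ) + 1) * (C1 * eta (T0 + n) / t) ^ 2) Filter.atTop (nhds (((K:ℝ) + 1) * (C1 * 0 / t) ^ 2)) := by
    refine Filter.Tendsto.const_mul _ (Filter.Tendsto.pow ?_ 2)
    refine Filter.Tendsto.div_const (Filter.Tendsto.const_mul _ ?_) _
    have h5 : Filter.Tendsto (fun n : ℕ => ((1:ℝ) / 2 ^ 40) ^ (n + T0)) Filter.atTop (nhds 0) :=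
      (Filter.tendsto_add_atTop_iff_nat T0).2 (tendsto_pow_atTop_nhds_zero_of_lt_one (by positivity) (by norm_num))
    refine h5.congr (fun n => ?_)
    unfold eta
    rw [one_div_pow, ← pow_mul, ← pow_mul, mul_comm 40, add_comm]
  obtain ⟨n, hn⟩ : ∃ n : ℕ, ((K:ℝ) + 1) * (C1 * eta (T0 + n) / t) ^ 2 ≤ t := by
    have := hlim.eventually_lt_const (u := t) (by simpa using htp)
    obtain ⟨n, hn⟩ := this.exists
    exact ⟨n, hn.le⟩
  obtain ⟨E2, hE2, h2⟩ := tele h hbig K hK f g hf hg n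
  obtain ⟨E3, hE3, h3⟩ := remainder h K hK f g hg (T0 + n) t htp
  have htn : 0 ≤ 1 / (2:ℝ) ^ (T0 + n) := by positivity
  have hKp : (0:ℝ) < 2 ^ K := by positivity
  refine ⟨E1 ∪ (E2 ∪ E3), ?_, fun x hx hxE => ?_⟩
  · have hc : ((E1 ∪ (E2 ∪ E3)).card : ℝ) ≤ E1.card + (E2.card + E3.card) := by
      have h1 := card_union_le E1 (E2 ∪ E3)
      have h2 := card_union_le E2 E3
      exact_mod_cast h1.trans (by omega)
    have h4 : (E3.card : ℝ) ≤ t * 2 ^ K := hE3.trans (mul_le_mul_of_nonneg_right hn hKp.le)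
    have h5 : (E2.card : ℝ) ≤ 6 * t * 2 ^ K := hE2.trans (by gcongr; linarith)
    have h6 : (8 * t) * 2 ^ K ≤ ε * 2 ^ K := by gcongr; linarith
    linarith
  · rw [mem_union, mem_union, not_or, not_or] at hxE
    obtain ⟨D, hD, hDD⟩ := h1 x hx hxE.1
    refine ⟨D, hD, fun k k' hk hkk hk' hgk hgk' hno => ?_⟩
    have b1 := hDD k k' hk hkk hk' hgk hgk' hno
    have c1 := h2 x hx hxE.2.1 k hk (by omega) hgk
    have c2 := h2 x hx hxE.2.1 k' (by omega) hk' hgk'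
    have d1 := h3 x hx hxE.2.2 k hk (by omega) hgk
    have d2 := h3 x hx hxE.2.2 k' (by omega) hk' hgk'
    rw [← dist_eq_norm] at b1 c1 c2 d1 d2 ⊢
    have e1 := dist_triangle4 (Av a b N H k' x f g) (Av a b N H k' x (sT f K x (T0 + n) k') g) (Av a b N H k' x (sT f K x T0 k') g)
      (Av a b N H k x (sT f K x T0 k) g)
    have e2 := dist_triangle4 (Av a b N H k' x f g) (Av a b N H k x (sT f K x T0 k) g) (Av a b N H k x (sT f K x (T0 + n) k) g)
      (Av a b N H k x f g)
    have q1 := dist_comm (Av a b N H k x f g) (Av a b N H k x (sT f K x (T0 + n) k) g)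
    have q2 := dist_comm (Av a b N H k x (sT f K x (T0 + n) k) g) (Av a b N H k x (sT f K x T0 k) g)
    have q3 := dist_comm (Av a b N H k' x f g) (Av a b N H k' x (sT f K x (T0 + n) k') g)
    have q4 := dist_comm (Av a b N H k' x (sT f K x (T0 + n) k') g) (Av a b N H k' x (sT f K x T0 k') g)
    have q5 := dist_comm (Av a b N H k' x (sT f K x T0 k') g) (Av a b N H k x (sT f K x T0 k) g)
    linarith

end
end DR
end

section
namespace DR
open Finset

lemma good_count (k K : ℕ) (hk : 3 ≤ k) (hkK : k ≤ K) :
    ∃ B : Finset ℕ, 4 * B.card ≤ 2 ^ K ∧ ∀ x < 2 ^ K, x ∉ B → good k x := by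
  classical
  refine ⟨(range (2 ^ K)).filter (fun x => ¬ good k x), ?_, ?_⟩
  · obtain ⟨j, rfl⟩ := Nat.exists_eq_add_of_le hk
    have hm : ∀ x ∈ (range (2 ^ K)).filter (fun x => ¬ good (3 + j) x),
        (x / 2 ^ (3 + j), x % 2 ^ (3 + j)) ∈ (range (2 ^ (K - (3 + j)))) ×ˢ (range (2 ^ j) ∪ Ico (7 * 2 ^ j) (8 * 2 ^ j)) := by
      intro x hx
      rw [mem_filter, mem_range] at hx
      have hp : (2:ℕ) ^ (3 + j) = 8 * 2 ^ j := by rw [pow_add]; norm_num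
      have h1 : x % 2 ^ (3 + j) < 2 ^ (3 + j) := Nat.mod_lt _ (by positivity)
      rw [mem_product, mem_union, mem_range, mem_range, mem_Ico]
      refine ⟨?_, ?_⟩
      · simp only
        rw [Nat.div_lt_iff_lt_mul (by positivity), ← pow_add, Nat.sub_add_cancel hkK]; exact hx.1
      · have h2 := hx.2
        unfold good at h2
        simp only
        generalize x % 2 ^ (3 + j) = r at *
        rw [hp] at h1 h2
        omega
    have hc := card_le_card_of_injOn (s := (range (2 ^ K)).filter (fun x => ¬ good (3 + j) x))
      (fun x => (x / 2 ^ (3 + j), x % 2 ^ (3 + j))) hm (by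
        intro x _ y _ hxy
        simp only [Prod.mk.injEq] at hxy
        rw [← Nat.div_add_mod x (2 ^ (3 + j)), ← Nat.div_add_mod y (2 ^ (3 + j)), hxy.1, hxy.2])
    rw [card_product, card_range] at hc
    have hc2 := card_union_le (range (2 ^ j)) (Ico (7 * 2 ^ j) (8 * 2 ^ j))
    rw [card_range, Nat.card_Ico] at hc2
    have hK : 2 ^ K = 2 ^ (K - (3 + j)) * (8 * 2 ^ j) := by
      rw [show (8:ℕ) = 2 ^ 3 by norm_num, ← pow_add, ← pow_add, Nat.sub_add_cancel hkK]
    calc _ ≤ 4 * (2 ^ (K - (3 + j)) * (2 ^ j + 2 ^ j)) := by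
            gcongr; refine hc.trans (Nat.mul_le_mul_left _ ?_); omega
      _ = 2 ^ K := by rw [hK]; ring
  · intro x hx hn
    simpa [hx] using hn

open MeasureTheory
set_option linter.unusedSectionVars false

section
variable {X : Type*} [MeasurableSpace X] (μ : Measure X) [IsProbabilityMeasure μ]
  (τ : ℕ → X → X) (S : ℕ → X → ℂ) (k0 : ℕ)

/-- jump set -/
def JS (ε : ℝ) (m M : ℕ) : Set X := {z | ∃ k k', m ≤ k ∧ k ≤ k' ∧ k' ≤ M ∧ ε < ‖S k' z - S k z‖}

def JG (ε : ℝ) (m M x : ℕ) : Set X :=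
  {z | ∃ k k', m ≤ k ∧ k ≤ k' ∧ k' ≤ M ∧ good k x ∧ good k' x ∧ ε < ‖S k' z - S k z‖}

def PT (ε : ℝ) (ν : ℕ) : Prop := ∀ K, k0 ≤ K → ∀ y : X, 
    ∃ E : Finset ℕ, (E.card : ℝ) ≤ ε * 2 ^ K ∧ ∀ x < 2 ^ K, x ∉ E → ∃ D : Finset ℕ, D.card ≤ ν ∧
      ∀ k k', k0 ≤ k → k ≤ k' → k' ≤ K → good k x → good k' x → (∀ l ∈ D, ¬ (k ≤ l ∧ l < k')) →
        ‖S k' (τ x y) - S k (τ x y)‖ ≤ ε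

variable {S τ k0 μ}

lemma meas_JS (hS : ∀ k, Measurable (S k)) (ε : ℝ) (m M : ℕ) : MeasurableSet (JS S ε m M) := by
  have : JS S ε m M = ⋃ k, ⋃ k', {z | m ≤ k ∧ k ≤ k' ∧ k' ≤ M ∧ ε < ‖S k' z - S k z‖} := by
    ext z; simp [JS]
  rw [this]
  refine MeasurableSet.iUnion fun k => MeasurableSet.iUnion fun k' => ?_
  refine (MeasurableSet.const _).inter ((MeasurableSet.const _).inter ((MeasurableSet.const _).inter ?_))
  exact measurableSet_lt measurable_const ((hS _).sub (hS _)).norm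

lemma meas_JG (hS : ∀ k, Measurable (S k)) (ε : ℝ) (m M x : ℕ) : MeasurableSet (JG S ε m M x) := by
  have : JG S ε m M x = ⋃ k, ⋃ k', {z | m ≤ k ∧ k ≤ k' ∧ k' ≤ M ∧ good k x ∧ good k' x ∧ ε < ‖S k' z - S k z‖} := by
    ext z; simp [JG]
  rw [this]
  refine MeasurableSet.iUnion fun k => MeasurableSet.iUnion fun k' => ?_
  refine (MeasurableSet.const _).inter ((MeasurableSet.const _).inter ((MeasurableSet.const _).inter 
    ((MeasurableSet.const _).inter ((MeasurableSet.const _).inter ?_))))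
  exact measurableSet_lt measurable_const ((hS _).sub (hS _)).norm

lemma JS_le (h3 : 3 ≤ k0) (ε : ℝ) (m M K : ℕ) (hm : k0 ≤ m) (hMK : M ≤ K) (z : X) :
    (2 ^ K / 2 : ℝ) * (JS S ε m M).indicator 1 z ≤ ∑ x ∈ range (2 ^ K), (JG S ε m M x).indicator (1 : X → ℝ) z := by
  classical
  by_cases hz : z ∈ JS S ε m M
  · rw [Set.indicator_of_mem hz]
    obtain ⟨k, k', h1, h2, h4, h5⟩ := hz
    obtain ⟨B, hB, hB'⟩ := good_count k K (by omega) (by omega)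
    obtain ⟨C, hC, hC'⟩ := good_count k' K (by omega) (by omega)
    have hsub : range (2 ^ K) \ (B ∪ C) ⊆ range (2 ^ K) := sdiff_subset
    refine le_trans ?_ (sum_le_sum_of_subset_of_nonneg hsub (fun x _ _ => Set.indicator_nonneg (fun _ _ => zero_le_one) _))
    have : ∀ x ∈ range (2 ^ K) \ (B ∪ C), (JG S ε m M x).indicator (1 : X → ℝ) z = 1 := by
      intro x hx
      rw [mem_sdiff, mem_union, not_or, mem_range] at hx
      have hmem : z ∈ JG S ε m M x := ⟨k, k', h1, h2, h4, hB' x hx.1 hx.2.1, hC' x hx.1 hx.2.2, h5⟩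
      rw [Set.indicator_of_mem hmem]; rfl
    rw [sum_congr rfl this, sum_const, nsmul_eq_mul, mul_one]
    have q1 := card_union_le B C
    have q2 := le_card_sdiff (B ∪ C) (range (2 ^ K))
    rw [card_range] at q2
    have q3 : 2 ^ K ≤ 2 * (range (2 ^ K) \ (B ∪ C)).card := by omega
    have q4 : (2:ℝ) ^ K ≤ 2 * ((range (2 ^ K) \ (B ∪ C)).card : ℝ) := by exact_mod_cast q3
    simp only [Pi.one_apply, mul_one]
    linarith
  · rw [Set.indicator_of_notMem hz, mul_zero]
    exact sum_nonneg (fun x _ => Set.indicator_nonneg (fun _ _ => zero_le_one) _)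

lemma count_JG (ε : ℝ) (ν : ℕ) (hP : PT τ S k0 ε ν) (m : ℕ → ℕ) (hm : StrictMono m) (hm0 : k0 ≤ m 0) (R : ℕ) (y : X)
    (ε' : ℝ) (hε : ε ≤ ε') :
    ∑ x ∈ range (2 ^ m R), ∑ i ∈ range R, (JG S ε' (m i) (m (i + 1)) x).indicator (1 : X → ℝ) (τ x y) ≤ 2 ^ m R * (ν + R * ε) := by
  classical
  obtain ⟨E, hE, hE2⟩ := hP (m R) (hm0.trans (hm.monotone (Nat.zero_le _))) y
  have key : ∀ x ∈ range (2 ^ m R), ∑ i ∈ range R, (JG S ε' (m i) (m (i + 1)) x).indicator (1 : X → ℝ) (τ x y) ≤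
      ν + (if x ∈ E then (R:ℝ) else 0) := by
    intro x hx
    rw [mem_range] at hx
    simp only [Set.indicator_apply, Pi.one_apply]
    rw [sum_boole]
    split_ifs with hxE
    · have : (((range R).filter (fun i => τ x y ∈ JG S ε' (m i) (m (i + 1)) x)).card : ℝ) ≤ R := by
        exact_mod_cast (card_filter_le _ _).trans (card_range R).le
      have hν : (0:ℝ) ≤ ν := by positivity
      linarith
    · obtain ⟨D, hD, hD2⟩ := hE2 x hx hxE
      rw [add_zero]
      have : ((range R).filter (fun i => τ x y ∈ JG S ε' (m i) (m (i + 1)) x)).card ≤ D.card := by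
        have hex : ∀ i ∈ (range R).filter (fun i => τ x y ∈ JG S ε' (m i) (m (i + 1)) x), ∃ l ∈ D, m i ≤ l ∧ l < m (i + 1) := by
          intro i hi
          rw [mem_filter, mem_range] at hi
          obtain ⟨hi, k, k', h1, h2, h4, h5, h6, h7⟩ := hi
          by_contra hcon
          push Not at hcon
          refine absurd (hD2 k k' ((hm0.trans (hm.monotone (Nat.zero_le _))).trans h1) h2 (h4.trans (hm.monotone hi)) h5 h6 ?_) (not_le.2 (hε.trans_lt h7))
          rintro l hl ⟨h8, h9⟩
          have := hcon l hl (by omega)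
          omega
        choose! L hL using hex
        refine card_le_card_of_injOn L (fun i hi => (hL i hi).1) ?_
        intro i hi j hj hij
        have a1 := (hL i hi).2
        have a2 := (hL j hj).2
        rw [hij] at a1
        by_contra hne
        rcases lt_or_gt_of_ne hne with h | h
        · have := hm.monotone (show i + 1 ≤ j from h); omega
        · have := hm.monotone (show j + 1 ≤ i from h); omega
      exact_mod_cast this.trans hD
  refine (sum_le_sum key).trans ?_
  rw [sum_add_distrib, sum_const, card_range, nsmul_eq_mul, ← sum_filter, sum_const, nsmul_eq_mul]
  have : (((range (2 ^ m R)).filter (fun x => x ∈ E)).card : ℝ) ≤ ε * 2 ^ m R := by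
    refine le_trans ?_ hE
    exact_mod_cast card_le_card (fun x hx => (mem_filter.1 hx).2)
  have hR : (0:ℝ) ≤ R := by positivity
  push_cast
  nlinarith [mul_le_mul_of_nonneg_right this hR]

lemma sum_JS (hτ : ∀ n, MeasurePreserving (τ n) μ μ) (hS : ∀ k, Measurable (S k)) (h3 : 3 ≤ k0) (ε : ℝ) (ν : ℕ) (hP : PT τ S k0 ε ν) (m : ℕ → ℕ) (hm : StrictMono m) (hm0 : k0 ≤ m 0) (R : ℕ)
    (ε' : ℝ) (hε : ε ≤ ε') :
    ∑ i ∈ range R, μ.real (JS S ε' (m i) (m (i + 1))) ≤ 2 * (ν + R * ε) := by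
  have hintg : ∀ A : Set X, MeasurableSet A → Integrable (A.indicator (1 : X → ℝ)) μ := fun A hA =>
    (integrable_const (1:ℝ)).indicator hA
  have h1 : ∀ i ∈ range R, (2 ^ m R / 2 : ℝ) * μ.real (JS S ε' (m i) (m (i + 1))) ≤
      ∑ x ∈ range (2 ^ m R), μ.real (JG S ε' (m i) (m (i + 1)) x) := by
    intro i hi
    rw [mem_range] at hi
    have := integral_mono (μ := μ) ((hintg _ (meas_JS hS ε' (m i) (m (i + 1)))).const_mul (2 ^ m R / 2 : ℝ))
      (integrable_finsetSum _ fun x _ => hintg _ (meas_JG hS ε' (m i) (m (i + 1)) x))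
      (JS_le (S := S) h3 ε' (m i) (m (i + 1)) (m R) (hm0.trans (hm.monotone (Nat.zero_le _))) (hm.monotone hi))
    rw [integral_const_mul, integral_finsetSum _ (fun x _ => hintg _ (meas_JG hS ε' (m i) (m (i + 1)) x)),
      integral_indicator_one (meas_JS hS ε' (m i) (m (i + 1)))] at this
    refine this.trans (le_of_eq (sum_congr rfl fun x _ => ?_))
    exact integral_indicator_one (meas_JG hS ε' (m i) (m (i + 1)) x)
  have hpre : ∀ i x, (fun y => (JG S ε' (m i) (m (i + 1)) x).indicator (1 : X → ℝ) (τ x y)) =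
      (τ x ⁻¹' (JG S ε' (m i) (m (i + 1)) x)).indicator 1 := by
    intro i x; rfl
  have hmp : ∀ i x, MeasurableSet (τ x ⁻¹' (JG S ε' (m i) (m (i + 1)) x)) := fun i x =>
    (hτ x).measurable (meas_JG hS ε' (m i) (m (i + 1)) x)
  have h2 := integral_mono (μ := μ) (integrable_finsetSum (range (2 ^ m R)) fun x _ => integrable_finsetSum (range R) fun i _ => by
      rw [hpre]; exact hintg _ (hmp i x)) (integrable_const _) (fun y => count_JG ε ν hP m hm hm0 R y ε' hε)
  rw [integral_finsetSum _ (fun x _ => integrable_finsetSum (range R) fun i _ => by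
      rw [hpre]; exact hintg _ (hmp i x))] at h2
  simp only [integral_const, probReal_univ, one_smul] at h2
  have h4 : ∀ x ∈ range (2 ^ m R), ∫ y, ∑ i ∈ range R, (JG S ε' (m i) (m (i + 1)) x).indicator (1 : X → ℝ) (τ x y) ∂μ = 
      ∑ i ∈ range R, μ.real (JG S ε' (m i) (m (i + 1)) x) := by
    intro x _
    rw [integral_finsetSum _ (fun i _ => by rw [hpre]; exact hintg _ (hmp i x))]
    refine sum_congr rfl fun i _ => ?_
    rw [hpre, integral_indicator_one (hmp i x)]
    simp only [Measure.real]
    rw [(hτ x).measure_preimage (meas_JG hS ε' (m i) (m (i + 1)) x).nullMeasurableSet]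
  rw [sum_congr rfl h4, sum_comm] at h2
  have h5 := (sum_le_sum h1).trans h2
  rw [← mul_sum] at h5
  have hp : (0:ℝ) < 2 ^ m R := by positivity
  by_contra hcon
  push Not at hcon
  nlinarith [mul_lt_mul_of_pos_left hcon hp]

theorem transfer (hτ : ∀ n, MeasurePreserving (τ n) μ μ) (hS : ∀ k, Measurable (S k)) (h3 : 3 ≤ k0) (hP : ∀ ε : ℝ, 0 < ε → ∃ ν, PT τ S k0 ε ν) : ∀ᵐ z ∂μ, ∃ l, Filter.Tendsto (fun k => S k z) Filter.atTop (nhds l) := by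
  have key : ∀ ε' : ℝ, 0 < ε' → μ (⋂ m : ℕ, ⋃ M : ℕ, JS S ε' (k0 + m) M) = 0 := by
    intro ε' hε'
    by_contra hne
    set Z := ⋂ m : ℕ, ⋃ M : ℕ, JS S ε' (k0 + m) M with hZ
    have hpos : 0 < μ.real Z := ENNReal.toReal_pos hne (by finiteness)
    set δ := μ.real Z / 2 with hδ
    have hstep : ∀ m, k0 ≤ m → ∃ M, m < M ∧ δ < μ.real (JS S ε' m M) := by
      intro m hm
      have hmono : Monotone (fun M => JS S ε' m M) := by
        rintro M M' h z ⟨k, k', h1, h2, h4, h5⟩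
        exact ⟨k, k', h1, h2, h4.trans h, h5⟩
      have ht := tendsto_measure_iUnion_atTop (μ := μ) hmono
      have ht2 := (ENNReal.tendsto_toReal (by finiteness)).comp ht
      have hlt : δ < (μ (⋃ M, JS S ε' m M)).toReal := by
        have : μ.real Z ≤ μ.real (⋃ M, JS S ε' m M) := by
          apply measureReal_mono _ (by finiteness)
          obtain ⟨j, rfl⟩ := Nat.exists_eq_add_of_le hm
          exact Set.iInter_subset _ j
        have h0 : (μ (⋃ M, JS S ε' m M)).toReal = μ.real (⋃ M, JS S ε' m M) := rfl
        rw [h0]; linarith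
      obtain ⟨M, hM, hM2⟩ := ((ht2.eventually_const_lt hlt).and (Filter.eventually_gt_atTop m)).exists
      exact ⟨M, hM2, hM⟩
    choose! nx hnx using hstep
    set m : ℕ → ℕ := fun i => nx^[i] k0 with hm
    have hmk : ∀ i, k0 ≤ m i := by
      intro i
      induction i with
      | zero => exact le_rfl
      | succ i ih =>
        simp only [hm, Function.iterate_succ_apply'] at ih ⊢
        exact ih.trans (hnx _ ih).1.le
    have hms : ∀ i, m (i + 1) = nx (m i) := fun i => by simp only [hm, Function.iterate_succ_apply']
    have hmono : StrictMono m := strictMono_nat_of_lt_succ fun i => by rw [hms]; exact (hnx _ (hmk i)).1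
    have hδp : 0 < δ := by positivity
    obtain ⟨ν, hν⟩ := hP (min ε' (δ / 4)) (lt_min hε' (by positivity))
    obtain ⟨R, hR⟩ := exists_nat_gt (4 * ν / δ)
    have h1 := sum_JS hτ hS h3 _ ν hν m hmono (hmk 0) R ε' (min_le_left _ _)
    have h2 : (R:ℝ) * δ ≤ ∑ i ∈ range R, μ.real (JS S ε' (m i) (m (i + 1))) := by
      have := card_nsmul_le_sum (range R) (fun i => μ.real (JS S ε' (m i) (m (i + 1)))) δ
        (fun i _ => by rw [hms]; exact (hnx _ (hmk i)).2.le)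
      rwa [card_range, nsmul_eq_mul] at this
    rw [div_lt_iff₀ hδp] at hR
    have h5 : (R:ℝ) * min ε' (δ / 4) ≤ R * (δ / 4) := by gcongr; exact min_le_right _ _
    linarith
  have hall : ∀ᵐ z ∂μ, ∀ j : ℕ, z ∉ ⋂ m : ℕ, ⋃ M : ℕ, JS S (1 / ((j:ℝ) + 1)) (k0 + m) M := by
    rw [ae_all_iff]
    intro j
    exact measure_eq_zero_iff_ae_notMem.1 (key _ (by positivity))
  filter_upwards [hall] with z hz
  apply cauchySeq_tendsto_of_complete
  rw [Metric.cauchySeq_iff']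
  intro ε hε
  obtain ⟨j, hj⟩ := exists_nat_one_div_lt hε
  have := hz j
  simp only [Set.mem_iInter, Set.mem_iUnion, not_forall, not_exists] at this
  obtain ⟨m, hm⟩ := this
  refine ⟨k0 + m, fun n hn => ?_⟩
  have h2 := hm n
  rw [dist_eq_norm]
  by_contra hc
  push Not at hc
  exact h2 ⟨k0 + m, n, le_rfl, hn, le_rfl, hj.trans_le hc⟩

end

theorem smoothed_conv {X : Type*} [MeasurableSpace X] (μ : Measure X) [IsProbabilityMeasure μ]
    (T : Equiv.Perm X) (hT : MeasurePreserving T μ μ) (hT2 : Measurable T.symm)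
    {a b : ℤ} {C1 : ℝ} {k0 : ℕ} {N H : ℕ → ℕ} (h : Adm a b C1 k0 N H)
    (f g : X → ℂ) (hfm : Measurable f) (hgm : Measurable g) (hf : ∀ x, ‖f x‖ ≤ 1) (hg : ∀ x, ‖g x‖ ≤ 1) :
    ∀ᵐ z ∂μ, ∃ l, Filter.Tendsto (fun k => av (N k) (H k) 100 (fun n => f ((T ^ (a * n)) z) * g ((T ^ (b * n)) z)))
      Filter.atTop (nhds l) := by
  have hTn : ∀ n : ℕ, MeasurePreserving (fun x => (T ^ n) x) μ μ := by
    intro n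
    have := hT.iterate n
    rwa [← Equiv.Perm.coe_pow] at this
  have hTz : ∀ n : ℤ, Measurable (fun x => (T ^ n) x) := by
    intro n
    obtain ⟨m, rfl | rfl⟩ := n.eq_nat_or_neg
    · simp only [zpow_natCast]; exact (hTn m).measurable
    · have : (fun x => (T ^ (-(m:ℤ))) x) = (fun x => (T.symm)^[m] x) := by
        funext x
        rw [zpow_neg, zpow_natCast, ← inv_pow, Equiv.Perm.coe_pow]; rfl
      rw [this]
      exact hT2.iterate m
  refine transfer (τ := fun n x => (T ^ n) x) (k0 := k0) hTn (fun k => ?_) h.k3 (fun ε hε => ?_)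
  · unfold av
    refine measurable_const.mul (Finset.measurable_sum _ fun ω _ => ?_)
    exact (hfm.comp (hTz _)).mul (hgm.comp (hTz _))
  · obtain ⟨ν, hν⟩ := core h ε hε
    refine ⟨ν, fun K hK y => ?_⟩
    obtain ⟨E, hE, hE2⟩ := hν K hK (fun n => f ((T ^ n) y)) (fun n => g ((T ^ n) y)) (fun n => hf _) (fun n => hg _)
    refine ⟨E, hE, fun x hx hxE => ?_⟩
    obtain ⟨D, hD, hD2⟩ := hE2 x hx hxE
    refine ⟨D, hD, fun k k' h1 h2 h3 h4 h5 h6 => ?_⟩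
    have e : ∀ k, Av a b N H k x (fun n => f ((T ^ n) y)) (fun n => g ((T ^ n) y)) = 
        av (N k) (H k) 100 (fun n => f ((T ^ (a * n)) ((T ^ x) y)) * g ((T ^ (b * n)) ((T ^ x) y))) := by
      intro k
      unfold Av
      congr 1; funext n
      rw [← zpow_natCast T x, ← Equiv.Perm.mul_apply, ← Equiv.Perm.mul_apply, ← zpow_add, ← zpow_add, add_comm, add_comm (x:ℤ)]
    have := hD2 k k' h1 h2 h3 h4 h5 h6
    rwa [e, e] at this

end DR
end

section
namespace DR
open Finset MeasureTheory

/-- sharp average -/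
noncomputable def shp (N : ℕ) (v : ℤ → ℂ) : ℂ := (N : ℂ)⁻¹ * ∑ n ∈ range N, v (n : ℤ)

lemma shift_nat (N s : ℕ) (v : ℤ → ℂ) (hv : ∀ n, ‖v n‖ ≤ 1) :
    ‖∑ n ∈ range N, v ((n : ℤ) + s) - ∑ n ∈ range N, v (n : ℤ)‖ ≤ 2 * s := by
  induction s with
  | zero => simp
  | succ s ih =>
    have e1 := sum_range_succ (fun n : ℕ => v ((n:ℤ) + s)) N
    have e2 := sum_range_succ' (fun n : ℕ => v ((n:ℤ) + s)) N
    have e3 : ∑ n ∈ range N, v ((n:ℤ) + (s + 1 : ℕ)) = ∑ n ∈ range N, v ((((n + 1 : ℕ)):ℤ) + s) := by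
      apply sum_congr rfl; intro n _; congr 1; push_cast; ring
    have e4 : ∑ n ∈ range N, v ((n:ℤ) + (s + 1 : ℕ)) - ∑ n ∈ range N, v (n : ℤ) =
      (∑ n ∈ range N, v ((n:ℤ) + s) - ∑ n ∈ range N, v (n : ℤ)) + (v ((N:ℤ) + s) - v (((0:ℕ):ℤ) + s)) := by
      rw [e3]
      linear_combination e1 - e2
    rw [e4]
    have h1 := norm_add_le (∑ n ∈ range N, v ((n:ℤ) + s) - ∑ n ∈ range N, v (n : ℤ)) (v ((N:ℤ) + s) - v (((0:ℕ):ℤ) + s))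
    have h2 := norm_sub_le (v ((N:ℤ) + s)) (v (((0:ℕ):ℤ) + s))
    have h3 := hv ((N:ℤ) + s)
    have h4 := hv (((0:ℕ):ℤ) + s)
    push_cast at *
    linarith

lemma shift_int (N : ℕ) (s : ℤ) (v : ℤ → ℂ) (hv : ∀ n, ‖v n‖ ≤ 1) (C : ℕ) (hs : |s| ≤ C) :
    ‖∑ n ∈ range N, v ((n : ℤ) + s) - ∑ n ∈ range N, v (n : ℤ)‖ ≤ 2 * C := by
  obtain ⟨m, rfl | rfl⟩ := s.eq_nat_or_neg
  · refine (shift_nat N m v hv).trans ?_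
    rw [Nat.abs_cast] at hs
    have : m ≤ C := by exact_mod_cast hs
    gcongr
  · have := shift_nat N m (fun n => v (n + -(m:ℤ))) (fun n => hv _)
    rw [norm_sub_rev]
    simp only [add_neg_cancel_right] at this
    refine this.trans ?_
    rw [abs_neg, Nat.abs_cast] at hs
    have : m ≤ C := by exact_mod_cast hs
    gcongr

lemma av_shp (N H : ℕ) (hN : 0 < N) (hH : 0 < H) (v : ℤ → ℂ) (hv : ∀ n, ‖v n‖ ≤ 1) :
    ‖av N H 100 v - shp N v‖ ≤ 200 * H / N := by
  have hN0 : (N : ℂ) ≠ 0 := by exact_mod_cast hN.ne'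
  have hH0 : (H : ℂ) ≠ 0 := by exact_mod_cast hH.ne'
  have hcard : (Fintype.card (Fin 100 → Fin H × Fin H) : ℂ) = ((H : ℂ) ^ 2) ^ 100 := by simp [sq]
  have e : av N H 100 v - shp N v = ((N : ℂ) * ((H : ℂ) ^ 2) ^ 100)⁻¹ *
      ∑ p : Fin 100 → Fin H × Fin H, (∑ n ∈ range N, v ((n:ℤ) + ∑ i, (((p i).1 : ℕ) - ((p i).2 : ℕ) : ℤ)) - ∑ n ∈ range N, v (n : ℤ)) := by
    rw [sum_sub_distrib, sum_const, card_univ, nsmul_eq_mul, hcard, mul_sub]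
    unfold av shp
    congr 1
    · congr 1
      rw [Fintype.sum_prod_type_right]
      refine sum_congr rfl fun p _ => ?_
      rw [← Fin.sum_univ_eq_sum_range (fun n : ℕ => v ((n:ℤ) + ∑ i, (((p i).1 : ℕ) - ((p i).2 : ℕ) : ℤ)))]
      rfl
    · generalize ∑ n ∈ range N, v (n:ℤ) = z
      have : ((H:ℂ) ^ 2) ^ 100 ≠ 0 := by positivity
      generalize ((H:ℂ) ^ 2) ^ 100 = w at *
      field_simp
  rw [e, norm_mul, norm_inv]
  have hs : ‖∑ p : Fin 100 → Fin H × Fin H, (∑ n ∈ range N, v ((n:ℤ) + ∑ i, (((p i).1 : ℕ) - ((p i).2 : ℕ) : ℤ)) - ∑ n ∈ range N, v (n : ℤ))‖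
      ≤ ((H:ℝ) ^ 2) ^ 100 * (2 * (100 * H : ℕ)) := by
    refine (norm_sum_le _ _).trans ((sum_le_card_nsmul _ _ (2 * ((100 * H : ℕ) : ℝ)) ?_).trans (le_of_eq ?_))
    · intro p _
      apply shift_int N _ v hv
      have := abs_ph_sum_le p
      push_cast at this ⊢
      exact this
    · rw [card_univ, nsmul_eq_mul]
      congr 1
      exact_mod_cast hcard
  have hN1 : (0:ℝ) < N := by exact_mod_cast hN
  have hH1 : (0:ℝ) < ((H:ℝ) ^ 2) ^ 100 := by have : (0:ℝ) < H := by exact_mod_cast hH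
                                             positivity
  have hn : ‖(N : ℂ) * ((H : ℂ) ^ 2) ^ 100‖ = N * ((H:ℝ) ^ 2) ^ 100 := by
    simp only [norm_mul, norm_pow, Complex.norm_natCast]
  rw [hn]
  refine (mul_le_mul_of_nonneg_left hs (by positivity)).trans (le_of_eq ?_)
  push_cast
  generalize ((H:ℝ) ^ 2) ^ 100 = w at *
  field_simp
  norm_num

lemma shp_sub (N r : ℕ) (hN : 0 < N) (v : ℤ → ℂ) (hv : ∀ n, ‖v n‖ ≤ 1) :
    ‖shp (N + r) v - shp N v‖ ≤ 2 * r / N := by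
  have hN0 : (N : ℂ) ≠ 0 := by exact_mod_cast hN.ne'
  have hNr : ((N:ℂ) + r) ≠ 0 := by exact_mod_cast (by omega : N + r ≠ 0)
  have hN1 : (0:ℝ) < N := by exact_mod_cast hN
  have hr : (0:ℝ) ≤ r := by positivity
  have h1 : ‖∑ n ∈ range N, v (n:ℤ)‖ ≤ N := by
    refine (norm_sum_le _ _).trans ((sum_le_card_nsmul _ _ 1 fun n _ => hv _).trans ?_)
    simp
  have h2 : ‖∑ n ∈ range r, v ((N + n : ℕ):ℤ)‖ ≤ r := by
    refine (norm_sum_le _ _).trans ((sum_le_card_nsmul _ _ 1 fun n _ => hv _).trans ?_)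
    simp
  unfold shp
  rw [sum_range_add]
  generalize ∑ n ∈ range N, v (n:ℤ) = A at *
  generalize ∑ n ∈ range r, v ((N + n : ℕ):ℤ) = B at *
  have e : ((N + r : ℕ) : ℂ)⁻¹ * (A + B) - (N:ℂ)⁻¹ * A = ((N:ℂ) * (N + r))⁻¹ * (N * B - r * A) := by
    push_cast; field_simp; ring
  rw [e, norm_mul, norm_inv, norm_mul]
  have h3 : ‖(N:ℂ) * B - r * A‖ ≤ N * r + r * N := by
    refine (norm_sub_le _ _).trans ?_
    rw [norm_mul, norm_mul, Complex.norm_natCast, Complex.norm_natCast]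
    gcongr
  have h4 : ‖(N:ℂ) + r‖ = N + r := by
    have : (N:ℂ) + r = ((N + r : ℕ) : ℂ) := by push_cast; rfl
    rw [this, Complex.norm_natCast]; push_cast; rfl
  rw [h4, Complex.norm_natCast]
  calc _ ≤ ((N:ℝ) * (N + r))⁻¹ * (N * r + r * N) := by gcongr
    _ = 2 * r / (N + r) := by field_simp; ring
    _ ≤ 2 * r / N := by gcongr; linarith

lemma adm_ex {a b : ℤ} (ha : a ≠ 0) (hb : b ≠ 0) (hab : a ≠ b) (j : ℕ) : ∃ s : ℕ, ∀ p : ℕ → ℕ,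
    (∀ k, 2 ^ j ≤ p k ∧ p k ≤ 2 ^ (j + 1)) → Adm a b (2 ^ s) (max 3 s) (fun k => p k * 2 ^ (k - s)) (fun k => 2 ^ (k - s)) := by
  obtain ⟨s, hs⟩ := pow_unbounded_of_one_lt (8 * ((|a| + |b|) * (2 ^ (j + 1) + 201))) (one_lt_two)
  refine ⟨s, fun p hp => ⟨ha, hb, hab, le_max_left _ _, fun k hk => by positivity, fun k hk => ?_, fun k hk => ?_, fun k hk => ?_⟩⟩
  · exact Nat.le_mul_of_pos_left _ ((by positivity : 0 < 2 ^ j).trans_le (hp k).1)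
  · have hsk : s ≤ k := (le_max_right _ _).trans hk
    push_cast
    rw [← pow_add, Nat.add_sub_cancel' hsk]
  · have hsk : s ≤ k := (le_max_right _ _).trans hk
    have e : (2:ℤ) ^ k = 2 ^ s * 2 ^ (k - s) := by rw [← pow_add, Nat.add_sub_cancel' hsk]
    have h1 : (1:ℤ) ≤ 2 ^ (k - s) := one_le_pow₀ (by norm_num)
    have h2 : (p k : ℤ) ≤ 2 ^ (j + 1) := by exact_mod_cast (hp k).2
    have hc : 0 ≤ |a| + |b| := by positivity
    unfold rad
    push_cast
    rw [e]
    calc _ ≤ 8 * ((|a| + |b|) * ((2 ^ (j + 1) + 201) * 2 ^ (k - s))) := by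
          gcongr
          nlinarith
      _ = (8 * ((|a| + |b|) * (2 ^ (j + 1) + 201))) * 2 ^ (k - s) := by ring
      _ ≤ _ := by gcongr

section
open Filter
variable {X : Type*} [MeasurableSpace X] (μ : Measure X) [IsProbabilityMeasure μ]
    (T : Equiv.Perm X) (hT : MeasurePreserving T μ μ) (hT2 : Measurable T.symm)
    {a b : ℤ} (ha : a ≠ 0) (hb : b ≠ 0) (hab : a ≠ b)
    (f g : X → ℂ) (hfm : Measurable f) (hgm : Measurable g) (hf : ∀ x, ‖f x‖ ≤ 1) (hg : ∀ x, ‖g x‖ ≤ 1)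

theorem near_limit (hT : MeasurePreserving T μ μ) (hT2 : Measurable T.symm)
    (ha : a ≠ 0) (hb : b ≠ 0) (hab : a ≠ b)
    (hfm : Measurable f) (hgm : Measurable g) (hf : ∀ x, ‖f x‖ ≤ 1) (hg : ∀ x, ‖g x‖ ≤ 1) (j : ℕ) :
    ∀ᵐ z ∂μ, ∃ l : ℂ, ∃ N0 : ℕ, ∀ N ≥ N0, 
      ‖shp N (fun n => f ((T ^ (a * n)) z) * g ((T ^ (b * n)) z)) - l‖ ≤ 203 * (1 / 2 ^ j) := by
  obtain ⟨s, hs⟩ := adm_ex ha hb hab j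
  have hj : 2 ^ j ≤ 2 ^ (j + 1) := Nat.pow_le_pow_right (by norm_num) (by omega)
  have h1 : ∀ p : ℕ, (2 ^ j ≤ p ∧ p ≤ 2 ^ (j + 1)) → ∀ᵐ z ∂μ, ∃ l, Tendsto (fun k => av (p * 2 ^ (k - s)) (2 ^ (k - s)) 100
      (fun n => f ((T ^ (a * n)) z) * g ((T ^ (b * n)) z))) atTop (nhds l) := by
    intro p hp
    exact smoothed_conv μ T hT hT2 (hs (fun _ => p) (fun _ => hp)) f g hfm hgm hf hg
  have h2 : ∀ p : ℕ, (2 ^ j ≤ p ∧ p ≤ 2 ^ (j + 1)) → ∀ᵐ z ∂μ, ∃ l, Tendsto (fun k => av ((if Even k then 2 ^ j else p) * 2 ^ (k - s)) (2 ^ (k - s)) 100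
      (fun n => f ((T ^ (a * n)) z) * g ((T ^ (b * n)) z))) atTop (nhds l) := by
    intro p hp
    refine smoothed_conv μ T hT hT2 (hs (fun k => if Even k then 2 ^ j else p) (fun k => ?_)) f g hfm hgm hf hg
    split_ifs
    · exact ⟨le_rfl, hj⟩
    · exact hp
  have h3 : ∀ᵐ z ∂μ, ∀ p : ℕ, (2 ^ j ≤ p ∧ p ≤ 2 ^ (j + 1)) → 
      (∃ l, Tendsto (fun k => av (p * 2 ^ (k - s)) (2 ^ (k - s)) 100
      (fun n => f ((T ^ (a * n)) z) * g ((T ^ (b * n)) z))) atTop (nhds l)) ∧ ∃ l, Tendsto (fun k => av ((if Even k then 2 ^ j else p) * 2 ^ (k - s)) (2 ^ (k - s)) 100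
      (fun n => f ((T ^ (a * n)) z) * g ((T ^ (b * n)) z))) atTop (nhds l) := by
    rw [ae_all_iff]
    intro p
    by_cases hp : (2 ^ j ≤ p ∧ p ≤ 2 ^ (j + 1))
    · filter_upwards [h1 p hp, h2 p hp] with z a1 a2 _
      exact ⟨a1, a2⟩
    · exact Eventually.of_forall fun z h => absurd h hp
  filter_upwards [h3] with z hz
  have hv : ∀ n : ℤ, ‖(fun n : ℤ => f ((T ^ (a * n)) z) * g ((T ^ (b * n)) z)) n‖ ≤ 1 := fun n => by
    simp only
    rw [norm_mul]
    exact mul_le_one₀ (hf _) (norm_nonneg _) (hg _)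
  generalize (fun n : ℤ => f ((T ^ (a * n)) z) * g ((T ^ (b * n)) z)) = v at *
  obtain ⟨l, hl⟩ := (hz (2 ^ j) ⟨le_rfl, hj⟩).1
  have te : Tendsto (fun m : ℕ => 2 * m) atTop atTop := Filter.tendsto_atTop_mono (fun m => (by omega : m ≤ 2 * m)) tendsto_id
  have todd : Tendsto (fun m : ℕ => 2 * m + 1) atTop atTop := Filter.tendsto_atTop_mono (fun m => (by omega : m ≤ 2 * m + 1)) tendsto_id
  have hlim : ∀ p : ℕ, (2 ^ j ≤ p ∧ p ≤ 2 ^ (j + 1)) → Tendsto (fun k => av (p * 2 ^ (k - s)) (2 ^ (k - s)) 100 v) atTop (nhds l) := by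
    intro p hp
    obtain ⟨⟨l1, hl1⟩, ⟨l2, hl2⟩⟩ := hz p hp
    have q1 : l2 = l := by
      refine tendsto_nhds_unique (hl2.comp te) ((hl.comp te).congr fun m => ?_)
      simp
    have q2 : l2 = l1 := by
      refine tendsto_nhds_unique (hl2.comp todd) ((hl1.comp todd).congr fun m => ?_)
      simp
    rwa [← q1, q2]
  have hev : ∀ᶠ k in atTop, ∀ p ∈ Finset.Icc (2 ^ j) (2 ^ (j + 1)), ‖av (p * 2 ^ (k - s)) (2 ^ (k - s)) 100 v - l‖ < 1 / 2 ^ j := by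
    rw [Finset.eventually_all]
    intro p hp
    have := (hlim p (Finset.mem_Icc.1 hp)).eventually (Metric.ball_mem_nhds l (by positivity : (0:ℝ) < 1 / 2 ^ j))
    simpa [Metric.mem_ball, dist_eq_norm] using this
  obtain ⟨k1, hk1⟩ := eventually_atTop.1 hev
  refine ⟨l, 2 ^ (j + k1), fun N hN => ?_⟩
  obtain ⟨e, he⟩ : ∃ e, e + j = Nat.log 2 N := by
    refine ⟨Nat.log 2 N - j, Nat.sub_add_cancel ?_⟩
    have := Nat.log_mono_right (b := 2) hN
    rw [Nat.log_pow (by norm_num)] at this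
    omega
  have hN0 : N ≠ 0 := by have : 0 < 2 ^ (j + k1) := by positivity
                         omega
  have b1 : 2 ^ (e + j) ≤ N := by rw [he]; exact Nat.pow_log_le_self 2 hN0
  have b2 : N < 2 ^ (e + j + 1) := by rw [he]; exact Nat.lt_pow_succ_log_self (by norm_num) N
  have hek : k1 ≤ e := by
    have := Nat.log_mono_right (b := 2) hN
    rw [Nat.log_pow (by norm_num)] at this
    omega
  have hp1 : 2 ^ j ≤ N / 2 ^ e := by
    rw [Nat.le_div_iff_mul_le (by positivity), ← pow_add, add_comm]; exact b1
  have hp2 : N / 2 ^ e ≤ 2 ^ (j + 1) := by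
    apply le_of_lt
    rw [Nat.div_lt_iff_lt_mul (by positivity), ← pow_add]; convert b2 using 2; ring
  have hmod : N % 2 ^ e < 2 ^ e := Nat.mod_lt _ (by positivity)
  have hdm := Nat.div_add_mod N (2 ^ e)
  have c1 := hk1 (e + s) (by omega) (N / 2 ^ e) (Finset.mem_Icc.2 ⟨hp1, hp2⟩)
  rw [Nat.add_sub_cancel] at c1
  generalize N / 2 ^ e = p at *
  generalize N % 2 ^ e = r at *
  have hp0 : 0 < p * 2 ^ e := Nat.mul_pos ((by positivity : 0 < 2 ^ j).trans_le hp1) (by positivity)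
  have c2 := av_shp (p * 2 ^ e) (2 ^ e) hp0 (by positivity) v hv
  have c3 := shp_sub (p * 2 ^ e) r hp0 v hv
  rw [mul_comm p, hdm] at c3
  have hpr : (2:ℝ) ^ j ≤ p := by exact_mod_cast hp1
  have h2j : (0:ℝ) < 2 ^ j := by positivity
  have h2e : (0:ℝ) < 2 ^ e := by positivity
  have d2 : (200:ℝ) * (2 ^ e : ℕ) / ((p * 2 ^ e : ℕ)) ≤ 200 * (1 / 2 ^ j) := by
    push_cast
    rw [mul_div_assoc, div_mul_cancel_right₀ h2e.ne', ← one_div]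
    gcongr
  have d3 : (2:ℝ) * r / ((2 ^ e * p : ℕ)) ≤ 2 * (1 / 2 ^ j) := by
    have hr : (r:ℝ) ≤ 2 ^ e := by exact_mod_cast hmod.le
    push_cast
    calc _ ≤ (2:ℝ) * 2 ^ e / (2 ^ e * 2 ^ j) := by gcongr
      _ = _ := by field_simp
  rw [mul_comm (2 ^ e) p] at c3 d3
  have := norm_add₃_le (a := shp N v - shp (p * 2 ^ e) v) (b := shp (p * 2 ^ e) v - av (p * 2 ^ e) (2 ^ e) 100 v) (c := av (p * 2 ^ e) (2 ^ e) 100 v - l)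
  rw [norm_sub_rev (shp (p * 2 ^ e) v) (av _ _ _ _)] at this
  have e1 : shp N v - shp (p * 2 ^ e) v + (shp (p * 2 ^ e) v - av (p * 2 ^ e) (2 ^ e) 100 v) + (av (p * 2 ^ e) (2 ^ e) 100 v - l) = shp N v - l := by ring
  rw [e1] at this
  linarith

theorem sharp_conv (hT : MeasurePreserving T μ μ) (hT2 : Measurable T.symm)
    (ha : a ≠ 0) (hb : b ≠ 0) (hab : a ≠ b)
    (hfm : Measurable f) (hgm : Measurable g) (hf : ∀ x, ‖f x‖ ≤ 1) (hg : ∀ x, ‖g x‖ ≤ 1) :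
    ∀ᵐ z ∂μ, ∃ l : ℂ, Tendsto (fun N : ℕ => shp N (fun n => f ((T ^ (a * n)) z) * g ((T ^ (b * n)) z))) atTop (nhds l) := by
  have := ae_all_iff.2 (near_limit μ T f g hT hT2 ha hb hab hfm hgm hf hg)
  filter_upwards [this] with z hz
  apply cauchySeq_tendsto_of_complete
  rw [Metric.cauchySeq_iff]
  intro ε hε
  obtain ⟨j, hj⟩ := pow_unbounded_of_one_lt (406 / ε) (one_lt_two)
  obtain ⟨l, N0, h⟩ := hz j
  refine ⟨N0, fun m hm n hn => ?_⟩
  have h1 := h m hm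
  have h2 := h n hn
  rw [← dist_eq_norm] at h1 h2
  have h3 := dist_triangle_right (shp m (fun n => f ((T ^ (a * n)) z) * g ((T ^ (b * n)) z))) (shp n (fun n => f ((T ^ (a * n)) z) * g ((T ^ (b * n)) z))) l
  have h4 : 406 * (1 / (2:ℝ) ^ j) < ε := by
    rw [mul_one_div, div_lt_iff₀ (by positivity)]
    rwa [div_lt_iff₀ hε, mul_comm] at hj
  linarith

end
end DR
end

section
namespace DR
set_option linter.unusedSectionVars false
open Finset MeasureTheory Filter

section
variable {X : Type*} [MeasurableSpace X] {μ : Measure X} [IsProbabilityMeasure μ] {T : Equiv.Perm X}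

lemma mp_zpow (hT : MeasurePreserving T μ μ) (hT2 : Measurable T.symm) (n : ℤ) :
    MeasurePreserving (fun x => (T ^ n) x) μ μ := by
  have hs : MeasurePreserving T.symm μ μ := by
    let e : X ≃ᵐ X := { toEquiv := T, measurable_toFun := hT.measurable, measurable_invFun := hT2 }
    exact MeasurePreserving.symm e hT
  obtain ⟨m, rfl | rfl⟩ := n.eq_nat_or_neg
  · simp only [zpow_natCast, Equiv.Perm.coe_pow]
    exact hT.iterate m
  · have : (fun x => (T ^ (-(m:ℤ))) x) = (fun x => (T.symm)^[m] x) := by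
      funext x
      rw [zpow_neg, zpow_natCast, ← inv_pow, Equiv.Perm.coe_pow]; rfl
    rw [this]
    exact hs.iterate m

lemma norm_shp_le (N : ℕ) (v : ℤ → ℂ) (hv : ∀ n, ‖v n‖ ≤ 1) : ‖shp N v‖ ≤ 1 := by
  unfold shp
  have h1 : ‖∑ n ∈ range N, v (n:ℤ)‖ ≤ N := by
    refine (norm_sum_le _ _).trans ((sum_le_card_nsmul _ _ 1 fun n _ => hv _).trans ?_)
    simp
  rw [norm_mul, norm_inv, Complex.norm_natCast]
  exact inv_mul_le_one_of_le₀ h1 (by positivity)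

lemma tendsto_shift (v : ℤ → ℂ) (hv : ∀ n, ‖v n‖ ≤ 1) :
    Tendsto (fun N : ℕ => shp N (fun n => v (n + 1)) - shp N v) atTop (nhds 0) := by
  refine squeeze_zero_norm (a := fun N : ℕ => 2 / (N:ℝ)) (fun N => ?_) (tendsto_const_div_atTop_nhds_zero_nat 2)
  have := shift_nat N 1 v hv
  unfold shp
  rw [← mul_sub, norm_mul, norm_inv, Complex.norm_natCast, div_eq_inv_mul]
  gcongr
  simpa using this

noncomputable def GG (T : Equiv.Perm X) (c : ℤ) (g : X → ℂ) (x : X) : ℂ :=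
  limUnder atTop (fun N : ℕ => shp N (fun n => g ((T ^ (c * n)) x)))

lemma meas_shp (hT : MeasurePreserving T μ μ) (hT2 : Measurable T.symm) (N : ℕ) (F : ℤ → X → ℂ) (hF : ∀ n, Measurable (F n)) :
    Measurable (fun x => shp N (fun n => F n x)) := by
  unfold shp
  exact measurable_const.mul (Finset.measurable_sum _ fun n _ => hF _)

lemma GG_inv (c : ℤ) (g : X → ℂ) (hg : ∀ x, ‖g x‖ ≤ 1) (x : X) : GG T c g ((T ^ c) x) = GG T c g x := by
  have ht := tendsto_shift (fun n => g ((T ^ (c * n)) x)) (fun n => hg _)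
  have e : ∀ n : ℤ, (T ^ (c * (n + 1))) x = (T ^ (c * n)) ((T ^ c) x) := by
    intro n
    rw [← Equiv.Perm.mul_apply, ← zpow_add]; congr 2; ring
  simp only [e] at ht
  unfold GG limUnder lim
  congr 1
  funext l
  apply propext
  change Tendsto _ _ _ ↔ Tendsto _ _ _
  constructor
  · intro h; simpa using h.sub ht
  · intro h; simpa using h.add ht

lemma inv_le (S : X → X) : invariantSets S ≤ (inferInstance : MeasurableSpace X) := fun _ hA => hA.1

lemma GG_meas (hT : MeasurePreserving T μ μ) (hT2 : Measurable T.symm) (c : ℤ) (g : X → ℂ) (hgm : Measurable g) :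
    Measurable (GG T c g) := by
  refine StronglyMeasurable.measurable (StronglyMeasurable.limUnder fun N => ?_)
  exact (meas_shp hT hT2 N _ (fun n => hgm.comp (mp_zpow hT hT2 _).measurable)).stronglyMeasurable

lemma GG_smeas (hT : MeasurePreserving T μ μ) (hT2 : Measurable T.symm) (c : ℤ) (g : X → ℂ) (hgm : Measurable g) (hg : ∀ x, ‖g x‖ ≤ 1) :
    StronglyMeasurable[invariantSets ⇑(T ^ c)] (GG T c g) := by
  suffices h : Measurable[invariantSets ⇑(T ^ c)] (GG T c g) from h.stronglyMeasurable
  intro B hB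
  refine ⟨GG_meas hT hT2 c g hgm hB, ?_⟩
  ext x
  simp only [Set.mem_preimage, GG_inv c g hg]

lemma GG_tendsto (hT : MeasurePreserving T μ μ) (hT2 : Measurable T.symm) (c : ℤ) (hc : c ≠ 0) (g : X → ℂ) (hgm : Measurable g) (hg : ∀ x, ‖g x‖ ≤ 1) :
    ∀ᵐ x ∂μ, Tendsto (fun N : ℕ => shp N (fun n => g ((T ^ (c * n)) x))) atTop (nhds (GG T c g x)) := by
  have := sharp_conv μ T (a := 2 * c) (b := c) (fun _ => 1) g hT hT2 (by omega) hc (by omega) measurable_const hgm (by simp) hg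
  filter_upwards [this] with x hx
  simp only [one_mul] at hx
  exact tendsto_nhds_limUnder hx

lemma GG_bound (hT : MeasurePreserving T μ μ) (hT2 : Measurable T.symm) (c : ℤ) (hc : c ≠ 0) (g : X → ℂ) (hgm : Measurable g) (hg : ∀ x, ‖g x‖ ≤ 1) :
    ∀ᵐ x ∂μ, ‖GG T c g x‖ ≤ 1 := by
  filter_upwards [GG_tendsto hT hT2 c hc g hgm hg] with x hx
  exact le_of_tendsto hx.norm (Eventually.of_forall fun N => norm_shp_le N _ fun n => hg _)

lemma integrable_bdd (f : X → ℂ) (hf : Measurable f) (hb : ∀ᵐ x ∂μ, ‖f x‖ ≤ 1) : Integrable f μ :=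
  Integrable.of_bound hf.aestronglyMeasurable 1 hb

/-- integrating the averages against a bounded weight -/
lemma int_lim (hT : MeasurePreserving T μ μ) (hT2 : Measurable T.symm) (c : ℤ) (hc : c ≠ 0) (f g : X → ℂ) (hfm : Measurable f) (hf : ∀ x, ‖f x‖ ≤ 1) (hgm : Measurable g) (hg : ∀ x, ‖g x‖ ≤ 1) :
    Tendsto (fun N : ℕ => shp N (fun n => ∫ x, f x * g ((T ^ (c * n)) x) ∂μ)) atTop (nhds (∫ x, f x * GG T c g x ∂μ)) := by
  have hm : ∀ n : ℤ, Measurable (fun x => g ((T ^ (c * n)) x)) := fun n => hgm.comp (mp_zpow hT hT2 _).measurable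
  have h1 : Tendsto (fun N : ℕ => ∫ x, f x * shp N (fun n => g ((T ^ (c * n)) x)) ∂μ) atTop (nhds (∫ x, f x * GG T c g x ∂μ)) := by
    refine tendsto_integral_of_dominated_convergence (fun _ => (1:ℝ)) (fun N => ?_) (integrable_const _) (fun N => ?_) ?_
    · exact (hfm.mul (meas_shp hT hT2 N _ hm)).aestronglyMeasurable
    · refine Eventually.of_forall fun x => ?_
      rw [norm_mul]
      exact mul_le_one₀ (hf x) (norm_nonneg _) (norm_shp_le N _ fun n => hg _)
    · filter_upwards [GG_tendsto hT hT2 c hc g hgm hg] with x hx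
      exact hx.const_mul _
  refine h1.congr fun N => ?_
  unfold shp
  rw [← integral_finsetSum, ← integral_const_mul]
  · congr 1; funext x; rw [← mul_sum]; ring
  · intro n _
    refine integrable_bdd _ (hfm.mul (hm _)) (Eventually.of_forall fun x => ?_)
    rw [norm_mul]
    exact mul_le_one₀ (hf x) (norm_nonneg _) (hg _)

lemma GG_condExp (hT : MeasurePreserving T μ μ) (hT2 : Measurable T.symm) (c : ℤ) (hc : c ≠ 0) (g : X → ℂ) (hgm : Measurable g) (hg : ∀ x, ‖g x‖ ≤ 1) :
    GG T c g =ᵐ[μ] μ[g | invariantSets ⇑(T ^ c)] := by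
  have hgi : Integrable g μ := integrable_bdd g hgm (Eventually.of_forall hg)
  have hGi : Integrable (GG T c g) μ := integrable_bdd _ (GG_meas hT hT2 c g hgm) (GG_bound hT hT2 c hc g hgm hg)
  refine ae_eq_condExp_of_forall_setIntegral_eq (inv_le _) hgi (fun A _ _ => hGi.integrableOn) (fun A hA _ => ?_)
    (GG_smeas hT hT2 c g hgm hg).aestronglyMeasurable
  have hAi : ∀ n : ℕ, ∀ x, (T ^ (c * (n:ℤ))) x ∈ A ↔ x ∈ A := by
    intro n
    induction n with
    | zero => intro x; simp
    | succ n ih =>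
      intro x
      have e : (T ^ (c * ((n + 1 : ℕ):ℤ))) x = (T ^ c) ((T ^ (c * (n:ℤ))) x) := by
        rw [← Equiv.Perm.mul_apply, ← zpow_add]; congr 2; push_cast; ring
      rw [e, ← ih x]
      have := hA.2
      exact Set.ext_iff.1 this _
  have h1 := int_lim hT hT2 c hc (A.indicator 1) g (measurable_one.indicator hA.1) (fun x => by
    by_cases h : x ∈ A <;> simp [h]) hgm hg
  have h2 : ∀ n : ℕ, ∫ x, (A.indicator (1 : X → ℂ)) x * g ((T ^ (c * (n:ℤ))) x) ∂μ = ∫ x in A, g x ∂μ := by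
    intro n
    rw [← integral_indicator hA.1]
    have hmp := mp_zpow hT hT2 (c * n)
    have := integral_map (μ := μ) hmp.measurable.aemeasurable (f := A.indicator g) (hgm.indicator hA.1).aestronglyMeasurable
    rw [hmp.map_eq] at this
    rw [this]
    congr 1; funext x
    by_cases h : x ∈ A
    · rw [Set.indicator_of_mem h, Set.indicator_of_mem ((hAi n x).2 h)]; simp
    · rw [Set.indicator_of_notMem h, Set.indicator_of_notMem (mt (hAi n x).1 h)]; simp
  have h3 : Tendsto (fun N : ℕ => shp N (fun n => ∫ x, (A.indicator (1 : X → ℂ)) x * g ((T ^ (c * n)) x) ∂μ)) atTop (nhds (∫ x in A, g x ∂μ)) := by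
    refine tendsto_const_nhds.congr' ?_
    filter_upwards [eventually_ge_atTop 1] with N hN
    unfold shp
    rw [sum_congr rfl (fun n _ => h2 n), sum_const, card_range, nsmul_eq_mul, inv_mul_cancel_left₀]
    exact_mod_cast (by omega : N ≠ 0)
  rw [tendsto_nhds_unique h3 h1, ← integral_indicator hA.1]
  congr 1; funext x
  by_cases h : x ∈ A <;> simp [h]

theorem main_one (hT : MeasurePreserving T μ μ) (hT2 : Measurable T.symm) (a b : ℤ) (ha : a ≠ 0) (hb : b ≠ 0) (hab : a ≠ b)
    (f g : X → ℂ) (hfm : Measurable f) (hgm : Measurable g) (hf : ∀ x, ‖f x‖ ≤ 1) (hg : ∀ x, ‖g x‖ ≤ 1) :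
    ∃ L : X → ℂ, (∀ᵐ x ∂μ, Tendsto (fun N : ℕ => shp N (fun n => f ((T ^ (a * n)) x) * g ((T ^ (b * n)) x))) atTop (nhds (L x))) ∧
      ∫ x, L x ∂μ = ∫ x, (μ[f| invariantSets ⇑(T ^ (b - a))]) x * (μ[g| invariantSets ⇑(T ^ (b - a))]) x ∂μ := by
  have hc : b - a ≠ 0 := sub_ne_zero.2 hab.symm
  refine ⟨fun x => limUnder atTop (fun N : ℕ => shp N (fun n => f ((T ^ (a * n)) x) * g ((T ^ (b * n)) x))), ?_, ?_⟩
  · filter_upwards [sharp_conv μ T f g hT hT2 ha hb hab hfm hgm hf hg] with x hx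
    exact tendsto_nhds_limUnder hx
  have hm : ∀ n : ℤ, Measurable (fun x => f ((T ^ (a * n)) x) * g ((T ^ (b * n)) x)) := fun n =>
    (hfm.comp (mp_zpow hT hT2 _).measurable).mul (hgm.comp (mp_zpow hT hT2 _).measurable)
  have hbd : ∀ (n : ℤ) x, ‖f ((T ^ (a * n)) x) * g ((T ^ (b * n)) x)‖ ≤ 1 := fun n x => by
    rw [norm_mul]; exact mul_le_one₀ (hf _) (norm_nonneg _) (hg _)
  have h1 : Tendsto (fun N : ℕ => ∫ x, shp N (fun n => f ((T ^ (a * n)) x) * g ((T ^ (b * n)) x)) ∂μ) atTop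
      (nhds (∫ x, limUnder atTop (fun N : ℕ => shp N (fun n => f ((T ^ (a * n)) x) * g ((T ^ (b * n)) x))) ∂μ)) := by
    refine tendsto_integral_of_dominated_convergence (fun _ => (1:ℝ)) (fun N => ?_) (integrable_const _) (fun N => ?_) ?_
    · exact (meas_shp hT hT2 N _ hm).aestronglyMeasurable
    · exact Eventually.of_forall fun x => norm_shp_le N _ fun n => hbd n x
    · filter_upwards [sharp_conv μ T f g hT hT2 ha hb hab hfm hgm hf hg] with x hx
      exact tendsto_nhds_limUnder hx
  have h2 : ∀ n : ℤ, ∫ x, f ((T ^ (a * n)) x) * g ((T ^ (b * n)) x) ∂μ = ∫ x, f x * g ((T ^ ((b - a) * n)) x) ∂μ := by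
    intro n
    have hmp := mp_zpow hT hT2 (a * n)
    have := integral_map (μ := μ) hmp.measurable.aemeasurable (f := fun x => f x * g ((T ^ ((b - a) * n)) x))
      (hfm.mul (hgm.comp (mp_zpow hT hT2 _).measurable)).aestronglyMeasurable
    rw [hmp.map_eq] at this
    rw [this]
    congr 1; funext x
    rw [← Equiv.Perm.mul_apply (T ^ ((b - a) * n)), ← zpow_add]
    congr 4; ring
  have h3 := int_lim hT hT2 (b - a) hc f g hfm hf hgm hg
  have h4 : ∀ N : ℕ, ∫ x, shp N (fun n => f ((T ^ (a * n)) x) * g ((T ^ (b * n)) x)) ∂μ = 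
      shp N (fun n => ∫ x, f x * g ((T ^ ((b - a) * n)) x) ∂μ) := by
    intro N
    unfold shp
    rw [integral_const_mul, integral_finsetSum]
    · congr 1; exact sum_congr rfl fun n _ => h2 n
    · intro n _
      exact integrable_bdd _ (hm _) (Eventually.of_forall fun x => hbd _ x)
  simp only [h4] at h1
  rw [tendsto_nhds_unique h1 h3]
  have hfi : Integrable f μ := integrable_bdd f hfm (Eventually.of_forall hf)
  have hfg : Integrable (fun x => f x * GG T (b - a) g x) μ := by
    refine integrable_bdd _ (hfm.mul (GG_meas hT hT2 _ g hgm)) ?_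
    filter_upwards [GG_bound hT hT2 (b - a) hc g hgm hg] with x hx
    rw [norm_mul]; exact mul_le_one₀ (hf _) (norm_nonneg _) hx
  have h5 := condExp_bilin_of_stronglyMeasurable_right (μ := μ) (ContinuousLinearMap.mul ℝ ℂ)
    (GG_smeas hT hT2 (b - a) g hgm hg) hfg hfi
  rw [← integral_condExp (inv_le ⇑(T ^ (b - a)))]
  refine integral_congr_ae ?_
  filter_upwards [h5, GG_condExp hT hT2 (b - a) hc g hgm hg] with x h6 h7
  rw [← h7]
  exact h6

theorem main_bdd (hT : MeasurePreserving T μ μ) (hT2 : Measurable T.symm) (a b : ℤ) (ha : a ≠ 0) (hb : b ≠ 0) (hab : a ≠ b)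
    (f g : X → ℂ) (hfm : Measurable f) (hgm : Measurable g) (hf : ∃ C : ℝ, ∀ x, ‖f x‖ ≤ C) (hg : ∃ C : ℝ, ∀ x, ‖g x‖ ≤ C) :
    ∃ L : X → ℂ, (∀ᵐ x ∂μ, Tendsto (fun N : ℕ => shp N (fun n => f ((T ^ (a * n)) x) * g ((T ^ (b * n)) x))) atTop (nhds (L x))) ∧
      ∫ x, L x ∂μ = ∫ x, (μ[f| invariantSets ⇑(T ^ (b - a))]) x * (μ[g| invariantSets ⇑(T ^ (b - a))]) x ∂μ := by
  have hsc : ∀ f : X → ℂ, Measurable f → (∃ C : ℝ, ∀ x, ‖f x‖ ≤ C) → ∃ (c : ℂ) (f0 : X → ℂ), Measurable f0 ∧ (∀ x, ‖f0 x‖ ≤ 1) ∧ f = c • f0 := by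
    rintro f hfm ⟨C, hC⟩
    have hp : 0 < max C 1 := lt_max_of_lt_right one_pos
    refine ⟨((max C 1 : ℝ) : ℂ), fun x => ((max C 1 : ℝ) : ℂ)⁻¹ * f x, hfm.const_mul _, fun x => ?_, ?_⟩
    · rw [norm_mul, norm_inv, Complex.norm_real, Real.norm_of_nonneg hp.le]
      exact inv_mul_le_one_of_le₀ ((hC x).trans (le_max_left _ _)) hp.le
    · funext x
      rw [Pi.smul_apply, smul_eq_mul, mul_inv_cancel_left₀]
      exact_mod_cast hp.ne'
  obtain ⟨c, f0, hf0, hf1, rfl⟩ := hsc f hfm hf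
  obtain ⟨d, g0, hg0, hg1, rfl⟩ := hsc g hgm hg
  obtain ⟨L, hL, hL2⟩ := main_one hT hT2 a b ha hb hab f0 g0 hf0 hg0 hf1 hg1
  refine ⟨fun x => c * d * L x, ?_, ?_⟩
  · filter_upwards [hL] with x hx
    refine (hx.const_mul (c * d)).congr fun N => ?_
    unfold shp
    rw [mul_left_comm, mul_sum]
    congr 1
    refine sum_congr rfl fun n _ => ?_
    simp only [Pi.smul_apply, smul_eq_mul]; ring
  · rw [integral_const_mul, hL2, ← integral_const_mul]
    refine integral_congr_ae ?_
    filter_upwards [condExp_smul (μ := μ) c f0 (invariantSets ⇑(T ^ (b - a))), condExp_smul (μ := μ) d g0 (invariantSets ⇑(T ^ (b - a)))] with x h1 h2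
    rw [h1, h2]
    simp only [Pi.smul_apply, smul_eq_mul]; ring

end
end DR
end

open MeasureTheory Filter Finset

/-- The integral of the a.e. limit of the double recurrence averages
`(1/N) ∑_{n<N} f(T^{an}x) g(T^{bn}x)` equals `∫ E[f|I]·E[g|I] dμ`, where `I` is the
σ-algebra of `T^{b-a}`-invariant sets. -/
theorem integral_double_recurrence_limit {X : Type*} [MeasurableSpace X] (μ : Measure X)
    [IsProbabilityMeasure μ] (T : Equiv.Perm X) (hT : MeasurePreserving T μ μ)
    (hT' : Measurable T.symm)
    (a b : ℤ) (ha : a ≠ 0) (hb : b ≠ 0) (hab : a ≠ b)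
    (f g : X → ℂ) (hfm : Measurable f) (hgm : Measurable g)
    (hfb : ∃ C : ℝ, ∀ x, ‖f x‖ ≤ C) (hgb : ∃ C : ℝ, ∀ x, ‖g x‖ ≤ C) :
    ∃ L : X → ℂ,
      (∀ᵐ x ∂μ, Tendsto (fun N : ℕ =>
          (N : ℂ)⁻¹ * ∑ n ∈ Finset.range N,
            f ((T ^ (a * (n : ℤ))) x) * g ((T ^ (b * (n : ℤ))) x))
        atTop (nhds (L x))) ∧
      ∫ x, L x ∂μ = ∫ x, (μ[f| invariantSets (T ^ (b - a))]) x *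
        (μ[g| invariantSets (T ^ (b - a))]) x ∂μ := by
  exact DR.main_bdd hT hT' a b ha hb hab f g hfm hgm hfb hgb
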